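/- arXiv:2301.10699 — 7 statements merged into one kernel-verified Lean document; each statement's English description precedes it below -/
import Mathlib

section
/- For every k and every ε > 0 there exists N such that for all n ≥ N, no instance ([n],{Π_s}) of quantum k-SAT on n qubits is both satisfiable and ε-far from satisfiable by a product state. -/
open scoped Classical

namespace QkSAT

/-- The Hilbert space of the qubits indexed by the subset `C` of `[n]`,
with basis indexed by bit strings on `C`. -/
abbrev QVec (n : ℕ) (C : Finset (Fin n)) : Type := (↥C → Fin 2) → ℂ

/-- Extend an operator acting on the qubits in `s` to an operator on the qubits of `C ⊇ s`
which acts trivially on the qubits outside `s`. -/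
noncomputable def extendOp {n : ℕ} (s C : Finset (Fin n))
    (K : Matrix (↥s → Fin 2) (↥s → Fin 2) ℂ) :
    Matrix (↥C → Fin 2) (↥C → Fin 2) ℂ :=
  Matrix.of fun f g =>
    if hs : s ⊆ C then
      if ∀ i : ↥C, (i : Fin n) ∉ s → f i = g i then
        K (fun j => f ⟨j.1, hs j.2⟩) (fun j => g ⟨j.1, hs j.2⟩)
      else 0
    else 0

/-- An instance of quantum `k`-SAT on `n` qubits: for every `k`-element subset `s` of the
qubits, an orthogonal projection acting nontrivially only on the qubits in `s`, specified by
its matrix on the qubits in `s`. -/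
structure Instance (n k : ℕ) where
  K : (s : Finset (Fin n)) → Matrix (↥s → Fin 2) (↥s → Fin 2) ℂ
  isHermitian : ∀ s : Finset (Fin n), s.card = k → (K s).IsHermitian
  isIdempotent : ∀ s : Finset (Fin n), s.card = k → K s * K s = K s

/-- `∑_{s ∈ σ_k(C)} Π_s ψ` for a vector `ψ` on the qubits in `C`. -/
noncomputable def constraintSum {n k : ℕ} (I : Instance n k) (C : Finset (Fin n))
    (ψ : QVec n C) : QVec n C :=
  ∑ s ∈ Finset.powersetCard k C, (extendOp s C (I.K s)).mulVec ψ

/-- The restriction of the instance to the qubits in `C` is satisfiable. -/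
def SatisfiableAt {n k : ℕ} (I : Instance n k) (C : Finset (Fin n)) : Prop :=
  ∃ ψ : QVec n C, ψ ≠ 0 ∧ constraintSum I C ψ = 0

/-- The instance is satisfiable. -/
def Satisfiable {n k : ℕ} (I : Instance n k) : Prop :=
  SatisfiableAt I Finset.univ

/-- The product vector `⊗ᵢ φᵢ`. -/
def prodVec {ι : Type*} [Fintype ι] (φ : ι → (Fin 2 → ℂ)) : (ι → Fin 2) → ℂ :=
  fun f => ∏ i, φ i (f i)

/-- The instance is locally satisfiable by a product state at `C`. -/
def ProdSatisfiableAt {n k : ℕ} (I : Instance n k) (C : Finset (Fin n)) : Prop :=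
  ∃ φ : ↥C → (Fin 2 → ℂ), (∀ i, φ i ≠ 0) ∧ constraintSum I C (prodVec φ) = 0

/-- The instance is `ε`-far from satisfiable by a product state: whenever removing the
constraints indexed by `Sig` admits a (nonzero) product-state solution, `|Sig| ≥ ε n^k`. -/
def EpsFarFromProdSat {n k : ℕ} (I : Instance n k) (ε : ℝ) : Prop :=
  ∀ Sig : Finset (Finset (Fin n)),
    (∃ φ : ↥(Finset.univ : Finset (Fin n)) → (Fin 2 → ℂ), (∀ i, φ i ≠ 0) ∧
      ∑ s ∈ Finset.powersetCard k (Finset.univ : Finset (Fin n)) \ Sig,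
        (extendOp s Finset.univ (I.K s)).mulVec (prodVec φ) = 0) →
    ε * (n : ℝ) ^ k ≤ (Sig.card : ℝ)

/-- Extend a finite sequence to an infinite one by an arbitrary value. -/
noncomputable def extendSeq {α : Type*} [Nonempty α] {c : ℕ} (ω : Fin c → α) : ℕ → α :=
  fun l => if h : l < c then ω ⟨l, h⟩ else Classical.arbitrary α

theorem extendSeq_of_lt {α : Type*} [Nonempty α] {c : ℕ} (ω : Fin c → α) {l : ℕ} (h : l < c) :
    extendSeq ω l = ω ⟨l, h⟩ := by simp [extendSeq, h]

theorem card_pairs_eq_card_mul_card_diag {ι α : Type*} [Fintype ι] [DecidableEq ι] [Fintype α]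
    (τ : ι) (P : (ι → α) → α → Prop)
    (hP : ∀ ω i i', P (Function.update ω τ i') i ↔ P ω i) :
    (Finset.univ.filter fun p : (ι → α) × α => P p.1 p.2).card
      = Fintype.card α * (Finset.univ.filter fun ω : ι → α => P ω (ω τ)).card := by
  have h1 : (Finset.univ.filter fun p : (ι → α) × α => P p.1 p.2).card
      = (Finset.univ.filter fun p : (ι → α) × α => P p.1 (p.1 τ)).card := by
    refine Finset.card_nbij' (fun p => (Function.update p.1 τ p.2, p.1 τ))
      (fun p => (Function.update p.1 τ p.2, p.1 τ)) ?_ ?_ ?_ ?_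
    · rintro ⟨ω, i⟩ h; simpa [hP] using h
    · rintro ⟨ω, i⟩ h; simpa [hP] using h
    · rintro ⟨ω, i⟩ h; simp
    · rintro ⟨ω, i⟩ h; simp
  have h2 : (Finset.univ.filter fun p : (ι → α) × α => P p.1 (p.1 τ))
      = (Finset.univ.filter fun ω : ι → α => P ω (ω τ)) ×ˢ Finset.univ := by
    ext ⟨ω, i⟩; simp
  rw [h1, h2, Finset.card_product, mul_comm, Finset.card_univ]

/-- The span of the values of `p` at the sample points with index in `[r, r + τ)`. -/
def sampleSpan {α V : Type*} [AddCommGroup V] [Module ℂ V] (p : α → V) (ω : ℕ → α) (r τ : ℕ) :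
    Submodule ℂ V :=
  Submodule.span ℂ ((fun l => p (ω l)) '' Set.Ico r (r + τ))

theorem sampleSpan_mono {α V : Type*} [AddCommGroup V] [Module ℂ V] (p : α → V) (ω : ℕ → α)
    (r : ℕ) {τ τ' : ℕ} (h : τ ≤ τ') : sampleSpan p ω r τ ≤ sampleSpan p ω r τ' :=
  Submodule.span_mono (Set.image_mono (Set.Ico_subset_Ico_right (by omega)))

theorem sampleSpan_congr {α V : Type*} [AddCommGroup V] [Module ℂ V] (p : α → V) {ω ω' : ℕ → α}
    (r τ : ℕ) (h : ∀ l, l < r + τ → ω l = ω' l) : sampleSpan p ω r τ = sampleSpan p ω' r τ := by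
  unfold sampleSpan
  congr 1
  refine Set.image_congr fun l hl => ?_
  rw [h l hl.2]

theorem card_new_le {α V : Type*} [AddCommGroup V] [Module ℂ V] (G : Submodule ℂ V)
    [FiniteDimensional ℂ G] (p : α → V) (hp : ∀ i, p i ∈ G) (ω : ℕ → α) (r T : ℕ) :
    ((Finset.range T).filter fun τ => p (ω (r + τ)) ∉ sampleSpan p ω r τ).card
      ≤ Module.finrank ℂ G := by
  have hle : ∀ τ, sampleSpan p ω r τ ≤ G := fun τ => by
    refine Submodule.span_le.2 ?_
    rintro _ ⟨l, -, rfl⟩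
    exact hp _
  have hfd : ∀ τ, FiniteDimensional ℂ (sampleSpan p ω r τ) := fun τ =>
    Submodule.finiteDimensional_of_le (hle τ)
  refine le_trans ?_ (Submodule.finrank_mono (hle T))
  induction T with
  | zero => simp
  | succ T ih =>
    rw [Finset.range_add_one, Finset.filter_insert]
    by_cases h : p (ω (r + T)) ∈ sampleSpan p ω r T
    · rw [if_neg (not_not.2 h)]
      exact ih.trans (Submodule.finrank_mono (sampleSpan_mono p ω r (Nat.le_succ T)))
    · rw [if_pos h, Finset.card_insert_of_notMem (by simp)]
      have hlt : sampleSpan p ω r T < sampleSpan p ω r (T + 1) := by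
        refine lt_of_le_of_ne (sampleSpan_mono p ω r (Nat.le_succ T)) fun he => h ?_
        rw [he]
        exact Submodule.subset_span ⟨r + T, ⟨by omega, by omega⟩, rfl⟩
      exact lt_of_le_of_lt ih (Submodule.finrank_lt_finrank_of_lt hlt)

/-- A random sample of `T` points spans almost all values of a function into a
finite-dimensional space, even if the function depends on earlier samples. -/
theorem card_notMem_sampleSpan_le {α V : Type*} [Fintype α] [Nonempty α] [AddCommGroup V]
    [Module ℂ V] (G : Submodule ℂ V) [FiniteDimensional ℂ G] (p : (ℕ → α) → α → V)
    (hp : ∀ ω i, p ω i ∈ G) {c r T : ℕ} (hc : r + T ≤ c)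
    (hp' : ∀ ω ω' : ℕ → α, (∀ l < r, ω l = ω' l) → p ω = p ω') :
    T * (Finset.univ.filter fun q : (Fin c → α) × α =>
        p (extendSeq q.1) q.2 ∉ sampleSpan (p (extendSeq q.1)) (extendSeq q.1) r T).card
      ≤ Module.finrank ℂ G * Fintype.card α ^ (c + 1) := by
  have key : ∀ τ ∈ Finset.range T, (Finset.univ.filter fun q : (Fin c → α) × α =>
        p (extendSeq q.1) q.2 ∉ sampleSpan (p (extendSeq q.1)) (extendSeq q.1) r T).card
      ≤ Fintype.card α * (Finset.univ.filter fun ω : Fin c → α =>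
        p (extendSeq ω) (extendSeq ω (r + τ))
          ∉ sampleSpan (p (extendSeq ω)) (extendSeq ω) r τ).card := by
    intro τ hτ
    rw [Finset.mem_range] at hτ
    have hlt : r + τ < c := by omega
    have h := card_pairs_eq_card_mul_card_diag (α := α) (⟨r + τ, hlt⟩ : Fin c)
      (fun ω i => p (extendSeq ω) i ∉ sampleSpan (p (extendSeq ω)) (extendSeq ω) r τ) (by
        intro ω i i'
        have hu : ∀ l, l < r + τ →
            extendSeq (Function.update ω ⟨r + τ, hlt⟩ i') l = extendSeq ω l := by
          intro l hl
          rw [extendSeq_of_lt _ (by omega), extendSeq_of_lt _ (by omega), Function.update_of_ne]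
          simp only [ne_eq, Fin.mk.injEq]; omega
        rw [hp' _ (extendSeq ω) fun l hl => hu l (by omega), sampleSpan_congr _ r τ hu])
    simp only [extendSeq_of_lt _ hlt]
    refine le_trans (Finset.card_le_card fun q hq => ?_) (h.trans (by congr!)).le
    simp only [Finset.mem_filter, Finset.mem_univ, true_and] at hq ⊢
    exact fun hm => hq (sampleSpan_mono _ _ r hτ.le hm)
  calc _ = ∑ τ ∈ Finset.range T, (Finset.univ.filter fun q : (Fin c → α) × α =>
        p (extendSeq q.1) q.2 ∉ sampleSpan (p (extendSeq q.1)) (extendSeq q.1) r T).card := by simp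
    _ ≤ ∑ τ ∈ Finset.range T, Fintype.card α * (Finset.univ.filter fun ω : Fin c → α =>
        p (extendSeq ω) (extendSeq ω (r + τ))
          ∉ sampleSpan (p (extendSeq ω)) (extendSeq ω) r τ).card := Finset.sum_le_sum key
    _ = Fintype.card α * ∑ ω : Fin c → α, ((Finset.range T).filter fun τ =>
        p (extendSeq ω) (extendSeq ω (r + τ))
          ∉ sampleSpan (p (extendSeq ω)) (extendSeq ω) r τ).card := by
      rw [← Finset.mul_sum]
      simp only [Finset.card_filter]
      rw [Finset.sum_comm]
    _ ≤ Fintype.card α * ∑ _ω : Fin c → α, Module.finrank ℂ G :=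
      Nat.mul_le_mul_left _ (Finset.sum_le_sum fun ω _ => card_new_le G _ (hp _) _ r T)
    _ = _ := by
      simp only [Finset.sum_const, Finset.card_univ, Fintype.card_pi, Finset.prod_const,
        Fintype.card_fin, smul_eq_mul]
      ring

/-- Gram matrix of the vectors indexed by `σ`. -/
noncomputable def gramOn {ι J : Type*} [Fintype J] (σ : Finset ι) (v : ι → J → ℂ) :
    Matrix σ σ ℂ :=
  Matrix.of fun a a' => ∑ b, v a b * star (v a' b)

/-- Component `c` of a division-free form of the residual of `g` modulo the span of the vectors
indexed by `σ`. -/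
noncomputable def residual {ι J : Type*} [Fintype J] (σ : Finset ι) (v : ι → J → ℂ) (c : J)
    (g : J → ℂ) : ℂ :=
  (gramOn σ v).det * g c
    - ∑ a : σ, ∑ a' : σ, (∑ b, g b * star (v a b)) * (gramOn σ v).adjugate a a' * v a' c

theorem isLinearMap_residual {ι J : Type*} [Fintype J] (σ : Finset ι) (v : ι → J → ℂ) (c : J) :
    IsLinearMap ℂ (residual σ v c) where
  map_add g g' := by
    simp only [residual, Pi.add_apply, add_mul, Finset.sum_add_distrib]
    ring
  map_smul z g := by
    simp only [residual, Pi.smul_apply, smul_eq_mul, mul_assoc, ← Finset.mul_sum]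
    ring

theorem residual_sum {ι J κ : Type*} [Fintype J] (σ : Finset ι) (v : ι → J → ℂ) (c : J)
    (K : Finset κ) (a : κ → ℂ) (g : κ → J → ℂ) :
    residual σ v c (∑ i ∈ K, a i • g i) = ∑ i ∈ K, a i * residual σ v c (g i) := by
  have h := isLinearMap_residual σ v c
  refine (map_sum (IsLinearMap.mk' _ h) (fun i => a i • g i) K).trans ?_
  exact Finset.sum_congr rfl fun i _ => h.map_smul _ _

theorem isUnit_det_gramOn {ι J : Type*} [Fintype J] (σ : Finset ι) (v : ι → J → ℂ)
    (h : LinearIndependent ℂ fun a : σ => v a) : IsUnit (gramOn σ v).det := by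
  rw [isUnit_iff_ne_zero]
  intro h0
  obtain ⟨w, hw, hw0⟩ := Matrix.exists_vecMul_eq_zero_iff.2 h0
  apply hw
  have hz : ∀ b, ∑ a, w a * v a b = 0 := by
    have h1 : ∑ b, (∑ a, w a * v a b) * star (∑ a, w a * v a b) = 0 := by
      have : ∑ b, (∑ a, w a * v a b) * star (∑ a, w a * v a b)
          = ∑ a', Matrix.vecMul w (gramOn σ v) a' * star (w a') := by
        simp only [Matrix.vecMul, dotProduct, gramOn, Matrix.of_apply, star_sum, star_mul',
          Finset.sum_mul, Finset.mul_sum]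
        rw [Finset.sum_comm]
        refine Finset.sum_congr rfl fun a' _ => ?_
        rw [Finset.sum_comm]
        refine Finset.sum_congr rfl fun a _ => Finset.sum_congr rfl fun b _ => by ring
      rw [this, hw0]; simp
    have h2 : ∀ z : ℂ, z * star z = ((Complex.normSq z : ℝ) : ℂ) := fun z => Complex.mul_conj z
    simp only [h2] at h1
    rw [← Complex.ofReal_sum, Complex.ofReal_eq_zero,
      Finset.sum_eq_zero_iff_of_nonneg (fun _ _ => Complex.normSq_nonneg _)] at h1
    exact fun b => Complex.normSq_eq_zero.1 (h1 b (Finset.mem_univ b))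
  have := Fintype.linearIndependent_iff.1 h w (by ext b; simpa using hz b)
  exact funext this

theorem exists_residual_eq_zero_iff {ι J : Type*} [Fintype ι] [Fintype J] (v : ι → J → ℂ) :
    ∃ σ : Finset ι, ∀ g : J → ℂ,
      (∀ c, residual σ v c g = 0) ↔ g ∈ Submodule.span ℂ (Set.range v) := by
  obtain ⟨s, hs, hspan⟩ : ∃ s : Finset ι, LinearIndependent ℂ (fun a : s => v a) ∧
      Submodule.span ℂ (Set.range fun a : s => v a) = Submodule.span ℂ (Set.range v) := by
    obtain ⟨κ, a, ha, hsp, hli⟩ := exists_linearIndependent' ℂ v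
    have : Fintype κ := Fintype.ofInjective a ha
    refine ⟨Finset.univ.image a, ?_, ?_⟩
    · choose e he using fun b : Finset.univ.image a => Finset.mem_image.1 b.2
      have hinj : Function.Injective e := fun b b' hb => by
        ext1
        rw [← (he b).2, ← (he b').2, hb]
      have h := hli.comp e hinj
      have h2 : (v ∘ a) ∘ e = fun b : Finset.univ.image a => v b :=
        funext fun b => congrArg v (he b).2
      exact h2 ▸ h
    · rw [← hsp]
      congr 1
      ext y; simp
  refine ⟨s, fun g => ?_⟩
  have hu := isUnit_det_gramOn s v hs
  have hne := hu.ne_zero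
  rw [← hspan]
  constructor
  · intro h
    have hg : g = ∑ a' : s, ((gramOn s v).det⁻¹ *
        ∑ a : s, (∑ b, g b * star (v a b)) * (gramOn s v).adjugate a a') • v a' := by
      ext c
      have := h c
      rw [residual, sub_eq_zero] at this
      rw [Finset.sum_comm] at this
      simp only [Finset.sum_apply, Pi.smul_apply, smul_eq_mul, mul_assoc]
      rw [← Finset.mul_sum, eq_inv_mul_iff_mul_eq₀ hne, this]
      simp only [Finset.sum_mul, mul_assoc]
    rw [hg]
    exact Submodule.sum_mem _ fun a' _ => Submodule.smul_mem _ _ (Submodule.subset_span ⟨a', rfl⟩)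
  · intro h c
    obtain ⟨w, rfl⟩ := (Submodule.mem_span_range_iff_exists_fun ℂ).1 h
    have h1 : ∀ a : s, ∑ b, (∑ i : s, w i • v i) b * star (v a b)
        = Matrix.vecMul w (gramOn s v) a := by
      intro a
      simp only [Matrix.vecMul, dotProduct, gramOn, Matrix.of_apply, Finset.sum_apply,
        Pi.smul_apply, smul_eq_mul, Finset.sum_mul, Finset.mul_sum]
      rw [Finset.sum_comm]
      simp only [mul_assoc]
    have h2 : ∀ a' : s, ∑ a : s, Matrix.vecMul w (gramOn s v) a * (gramOn s v).adjugate a a'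
        = (gramOn s v).det * w a' := by
      intro a'
      change Matrix.vecMul (Matrix.vecMul w (gramOn s v)) (gramOn s v).adjugate a' = _
      rw [Matrix.vecMul_vecMul, Matrix.mul_adjugate]
      simp [Matrix.vecMul_smul]
    unfold residual
    simp only [h1]
    rw [Finset.sum_comm]
    simp only [← Finset.sum_mul, h2]
    simp only [Finset.sum_apply, Pi.smul_apply, smul_eq_mul, Finset.mul_sum, mul_assoc, sub_self]

/-- The span of `1` and of the coordinates with index below `r` and their conjugates. -/
def coordSpan (r : ℕ) : Submodule ℂ ((ℕ → Fin 2 → ℂ) → ℂ) :=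
  Submodule.span ℂ ({1} ∪ Set.range (fun (p : Fin r × Fin 2) (x : ℕ → Fin 2 → ℂ) => x p.1 p.2)
    ∪ Set.range (fun (p : Fin r × Fin 2) (x : ℕ → Fin 2 → ℂ) => star (x p.1 p.2)))

theorem one_le_coordSpan (r : ℕ) : 1 ≤ coordSpan r :=
  Submodule.one_le.2 (Submodule.subset_span (Or.inl (Or.inl rfl)))

theorem coordSpan_fg (r : ℕ) : (coordSpan r).FG :=
  Submodule.fg_span (((Set.finite_singleton _).union (Set.finite_range _)).union
    (Set.finite_range _))

instance (r d : ℕ) : FiniteDimensional ℂ ↥(coordSpan r ^ d) :=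
  Module.Finite.of_fg ((coordSpan_fg r).pow d)

theorem coordSpan_pow_mono (r : ℕ) {d e : ℕ} (h : d ≤ e) : coordSpan r ^ d ≤ coordSpan r ^ e :=
  pow_le_pow_right' (one_le_coordSpan r) h

theorem const_mem_coordSpan_pow (r d : ℕ) (z : ℂ) : (fun _ => z) ∈ coordSpan r ^ d := by
  have h : (1 : (ℕ → Fin 2 → ℂ) → ℂ) ∈ coordSpan r ^ d :=
    Submodule.one_le.1 (one_le_pow_of_one_le' (one_le_coordSpan r) d)
  have := Submodule.smul_mem _ z h
  convert this using 1
  ext x; simp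

theorem mul_mem_coordSpan_pow {r d e : ℕ} {φ ψ : (ℕ → Fin 2 → ℂ) → ℂ}
    (hφ : φ ∈ coordSpan r ^ d) (hψ : ψ ∈ coordSpan r ^ e) :
    (fun x => φ x * ψ x) ∈ coordSpan r ^ (d + e) := by
  rw [pow_add]; exact Submodule.mul_mem_mul hφ hψ

theorem const_mul_mem_coordSpan_pow {r d : ℕ} {φ : (ℕ → Fin 2 → ℂ) → ℂ} (z : ℂ)
    (hφ : φ ∈ coordSpan r ^ d) : (fun x => z * φ x) ∈ coordSpan r ^ d :=
  Submodule.smul_mem _ z hφ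

theorem sum_mem_coordSpan_pow {κ : Type*} {r d : ℕ} (K : Finset κ)
    (φ : κ → (ℕ → Fin 2 → ℂ) → ℂ) (hφ : ∀ i ∈ K, φ i ∈ coordSpan r ^ d) :
    (fun x => ∑ i ∈ K, φ i x) ∈ coordSpan r ^ d := by
  have := Submodule.sum_mem _ hφ
  convert this using 1
  ext x; simp

theorem prod_mem_coordSpan_pow {κ : Type*} {r d : ℕ} (K : Finset κ)
    (φ : κ → (ℕ → Fin 2 → ℂ) → ℂ) (hφ : ∀ i ∈ K, φ i ∈ coordSpan r ^ d) :
    (fun x => ∏ i ∈ K, φ i x) ∈ coordSpan r ^ (d * K.card) := by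
  induction K using Finset.induction_on with
  | empty => simpa using const_mem_coordSpan_pow r 0 1
  | insert i K hi ih =>
    simp only [Finset.prod_insert hi, Finset.card_insert_of_notMem hi, mul_add, mul_one]
    rw [add_comm]
    exact mul_mem_coordSpan_pow (hφ i (Finset.mem_insert_self i K))
      (ih fun j hj => hφ j (Finset.mem_insert_of_mem hj))

theorem det_mem_coordSpan_pow {κ : Type*} [Fintype κ] [DecidableEq κ] {r d : ℕ}
    (A : (ℕ → Fin 2 → ℂ) → Matrix κ κ ℂ) (hA : ∀ a b, (fun x => A x a b) ∈ coordSpan r ^ d) :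
    (fun x => (A x).det) ∈ coordSpan r ^ (d * Fintype.card κ) := by
  simp only [Matrix.det_apply']
  refine sum_mem_coordSpan_pow _ _ fun τ _ => ?_
  exact const_mul_mem_coordSpan_pow _
    (prod_mem_coordSpan_pow Finset.univ _ fun i _ => hA _ _)

theorem residual_mem_coordSpan_pow {ι J : Type*} [Fintype ι] [Fintype J] {r d : ℕ}
    (σ : Finset ι) (v : (ℕ → Fin 2 → ℂ) → ι → J → ℂ) (g : (ℕ → Fin 2 → ℂ) → J → ℂ)
    (hv : ∀ a b, (fun x => v x a b) ∈ coordSpan r ^ d)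
    (hv' : ∀ a b, (fun x => star (v x a b)) ∈ coordSpan r ^ d)
    (hg : ∀ b, (fun x => g x b) ∈ coordSpan r ^ d) (c : J) :
    (fun x => residual σ (v x) c (g x)) ∈ coordSpan r ^ (3 * d + 2 * d * Fintype.card ι) := by
  have hgram : ∀ a b, (fun x => gramOn σ (v x) a b) ∈ coordSpan r ^ (2 * d) := fun a b => by
    rw [two_mul]
    exact sum_mem_coordSpan_pow _ _ fun j _ => mul_mem_coordSpan_pow (hv _ _) (hv' _ _)
  have hle : 2 * d * Fintype.card σ ≤ 2 * d * Fintype.card ι :=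
    Nat.mul_le_mul_left _ (by simpa using σ.card_le_univ)
  have hdet := coordSpan_pow_mono r hle (det_mem_coordSpan_pow _ hgram)
  have hadj : ∀ a a', (fun x => (gramOn σ (v x)).adjugate a a')
      ∈ coordSpan r ^ (2 * d * Fintype.card ι) := fun a a' => by
    refine coordSpan_pow_mono r hle ?_
    simp only [Matrix.adjugate_apply]
    refine det_mem_coordSpan_pow _ fun b b' => ?_
    by_cases hb : b = a'
    · simp only [hb, Matrix.updateRow_self]
      exact const_mem_coordSpan_pow _ _ _
    · simp only [Matrix.updateRow_ne hb]
      exact hgram _ _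
  refine Submodule.sub_mem (coordSpan r ^ (3 * d + 2 * d * Fintype.card ι))
    (x := fun x => (gramOn σ (v x)).det * g x c)
    (y := fun x => ∑ a : σ, ∑ a' : σ, (∑ b, g x b * star (v x a b)) *
      (gramOn σ (v x)).adjugate a a' * v x a' c) ?_ ?_
  · exact coordSpan_pow_mono r (by omega) (mul_mem_coordSpan_pow hdet (hg c))
  · refine sum_mem_coordSpan_pow _ _ fun a _ => sum_mem_coordSpan_pow _ _ fun a' _ => ?_
    have h1 : (fun x => ∑ b, g x b * star (v x a b)) ∈ coordSpan r ^ (d + d) :=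
      sum_mem_coordSpan_pow _ _ fun b _ => mul_mem_coordSpan_pow (hg b) (hv' _ _)
    exact coordSpan_pow_mono r (by omega)
      (mul_mem_coordSpan_pow (mul_mem_coordSpan_pow h1 (hadj a a')) (hv a' c))

/-- Evaluation of a multilinear form, given by its coefficients, at a tuple of vectors. -/
noncomputable def evalForm {k : ℕ} (w : (Fin k → Fin 2) → ℂ) (y : Fin k → Fin 2 → ℂ) : ℂ :=
  ∑ h, w h * ∏ l, y l (h l)

theorem evalForm_update {k : ℕ} (w : (Fin k → Fin 2) → ℂ) (y : Fin k → Fin 2 → ℂ) (j : Fin k)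
    (a : Fin 2 → ℂ) :
    ∑ b, a b * evalForm w (Function.update y j (Pi.single b 1))
      = evalForm w (Function.update y j a) := by
  have h : ∀ (z : Fin 2 → ℂ) (h : Fin k → Fin 2), ∏ l, Function.update y j z l (h l)
      = z (h j) * ∏ l ∈ Finset.univ.erase j, y l (h l) := fun z h => by
    rw [← Finset.mul_prod_erase _ _ (Finset.mem_univ j), Function.update_self]
    congr 1
    refine Finset.prod_congr rfl fun l hl => ?_
    rw [Function.update_of_ne (Finset.ne_of_mem_erase hl)]
  simp only [evalForm, h, Finset.mul_sum]
  rw [Finset.sum_comm]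
  refine Finset.sum_congr rfl fun g _ => ?_
  rw [Finset.sum_eq_single (g j)]
  · simp; ring
  · intro b _ hb; simp [hb.symm]
  · simp

theorem evalForm_single {k : ℕ} (w : (Fin k → Fin 2) → ℂ) (g : Fin k → Fin 2) :
    evalForm w (fun l => Pi.single (g l) 1) = w g := by
  unfold evalForm
  rw [Finset.sum_eq_single g]
  · simp
  · intro h _ hne
    obtain ⟨l, hl⟩ := Function.ne_iff.1 hne
    rw [Finset.prod_eq_zero (Finset.mem_univ l) (by simp [hl]), mul_zero]
  · simp

/-- The partially evaluated constraint: the first `j` arguments are placed at `s` and left free,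
the remaining ones are placed at sample points and evaluated at the corresponding vectors. -/
noncomputable def slice {Ω P : Type*} {k : ℕ}
    (F : (Fin k → Ω) → (Fin k → Fin 2) → (Fin k → Fin 2) → ℂ) (j : ℕ) (ω : P → Ω)
    (x : P → Fin 2 → ℂ) (s : Fin k → Ω) (q : Fin k → P) (f : Fin k → Fin 2) :
    (Fin k → Fin 2) → ℂ := fun g =>
  evalForm (F (fun l => if (l : ℕ) < j then s l else ω (q l)) f)
    (fun l => if (l : ℕ) < j then Pi.single (g l) 1 else x (q l))

/-- Contraction of the `j`-th tensor factor with `a`. -/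
noncomputable def contract {k : ℕ} (j : Fin k) (a : Fin 2 → ℂ) :
    ((Fin k → Fin 2) → ℂ) →ₗ[ℂ] ((Fin k → Fin 2) → ℂ) where
  toFun u g := ∑ b, a b * u (Function.update g j b)
  map_add' u v := by ext g; simp [mul_add, Finset.sum_add_distrib]
  map_smul' z u := by ext g; simp; ring

theorem contract_apply {k : ℕ} (j : Fin k) (a : Fin 2 → ℂ) (u : (Fin k → Fin 2) → ℂ)
    (g : Fin k → Fin 2) : contract j a u g = ∑ b, a b * u (Function.update g j b) := rfl

theorem contract_eq_sum_single {k : ℕ} (j : Fin k) (a : Fin 2 → ℂ) (u : (Fin k → Fin 2) → ℂ) :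
    contract j a u = ∑ b, a b • contract j (Pi.single b 1) u := by
  ext g
  simp [contract_apply, Pi.single_apply]

section slices

variable {Ω P : Type*} {k : ℕ} (F : (Fin k → Ω) → (Fin k → Fin 2) → (Fin k → Fin 2) → ℂ)

theorem contract_slice (j : Fin k) (ω : P → Ω) (x : P → Fin 2 → ℂ) (s : Fin k → Ω)
    (q : Fin k → P) (f : Fin k → Fin 2) (p : P) :
    contract j (x p) (slice F (j + 1) ω x (Function.update s j (ω p)) q f)
      = slice F j ω x s (Function.update q j p) f := by
  ext g
  rw [contract_apply]
  have h1 : (fun l : Fin k => if (l : ℕ) < (j : ℕ) + 1 then Function.update s j (ω p) l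
        else ω (q l))
      = fun l : Fin k => if (l : ℕ) < j then s l else ω (Function.update q j p l) := by
    ext1 l
    rcases lt_trichotomy (l : ℕ) j with h | h | h
    · have : l ≠ j := fun h' => by subst h'; omega
      simp [h, this, show (l : ℕ) < j + 1 by omega]
    · have : l = j := Fin.ext h
      subst this; simp
    · have : l ≠ j := fun h' => by subst h'; omega
      simp [show ¬ (l : ℕ) < j by omega, this, show ¬ (l : ℕ) < j + 1 by omega]
  have h2 : ∀ b, (fun l : Fin k => if (l : ℕ) < (j : ℕ) + 1 then
        (Pi.single (Function.update g j b l) 1 : Fin 2 → ℂ) else x (q l))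
      = Function.update (fun l : Fin k => if (l : ℕ) < j then Pi.single (g l) 1
        else x (Function.update q j p l)) j (Pi.single b 1) := by
    intro b
    ext1 l
    rcases lt_trichotomy (l : ℕ) j with h | h | h
    · have : l ≠ j := fun h' => by subst h'; omega
      simp [this, show (l : ℕ) < j + 1 by omega, show l < j from h]
    · have : l = j := Fin.ext h
      subst this; simp
    · have : l ≠ j := fun h' => by subst h'; omega
      simp [this, show ¬ (l : ℕ) < j + 1 by omega, show ¬ l < j from not_lt.2 h.le]
  simp only [slice, h1, h2]
  rw [evalForm_update]
  congr 1
  rw [Function.update_eq_self_iff]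
  simp

theorem slice_congr_left (j : ℕ) (ω : P → Ω) (x : P → Fin 2 → ℂ) {s s' : Fin k → Ω}
    (h : ∀ l : Fin k, (l : ℕ) < j → s l = s' l) (q : Fin k → P) (f : Fin k → Fin 2) :
    slice F j ω x s q f = slice F j ω x s' q f := by
  unfold slice
  have : (fun l : Fin k => if (l : ℕ) < j then s l else ω (q l))
      = fun l : Fin k => if (l : ℕ) < j then s' l else ω (q l) := by
    ext1 l
    split_ifs with hl
    · exact h l hl
    · rfl
  rw [this]

theorem slice_top (ω : P → Ω) (x : P → Fin 2 → ℂ) (s : Fin k → Ω) (q : Fin k → P)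
    (f : Fin k → Fin 2) : slice F k ω x s q f = F s f := by
  ext g
  simp [slice, evalForm_single]

theorem slice_zero (ω : P → Ω) (x : P → Fin 2 → ℂ) (s : Fin k → Ω) (q : Fin k → P)
    (f g : Fin k → Fin 2) :
    slice F 0 ω x s q f g = evalForm (F (ω ∘ q) f) (x ∘ q) := by
  simp only [slice, Nat.not_lt_zero, if_false]; rfl

/-- The span of all slices at level `j` over the first `r` sample points. -/
noncomputable def sliceSpan (j : ℕ) (r : ℕ) (ω : ℕ → Ω) (x : ℕ → Fin 2 → ℂ) (s : Fin k → Ω) :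
    Submodule ℂ ((Fin k → Fin 2) → ℂ) :=
  Submodule.span ℂ (Set.range fun p : (Fin k → Fin r) × (Fin k → Fin 2) =>
    slice F j ω x s (fun l => p.1 l) p.2)

theorem slice_mem_sliceSpan (j : ℕ) {r : ℕ} (ω : ℕ → Ω) (x : ℕ → Fin 2 → ℂ) (s : Fin k → Ω)
    {q : Fin k → ℕ} (hq : ∀ l, q l < r) (f : Fin k → Fin 2) :
    slice F j ω x s q f ∈ sliceSpan F j r ω x s :=
  Submodule.subset_span ⟨(fun l => ⟨q l, hq l⟩, f), rfl⟩

theorem sliceSpan_mono (j : ℕ) {r r' : ℕ} (h : r ≤ r') (ω : ℕ → Ω) (x : ℕ → Fin 2 → ℂ)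
    (s : Fin k → Ω) : sliceSpan F j r ω x s ≤ sliceSpan F j r' ω x s := by
  refine Submodule.span_le.2 ?_
  rintro _ ⟨p, rfl⟩
  exact slice_mem_sliceSpan F j ω x s (fun l => (p.1 l).2.trans_le h) p.2

theorem sliceSpan_congr_left (j r : ℕ) (ω : ℕ → Ω) (x : ℕ → Fin 2 → ℂ) {s s' : Fin k → Ω}
    (h : ∀ l : Fin k, (l : ℕ) < j → s l = s' l) :
    sliceSpan F j r ω x s = sliceSpan F j r ω x s' := by
  unfold sliceSpan
  simp only [slice_congr_left F j ω x h]

theorem contract_slice_mem (j : Fin k) {r r' p : ℕ} (hr : r ≤ r') (hp : p < r') (ω : ℕ → Ω)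
    (x : ℕ → Fin 2 → ℂ) (s : Fin k → Ω) {q : Fin k → ℕ} (hq : ∀ l, q l < r)
    (f : Fin k → Fin 2) :
    contract j (x p) (slice F (j + 1) ω x (Function.update s j (ω p)) q f)
      ∈ sliceSpan F j r' ω x s := by
  rw [contract_slice]
  refine slice_mem_sliceSpan F j ω x s (fun l => ?_) f
  rw [Function.update_apply]
  split_ifs
  · exact hp
  · exact (hq l).trans_le hr

theorem sliceSpan_zero (r : ℕ) (ω : ℕ → Ω) (x : ℕ → Fin 2 → ℂ)
    (h : ∀ q : Fin k → ℕ, (∀ l, q l < r) → ∀ f, evalForm (F (ω ∘ q) f) (x ∘ q) = 0)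
    (s : Fin k → Ω) : sliceSpan F 0 r ω x s = ⊥ := by
  refine Submodule.span_eq_bot.2 ?_
  rintro _ ⟨p, rfl⟩
  ext g
  refine (slice_zero F ω x s _ _ g).trans ?_
  exact h _ (fun l => (p.1 l).2) _

/-- The assignment `a i` at `i` fails to be compatible with the slices at `s` in direction `j`. -/
def Violates (r : ℕ) (ω : ℕ → Ω) (x : ℕ → Fin 2 → ℂ) (a : Fin 2 → ℂ) (j : Fin k)
    (s : Fin k → Ω) (i : Ω) : Prop :=
  ∃ p : (Fin k → Fin r) × (Fin k → Fin 2),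
    contract j a (slice F (j + 1) ω x (Function.update s j i) (fun l => p.1 l) p.2)
      ∉ sliceSpan F j r ω x s

theorem violates_update_iff (r : ℕ) (ω : ℕ → Ω) (x : ℕ → Fin 2 → ℂ) (a : Fin 2 → ℂ) (j : Fin k)
    (s : Fin k → Ω) (i i' : Ω) :
    Violates F r ω x a j (Function.update s j i') i ↔ Violates F r ω x a j s i := by
  unfold Violates
  rw [Function.update_idem, sliceSpan_congr_left F j r ω x (s := Function.update s j i') (s' := s)]
  intro l hl
  rw [Function.update_of_ne]
  rintro rfl
  omega

theorem evalForm_eq_zero_of_not_violates {r : ℕ} (hr : 0 < r) (ω : ℕ → Ω) (x : ℕ → Fin 2 → ℂ)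
    (h0 : ∀ q : Fin k → ℕ, (∀ l, q l < r) → ∀ f, evalForm (F (ω ∘ q) f) (x ∘ q) = 0)
    (a : Ω → Fin 2 → ℂ) (t : Fin k → Ω) (h : ∀ j, ¬ Violates F r ω x (a (t j)) j t (t j))
    (f : Fin k → Fin 2) : evalForm (F t f) (a ∘ t) = 0 := by
  have key : ∀ d j : ℕ, j + d = k → slice F j id a t t f ∈ sliceSpan F j r ω x t := by
    intro d
    induction d with
    | zero =>
      intro j hj
      obtain rfl : j = k := by omega
      rw [slice_top, ← slice_top F ω x t (fun _ => 0) f]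
      exact slice_mem_sliceSpan F _ ω x t (fun _ => hr) f
    | succ d ih =>
      intro j hj
      have hjk : j < k := by omega
      have h1 := ih (j + 1) (by omega)
      have h2 := contract_slice F ⟨j, hjk⟩ id a t t f (t ⟨j, hjk⟩)
      simp only [id, Function.update_eq_self] at h2
      rw [← h2]
      have h3 := h ⟨j, hjk⟩
      simp only [Violates, Function.update_eq_self, not_exists, not_not] at h3
      have h4 : sliceSpan F (j + 1) r ω x t
          ≤ (sliceSpan F j r ω x t).comap (contract ⟨j, hjk⟩ (a (t ⟨j, hjk⟩))) := by
        refine Submodule.span_le.2 ?_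
        rintro _ ⟨p, rfl⟩
        exact h3 p
      exact h4 h1
  have h1 := key k 0 (by omega)
  rw [sliceSpan_zero F r ω x h0, Submodule.mem_bot] at h1
  have h2 := congrFun h1 f
  rw [slice_zero] at h2
  exact h2

end slices

section rows

variable {Ω : Type*} {k : ℕ} (F : (Fin k → Ω) → (Fin k → Fin 2) → (Fin k → Fin 2) → ℂ)

/-- Labels of the generators of `sliceSpan`. -/
abbrev SliceLabel (k r : ℕ) : Type := (Fin k → Fin r) × (Fin k → Fin 2)

/-- Labels of the linear conditions on the vector placed at a point: a direction, a set of
generators spanning the slices, a component of the residual, and a generator. -/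
abbrev RowLabel (k r : ℕ) : Type :=
  Fin k × Finset (SliceLabel k r) × (Fin k → Fin 2) × SliceLabel k r

/-- The coefficients of a linear condition on the vector placed at `i`. -/
noncomputable def row {r : ℕ} (ω : ℕ → Ω) (s : Fin k → Ω) (θ : RowLabel k r) (i : Ω) (b : Fin 2)
    (x : ℕ → Fin 2 → ℂ) : ℂ :=
  residual θ.2.1 (fun p : SliceLabel k r => slice F θ.1 ω x s (fun l => p.1 l) p.2) θ.2.2.1
    (contract θ.1 (Pi.single b 1)
      (slice F (θ.1 + 1) ω x (Function.update s θ.1 i) (fun l => θ.2.2.2.1 l) θ.2.2.2.2))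

/-- The determinant of two linear conditions at the same point. -/
noncomputable def wedge {r : ℕ} (ω : ℕ → Ω) (s : Fin k → Ω) (θ : RowLabel k r)
    (s' : Fin k → Ω) (θ' : RowLabel k r) (i : Ω) : (ℕ → Fin 2 → ℂ) → ℂ := fun x =>
  row F ω s θ i 0 x * row F ω s' θ' i 1 x - row F ω s θ i 1 x * row F ω s' θ' i 0 x

theorem exists_violates_iff (r : ℕ) (ω : ℕ → Ω) (x : ℕ → Fin 2 → ℂ) (s : Fin k → Ω) :
    ∃ σ : Fin k → Finset (SliceLabel k r), ∀ a j i, Violates F r ω x a j s i ↔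
      ∃ c p, ∑ b, a b * row F ω s (j, σ j, c, p) i b x ≠ 0 := by
  choose σ hσ using fun j : Fin k => exists_residual_eq_zero_iff
    (fun p : SliceLabel k r => slice F j ω x s (fun l => p.1 l) p.2)
  refine ⟨σ, fun a j i => ?_⟩
  have h : ∀ c p, ∑ b, a b * row F ω s (j, σ j, c, p) i b x
      = residual (σ j) (fun p : SliceLabel k r => slice F j ω x s (fun l => p.1 l) p.2) c
        (contract j a (slice F (j + 1) ω x (Function.update s j i) (fun l => p.1 l) p.2)) := by
    intro c p
    rw [contract_eq_sum_single j a, residual_sum]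
    rfl
  simp only [h]
  rw [exists_comm]
  refine exists_congr fun p => ?_
  rw [← not_forall, hσ]
  rfl

theorem slice_mem_coordSpan_pow {r : ℕ} (j : ℕ) (ω : ℕ → Ω) (s : Fin k → Ω) {q : Fin k → ℕ}
    (hq : ∀ l, q l < r) (f g : Fin k → Fin 2) :
    (fun x => slice F j ω x s q f g) ∈ coordSpan r ^ k := by
  unfold slice evalForm
  refine sum_mem_coordSpan_pow _ _ fun h _ => ?_
  refine const_mul_mem_coordSpan_pow _ ?_
  have := prod_mem_coordSpan_pow (r := r) (d := 1) (Finset.univ : Finset (Fin k))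
    (fun l x => (if (l : ℕ) < j then Pi.single (g l) 1 else x (q l) : Fin 2 → ℂ) (h l)) (by
      intro l _
      split_ifs
      · exact const_mem_coordSpan_pow r 1 _
      · rw [pow_one]
        exact Submodule.subset_span (Or.inl (Or.inr ⟨(⟨q l, hq l⟩, h l), rfl⟩)))
  simpa using this

theorem star_slice_mem_coordSpan_pow {r : ℕ} (j : ℕ) (ω : ℕ → Ω) (s : Fin k → Ω)
    {q : Fin k → ℕ} (hq : ∀ l, q l < r) (f g : Fin k → Fin 2) :
    (fun x => star (slice F j ω x s q f g)) ∈ coordSpan r ^ k := by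
  unfold slice evalForm
  simp only [star_sum, star_mul', star_prod]
  refine sum_mem_coordSpan_pow _ _ fun h _ => ?_
  refine const_mul_mem_coordSpan_pow _ ?_
  have := prod_mem_coordSpan_pow (r := r) (d := 1) (Finset.univ : Finset (Fin k))
    (fun l x => star ((if (l : ℕ) < j then Pi.single (g l) 1 else x (q l) : Fin 2 → ℂ) (h l))) (by
      intro l _
      split_ifs
      · exact const_mem_coordSpan_pow r 1 _
      · rw [pow_one]
        exact Submodule.subset_span (Or.inr ⟨(⟨q l, hq l⟩, h l), rfl⟩))
  simpa using this

/-- A bound for the degree of the entries of `row`. -/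
def rowDegree (k r : ℕ) : ℕ := 3 * k + 2 * k * Fintype.card (SliceLabel k r)

theorem row_mem_coordSpan_pow {r : ℕ} (ω : ℕ → Ω) (s : Fin k → Ω) (θ : RowLabel k r) (i : Ω)
    (b : Fin 2) : row F ω s θ i b ∈ coordSpan r ^ rowDegree k r := by
  refine residual_mem_coordSpan_pow θ.2.1 _ _ ?_ ?_ ?_ θ.2.2.1
  · exact fun p g => slice_mem_coordSpan_pow F _ ω s (fun l => (p.1 l).2) _ _
  · exact fun p g => star_slice_mem_coordSpan_pow F _ ω s (fun l => (p.1 l).2) _ _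
  · intro g
    simp only [contract_apply]
    refine sum_mem_coordSpan_pow _ _ fun b' _ => ?_
    exact const_mul_mem_coordSpan_pow _
      (slice_mem_coordSpan_pow F _ ω _ (fun l => (θ.2.2.2.1 l).2) _ _)

theorem wedge_mem_coordSpan_pow {r : ℕ} (ω : ℕ → Ω) (s : Fin k → Ω) (θ : RowLabel k r)
    (s' : Fin k → Ω) (θ' : RowLabel k r) (i : Ω) :
    wedge F ω s θ s' θ' i ∈ coordSpan r ^ (rowDegree k r + rowDegree k r) :=
  Submodule.sub_mem _
    (mul_mem_coordSpan_pow (row_mem_coordSpan_pow F ω s θ i 0)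
      (row_mem_coordSpan_pow F ω s' θ' i 1))
    (mul_mem_coordSpan_pow (row_mem_coordSpan_pow F ω s θ i 1)
      (row_mem_coordSpan_pow F ω s' θ' i 0))

theorem slice_congr_sample (j : ℕ) {ω ω' : ℕ → Ω} (x : ℕ → Fin 2 → ℂ) (s : Fin k → Ω)
    {q : Fin k → ℕ} (h : ∀ l, ω (q l) = ω' (q l)) (f : Fin k → Fin 2) :
    slice F j ω x s q f = slice F j ω' x s q f := by
  unfold slice
  simp only [h]

theorem row_congr_sample {r : ℕ} {ω ω' : ℕ → Ω} (h : ∀ l < r, ω l = ω' l) :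
    row F (r := r) ω = row F ω' := by
  funext s θ i b x
  unfold row
  have h1 : ∀ (p : SliceLabel k r) (l : Fin k), ω (p.1 l) = ω' (p.1 l) :=
    fun p l => h _ (p.1 l).2
  simp only [slice_congr_sample F _ x _ (h1 _)]

/-- The failure of the sample points with index in `[r, r + T)` to control the determinants of
the linear conditions at `i`. -/
def Uncontrolled (r T : ℕ) (ω : ℕ → Ω) (s s' : Fin k → Ω) (i : Ω) : Prop :=
  ∃ θ θ' : RowLabel k r,
    wedge F ω s θ s' θ' i ∉ sampleSpan (wedge F ω s θ s' θ') ω r T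

theorem row_mul_row_eq {r T : ℕ} {ω : ℕ → Ω} {x : ℕ → Fin 2 → ℂ} (hx : ∀ l < r + T, x l ≠ 0)
    {s s' : Fin k → Ω} {i : Ω} (hc : ¬ Uncontrolled F r T ω s s' i) {θ θ' : RowLabel k r}
    (hθ : ∀ l ∈ Set.Ico r (r + T), ∑ b, x l b * row F ω s θ (ω l) b x = 0)
    (hθ' : ∀ l ∈ Set.Ico r (r + T), ∑ b, x l b * row F ω s' θ' (ω l) b x = 0) :
    row F ω s θ i 0 x * row F ω s' θ' i 1 x = row F ω s θ i 1 x * row F ω s' θ' i 0 x := by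
  simp only [Uncontrolled, not_exists, not_not] at hc
  have hle : sampleSpan (wedge F ω s θ s' θ') ω r T
      ≤ LinearMap.ker (LinearMap.proj (R := ℂ) (φ := fun _ : ℕ → Fin 2 → ℂ => ℂ) x) := by
    refine Submodule.span_le.2 ?_
    rintro _ ⟨l, hl, rfl⟩
    have h1 := hθ l hl
    have h2 := hθ' l hl
    simp only [Fin.sum_univ_two] at h1 h2
    simp only [SetLike.mem_coe, LinearMap.mem_ker, LinearMap.proj_apply, wedge]
    by_cases h0 : x l 0 = 0
    · have h3 : x l 1 ≠ 0 := fun h3 => hx l hl.2 (by ext b; fin_cases b <;> simp [h0, h3])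
      apply mul_left_cancel₀ h3
      linear_combination row F ω s θ (ω l) 0 x * h2 - row F ω s' θ' (ω l) 0 x * h1
    · apply mul_left_cancel₀ h0
      linear_combination row F ω s' θ' (ω l) 1 x * h1 - row F ω s θ (ω l) 1 x * h2
  have := hle (hc θ θ')
  simp only [LinearMap.mem_ker, LinearMap.proj_apply, wedge] at this
  exact sub_eq_zero.1 this

end rows

theorem exists_vector_of_parallel {S : Type*} [Fintype S] (R : S → Set (Fin 2 → ℂ))
    (B : S → S → Prop) (ok : S → Prop)
    (hpar : ∀ s s', ok s → ok s' → ¬ B s s' → ∀ ρ ∈ R s, ∀ ρ' ∈ R s', ρ 0 * ρ' 1 = ρ 1 * ρ' 0) :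
    ∃ a : Fin 2 → ℂ, a ≠ 0 ∧
      (Finset.univ.filter fun s => ok s ∧ ∃ ρ ∈ R s, ∑ b, a b * ρ b ≠ 0).card ^ 2
        ≤ (Finset.univ.filter fun q : S × S => B q.1 q.2).card := by
  set E : Finset S := Finset.univ.filter fun s => ok s ∧ ∃ ρ ∈ R s, ρ ≠ 0 with hE
  have hsub : ∀ a : Fin 2 → ℂ,
      (Finset.univ.filter fun s => ok s ∧ ∃ ρ ∈ R s, ∑ b, a b * ρ b ≠ 0) ⊆ E := by
    intro a s hs
    simp only [hE, Finset.mem_filter, Finset.mem_univ, true_and] at hs ⊢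
    obtain ⟨h, ρ, hρ, hne⟩ := hs
    exact ⟨h, ρ, hρ, fun h0 => hne (by simp [h0])⟩
  by_cases hne : E.Nonempty
  · obtain ⟨s₀, hs₀, hmin⟩ := Finset.exists_min_image E
      (fun s => (Finset.univ.filter fun s' => B s s').card) hne
    have hs₀' := hs₀
    simp only [hE, Finset.mem_filter, Finset.mem_univ, true_and] at hs₀'
    obtain ⟨hok, ρ, hρ, hρ0⟩ := hs₀'
    refine ⟨![-ρ 1, ρ 0], fun h0 => hρ0 ?_, ?_⟩
    · have h1 := congrFun h0 0
      have h2 := congrFun h0 1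
      ext b; fin_cases b
      · simpa using h2
      · simpa using h1
    · set V := Finset.univ.filter fun s => ok s ∧ ∃ ρ' ∈ R s,
        ∑ b, (![-ρ 1, ρ 0] : Fin 2 → ℂ) b * ρ' b ≠ 0 with hV
      have h1 : V ⊆ Finset.univ.filter fun s' => B s₀ s' := by
        intro s hs
        simp only [hV, Finset.mem_filter, Finset.mem_univ, true_and] at hs ⊢
        obtain ⟨h, ρ', hρ', hne'⟩ := hs
        by_contra hB
        apply hne'
        have := hpar s₀ s hok h hB ρ hρ ρ' hρ'
        simp only [Fin.sum_univ_two, Matrix.cons_val_zero, Matrix.cons_val_one]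
        linear_combination this
      have h2 : ∀ s ∈ V, V.card ≤ (Finset.univ.filter fun s' => B s s').card := fun s hs =>
        (Finset.card_le_card h1).trans (hmin s (hsub _ hs))
      have h3 : (Finset.univ.filter fun q : S × S => B q.1 q.2).card
          = ∑ s, (Finset.univ.filter fun s' => B s s').card := by
        simp only [Finset.card_filter, Fintype.sum_prod_type]
      rw [h3, sq]
      calc V.card * V.card = ∑ s ∈ V, V.card := by simp
        _ ≤ ∑ s ∈ V, (Finset.univ.filter fun s' => B s s').card := Finset.sum_le_sum h2
        _ ≤ _ := Finset.sum_le_sum_of_subset (Finset.subset_univ V)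
  · refine ⟨Pi.single 0 1, by simp, ?_⟩
    rw [Finset.not_nonempty_iff_eq_empty] at hne
    have := hsub (Pi.single 0 1)
    rw [hne, Finset.subset_empty] at this
    rw [this]
    simp

theorem exists_assignment_of_parallel {S Ω : Type*} [Fintype S] [Fintype Ω]
    (R : S → Ω → Set (Fin 2 → ℂ)) (B : S → S → Ω → Prop) (ok : S → Prop)
    (hpar : ∀ s s' i, ok s → ok s' → ¬ B s s' i →
      ∀ ρ ∈ R s i, ∀ ρ' ∈ R s' i, ρ 0 * ρ' 1 = ρ 1 * ρ' 0) :
    ∃ a : Ω → Fin 2 → ℂ, (∀ i, a i ≠ 0) ∧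
      (Finset.univ.filter fun q : Ω × S =>
          ok q.2 ∧ ∃ ρ ∈ R q.2 q.1, ∑ b, a q.1 b * ρ b ≠ 0).card ^ 2
        ≤ Fintype.card Ω * (Finset.univ.filter fun q : Ω × S × S => B q.2.1 q.2.2 q.1).card := by
  choose a ha hcard using fun i => exists_vector_of_parallel (fun s => R s i)
    (fun s s' => B s s' i) ok (fun s s' => hpar s s' i)
  refine ⟨a, ha, ?_⟩
  have h1 : (Finset.univ.filter fun q : Ω × S =>
          ok q.2 ∧ ∃ ρ ∈ R q.2 q.1, ∑ b, a q.1 b * ρ b ≠ 0).card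
      = ∑ i, (Finset.univ.filter fun s =>
          ok s ∧ ∃ ρ ∈ R s i, ∑ b, a i b * ρ b ≠ 0).card := by
    simp only [Finset.card_filter]
    rw [Fintype.sum_prod_type]
  have h2 : (Finset.univ.filter fun q : Ω × S × S => B q.2.1 q.2.2 q.1).card
      = ∑ i, (Finset.univ.filter fun q : S × S => B q.1 q.2 i).card := by
    simp only [Finset.card_filter]
    rw [Fintype.sum_prod_type]
  rw [h1, h2]
  refine sq_sum_le_card_mul_sum_sq.trans ?_
  rw [Finset.card_univ]
  exact Nat.mul_le_mul_left _ (Finset.sum_le_sum fun i _ => hcard i)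

section assembly

variable {Ω : Type*} [Fintype Ω] [Nonempty Ω] {k : ℕ}
  (F : (Fin k → Ω) → (Fin k → Fin 2) → (Fin k → Fin 2) → ℂ)

theorem exists_assignment_of_stage {η : ℝ} (hη : 0 ≤ η) {r T : ℕ} (hr : 0 < r) (ω : ℕ → Ω)
    (x : ℕ → Fin 2 → ℂ) (hx : ∀ l < r + T, x l ≠ 0)
    (h0 : ∀ q : Fin k → ℕ, (∀ l, q l < r) → ∀ f, evalForm (F (ω ∘ q) f) (x ∘ q) = 0)
    (hok : ((Finset.univ.filter fun s : Fin k → Ω =>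
      ¬ ∀ j : Fin k, sliceSpan F j (r + T) ω x s ≤ sliceSpan F j r ω x s).card : ℝ)
        ≤ η * (Fintype.card Ω : ℝ) ^ k)
    (hun : ((Finset.univ.filter fun q : Ω × (Fin k → Ω) × (Fin k → Ω) =>
      Uncontrolled F r T ω q.2.1 q.2.2 q.1).card : ℝ)
        ≤ η ^ 2 * (Fintype.card Ω : ℝ) ^ (2 * k + 1)) :
    ∃ a : Ω → Fin 2 → ℂ, (∀ i, a i ≠ 0) ∧
      ((Finset.univ.filter fun t : Fin k → Ω => ∃ f, evalForm (F t f) (a ∘ t) ≠ 0).card : ℝ)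
        ≤ k * (2 * η) * (Fintype.card Ω : ℝ) ^ k := by
  set N := Fintype.card Ω with hN
  have hNpos : (0 : ℝ) < N := by exact_mod_cast Fintype.card_pos
  set ok : (Fin k → Ω) → Prop := fun s =>
    ∀ j : Fin k, sliceSpan F j (r + T) ω x s ≤ sliceSpan F j r ω x s with hokdef
  choose σ hσ using exists_violates_iff F r ω x
  have hzero : ∀ s, ok s → ∀ l ∈ Set.Ico r (r + T), ∀ j c p,
      ∑ b, x l b * row F ω s (j, σ s j, c, p) (ω l) b x = 0 := by
    intro s hs l hl j c p
    by_contra hne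
    obtain ⟨p', hp'⟩ := (hσ s (x l) j (ω l)).2 ⟨c, p, hne⟩
    exact hp' (hs j (contract_slice_mem F j (Nat.le_add_right r T) hl.2 ω x s
      (fun l => (p'.1 l).2) p'.2))
  obtain ⟨a, ha, hcard⟩ := exists_assignment_of_parallel
    (fun (s : Fin k → Ω) (i : Ω) =>
      {ρ : Fin 2 → ℂ | ∃ j c p, ρ = fun b => row F ω s (j, σ s j, c, p) i b x})
    (fun s s' i => Uncontrolled F r T ω s s' i) ok (by
      rintro s s' i hs hs' hB _ ⟨j, c, p, rfl⟩ _ ⟨j', c', p', rfl⟩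
      exact row_mul_row_eq F hx hB (fun l hl => hzero s hs l hl j c p)
        (fun l hl => hzero s' hs' l hl j' c' p'))
  refine ⟨a, ha, ?_⟩
  set A := Finset.univ.filter fun q : Ω × (Fin k → Ω) => ok q.2 ∧
    ∃ ρ ∈ {ρ : Fin 2 → ℂ | ∃ j c p, ρ = fun b => row F ω q.2 (j, σ q.2 j, c, p) q.1 b x},
      ∑ b, a q.1 b * ρ b ≠ 0 with hA
  have hAcard : (A.card : ℝ) ≤ η * (N : ℝ) ^ (k + 1) := by
    have h1 : (A.card : ℝ) ^ 2 ≤ N * (η ^ 2 * (N : ℝ) ^ (2 * k + 1)) :=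
      le_trans (by exact_mod_cast hcard) (mul_le_mul_of_nonneg_left hun hNpos.le)
    refine abs_le_of_sq_le_sq' (h1.trans (le_of_eq ?_)) (by positivity) |>.2
    ring
  have hV : ∀ j : Fin k, ((Finset.univ.filter fun t : Fin k → Ω =>
      Violates F r ω x (a (t j)) j t (t j)).card : ℝ) ≤ 2 * η * (N : ℝ) ^ k := by
    intro j
    have h1 := card_pairs_eq_card_mul_card_diag j (fun (s : Fin k → Ω) (i : Ω) =>
      Violates F r ω x (a i) j s i) (fun s i i' => violates_update_iff F r ω x (a i) j s i i')
    have h2 : (Finset.univ.filter fun p : (Fin k → Ω) × Ω =>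
        Violates F r ω x (a p.2) j p.1 p.2).card ≤ A.card + N * (Finset.univ.filter fun s =>
          ¬ ok s).card := by
      have hsub : (Finset.univ.filter fun p : (Fin k → Ω) × Ω =>
          Violates F r ω x (a p.2) j p.1 p.2) ⊆ A.image Prod.swap ∪
            (Finset.univ.filter fun s => ¬ ok s) ×ˢ Finset.univ := by
        rintro ⟨s, i⟩ hsi
        simp only [Finset.mem_filter, Finset.mem_univ, true_and] at hsi
        obtain ⟨c, p, hne⟩ := (hσ s (a i) j i).1 hsi
        rw [Finset.mem_union]
        by_cases hs : ok s
        · left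
          refine Finset.mem_image.2 ⟨(i, s), ?_, rfl⟩
          exact Finset.mem_filter.2 ⟨Finset.mem_univ _, hs, _, ⟨j, c, p, rfl⟩, hne⟩
        · right
          simp [hs]
      refine (Finset.card_le_card hsub).trans ((Finset.card_union_le _ _).trans ?_)
      rw [Finset.card_product, Finset.card_univ, mul_comm]
      exact Nat.add_le_add_right Finset.card_image_le _
    have h3 : (N : ℝ) * ((Finset.univ.filter fun t : Fin k → Ω =>
        Violates F r ω x (a (t j)) j t (t j)).card : ℝ)
        ≤ A.card + N * ((Finset.univ.filter fun s => ¬ ok s).card : ℝ) := by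
      rw [h1] at h2
      exact_mod_cast h2
    have h4 : (N : ℝ) * ((Finset.univ.filter fun t : Fin k → Ω =>
        Violates F r ω x (a (t j)) j t (t j)).card : ℝ) ≤ N * (2 * η * (N : ℝ) ^ k) :=
      calc _ ≤ _ := h3
        _ ≤ η * (N : ℝ) ^ (k + 1) + N * (η * (N : ℝ) ^ k) :=
          add_le_add hAcard (mul_le_mul_of_nonneg_left hok hNpos.le)
        _ = _ := by ring
    exact le_of_mul_le_mul_left h4 hNpos
  have hsub : (Finset.univ.filter fun t : Fin k → Ω => ∃ f, evalForm (F t f) (a ∘ t) ≠ 0)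
      ⊆ Finset.univ.biUnion fun j : Fin k => Finset.univ.filter fun t : Fin k → Ω =>
        Violates F r ω x (a (t j)) j t (t j) := by
    intro t ht
    simp only [Finset.mem_filter, Finset.mem_univ, true_and, Finset.mem_biUnion] at ht ⊢
    obtain ⟨f, hf⟩ := ht
    by_contra hno
    exact hf (evalForm_eq_zero_of_not_violates F hr ω x h0 a t (not_exists.1 hno) f)
  calc ((Finset.univ.filter fun t : Fin k → Ω => ∃ f, evalForm (F t f) (a ∘ t) ≠ 0).card : ℝ)
      ≤ ∑ j : Fin k, ((Finset.univ.filter fun t : Fin k → Ω =>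
        Violates F r ω x (a (t j)) j t (t j)).card : ℝ) := by
        exact_mod_cast (Finset.card_le_card hsub).trans Finset.card_biUnion_le
    _ ≤ ∑ _j : Fin k, 2 * η * (N : ℝ) ^ k := Finset.sum_le_sum fun j _ => hV j
    _ = _ := by simp; ring

/-- Bounded total dimension forces the spans of the slices to stabilise at some stage. -/
theorem exists_stage {η : ℝ} {m : ℕ} (hm : (k * 2 ^ k : ℝ) < m * η) (r : ℕ → ℕ)
    (hr : Monotone r) (ω : ℕ → Ω) (x : ℕ → Fin 2 → ℂ) :
    ∃ t < m, ((Finset.univ.filter fun s : Fin k → Ω =>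
      ¬ ∀ j : Fin k, sliceSpan F j (r (t + 1)) ω x s ≤ sliceSpan F j (r t) ω x s).card : ℝ)
        ≤ η * (Fintype.card Ω : ℝ) ^ k := by
  by_contra hno
  have hNpos : (0 : ℝ) < (Fintype.card Ω : ℝ) := by exact_mod_cast Fintype.card_pos
  set Φ : ℕ → ℕ := fun t => ∑ s : Fin k → Ω, ∑ j : Fin k,
    Module.finrank ℂ (sliceSpan F j (r t) ω x s) with hΦ
  have hstep : ∀ t, Φ t + (Finset.univ.filter fun s : Fin k → Ω =>
      ¬ ∀ j : Fin k, sliceSpan F j (r (t + 1)) ω x s ≤ sliceSpan F j (r t) ω x s).card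
      ≤ Φ (t + 1) := by
    intro t
    rw [Finset.card_filter]
    simp only [hΦ]
    rw [← Finset.sum_add_distrib]
    refine Finset.sum_le_sum fun s _ => ?_
    have hle : ∀ j : Fin k, sliceSpan F j (r t) ω x s ≤ sliceSpan F j (r (t + 1)) ω x s :=
      fun j => sliceSpan_mono F j (hr (Nat.le_succ t)) ω x s
    split_ifs with h
    · exact (add_zero _).trans_le
        (Finset.sum_le_sum fun j _ => Submodule.finrank_mono (hle j))
    · simp only [not_forall] at h
      obtain ⟨j, hj⟩ := h
      refine Nat.succ_le_of_lt (Finset.sum_lt_sum (fun j _ => Submodule.finrank_mono (hle j))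
        ⟨j, Finset.mem_univ j, Submodule.finrank_lt_finrank_of_lt (lt_of_le_not_ge (hle j) hj)⟩)
  have hgrow : ∀ t ≤ m, (t : ℝ) * (η * (Fintype.card Ω : ℝ) ^ k) ≤ Φ t := by
    intro t
    induction t with
    | zero => intro _; simp
    | succ t ih =>
      intro ht
      have h1 := ih (by omega)
      have h2 := not_le.1 fun hle => hno ⟨t, by omega, hle⟩
      have h3 : (Φ t : ℝ) + ((Finset.univ.filter fun s : Fin k → Ω => ¬ ∀ j : Fin k,
        sliceSpan F j (r (t + 1)) ω x s ≤ sliceSpan F j (r t) ω x s).card : ℝ) ≤ Φ (t + 1) := by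
        exact_mod_cast hstep t
      push_cast
      linarith
  have hbound : (Φ m : ℝ) ≤ (k * 2 ^ k : ℝ) * (Fintype.card Ω : ℝ) ^ k := by
    have h1 : Φ m ≤ ∑ _s : Fin k → Ω, ∑ _j : Fin k, 2 ^ k := by
      refine Finset.sum_le_sum fun s _ => Finset.sum_le_sum fun j _ => ?_
      refine (Submodule.finrank_le _).trans ?_
      simp
    have h2 : ∑ _s : Fin k → Ω, ∑ _j : Fin k, 2 ^ k = Fintype.card Ω ^ k * (k * 2 ^ k) := by
      simp
    rw [h2] at h1
    calc (Φ m : ℝ) ≤ ((Fintype.card Ω ^ k * (k * 2 ^ k) : ℕ) : ℝ) := by exact_mod_cast h1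
      _ = _ := by push_cast; ring
  have := hgrow m le_rfl
  have h2 : (k * 2 ^ k : ℝ) * (Fintype.card Ω : ℝ) ^ k < m * η * (Fintype.card Ω : ℝ) ^ k :=
    mul_lt_mul_of_pos_right hm (by positivity)
  linarith

/-- The number of row labels squared times the dimension of the space of determinants. -/
noncomputable def wedgeBound (k r : ℕ) : ℕ :=
  Fintype.card (RowLabel k r × RowLabel k r)
    * Module.finrank ℂ ↥(coordSpan r ^ (rowDegree k r + rowDegree k r))

theorem card_uncontrolled_le {c r T : ℕ} (hc : r + T ≤ c) :
    T * (Finset.univ.filter fun q : (Fin c → Ω) × Ω × (Fin k → Ω) × (Fin k → Ω) =>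
        Uncontrolled F r T (extendSeq q.1) q.2.2.1 q.2.2.2 q.2.1).card
      ≤ wedgeBound k r * Fintype.card Ω ^ (c + (2 * k + 1)) := by
  have h1 : (Finset.univ.filter fun q : (Fin c → Ω) × Ω × (Fin k → Ω) × (Fin k → Ω) =>
        Uncontrolled F r T (extendSeq q.1) q.2.2.1 q.2.2.2 q.2.1).card
      ≤ ∑ u : ((Fin k → Ω) × (Fin k → Ω)) × (RowLabel k r × RowLabel k r),
        (Finset.univ.filter fun q : (Fin c → Ω) × Ω =>
          wedge F (extendSeq q.1) u.1.1 u.2.1 u.1.2 u.2.2 q.2 ∉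
            sampleSpan (wedge F (extendSeq q.1) u.1.1 u.2.1 u.1.2 u.2.2)
              (extendSeq q.1) r T).card := by
    refine (Finset.card_le_card (t := Finset.univ.biUnion fun
      u : ((Fin k → Ω) × (Fin k → Ω)) × (RowLabel k r × RowLabel k r) =>
        (Finset.univ.filter fun q : (Fin c → Ω) × Ω =>
          wedge F (extendSeq q.1) u.1.1 u.2.1 u.1.2 u.2.2 q.2 ∉
            sampleSpan (wedge F (extendSeq q.1) u.1.1 u.2.1 u.1.2 u.2.2)
              (extendSeq q.1) r T).image fun q => (q.1, q.2, u.1)) ?_).trans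
      (Finset.card_biUnion_le.trans (Finset.sum_le_sum fun u _ => Finset.card_image_le))
    rintro ⟨ω, i, s, s'⟩ hq
    simp only [Finset.mem_filter, Finset.mem_univ, true_and] at hq
    obtain ⟨θ, θ', h⟩ := hq
    refine Finset.mem_biUnion.2 ⟨((s, s'), (θ, θ')), Finset.mem_univ _,
      Finset.mem_image.2 ⟨(ω, i), ?_, rfl⟩⟩
    exact Finset.mem_filter.2 ⟨Finset.mem_univ _, h⟩
  refine (Nat.mul_le_mul_left T h1).trans ?_
  rw [Finset.mul_sum]
  calc _ ≤ ∑ _u : ((Fin k → Ω) × (Fin k → Ω)) × (RowLabel k r × RowLabel k r),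
        Module.finrank ℂ ↥(coordSpan r ^ (rowDegree k r + rowDegree k r))
          * Fintype.card Ω ^ (c + 1) := Finset.sum_le_sum fun u _ => by
        refine card_notMem_sampleSpan_le (coordSpan r ^ (rowDegree k r + rowDegree k r))
          (fun ω => wedge F ω u.1.1 u.2.1 u.1.2 u.2.2)
          (fun ω i => wedge_mem_coordSpan_pow F ω _ _ _ _ i) hc ?_
        intro ω ω' h
        unfold wedge
        rw [row_congr_sample F h]
    _ = Fintype.card (((Fin k → Ω) × (Fin k → Ω)) × (RowLabel k r × RowLabel k r))
        * (Module.finrank ℂ ↥(coordSpan r ^ (rowDegree k r + rowDegree k r))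
          * Fintype.card Ω ^ (c + 1)) := by
      rw [Finset.sum_const, Finset.card_univ, smul_eq_mul]
    _ = _ := by
      rw [Fintype.card_prod, wedgeBound, Fintype.card_prod (Fin k → Ω)]
      simp only [Fintype.card_pi, Finset.prod_const, Finset.card_univ, Fintype.card_fin]
      ring

theorem card_uncontrolled_stage_le {c r T : ℕ} (hc : r + T ≤ c) {η δ : ℝ} (hη : 0 < η)
    (hT : (wedgeBound k r : ℝ) ≤ δ * η * T) (hT0 : 0 < T) :
    ((Finset.univ.filter fun ω : Fin c → Ω =>
      ¬ ((Finset.univ.filter fun q : Ω × (Fin k → Ω) × (Fin k → Ω) =>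
        Uncontrolled F r T (extendSeq ω) q.2.1 q.2.2 q.1).card : ℝ)
          ≤ η * (Fintype.card Ω : ℝ) ^ (2 * k + 1)).card : ℝ)
      ≤ δ * (Fintype.card Ω : ℝ) ^ c := by
  have hNpos : (0 : ℝ) < (Fintype.card Ω : ℝ) := by exact_mod_cast Fintype.card_pos
  have hTpos : (0 : ℝ) < T := by exact_mod_cast hT0
  have h1 : (T : ℝ) * ((Finset.univ.filter fun q : (Fin c → Ω) × Ω × (Fin k → Ω) × (Fin k → Ω) =>
        Uncontrolled F r T (extendSeq q.1) q.2.2.1 q.2.2.2 q.2.1).card : ℝ)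
      ≤ wedgeBound k r * (Fintype.card Ω : ℝ) ^ (c + (2 * k + 1)) := by
    exact_mod_cast card_uncontrolled_le F hc
  have h2 : (Finset.univ.filter fun q : (Fin c → Ω) × Ω × (Fin k → Ω) × (Fin k → Ω) =>
        Uncontrolled F r T (extendSeq q.1) q.2.2.1 q.2.2.2 q.2.1).card
      = ∑ ω : Fin c → Ω, (Finset.univ.filter fun q : Ω × (Fin k → Ω) × (Fin k → Ω) =>
        Uncontrolled F r T (extendSeq ω) q.2.1 q.2.2 q.1).card := by
    simp only [Finset.card_filter]
    rw [Fintype.sum_prod_type]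
  rw [h2] at h1
  set E := Finset.univ.filter fun ω : Fin c → Ω =>
      ¬ ((Finset.univ.filter fun q : Ω × (Fin k → Ω) × (Fin k → Ω) =>
        Uncontrolled F r T (extendSeq ω) q.2.1 q.2.2 q.1).card : ℝ)
          ≤ η * (Fintype.card Ω : ℝ) ^ (2 * k + 1) with hE
  have h3 : (E.card : ℝ) * (η * (Fintype.card Ω : ℝ) ^ (2 * k + 1))
      ≤ ((∑ ω : Fin c → Ω, (Finset.univ.filter fun q : Ω × (Fin k → Ω) × (Fin k → Ω) =>
        Uncontrolled F r T (extendSeq ω) q.2.1 q.2.2 q.1).card : ℕ) : ℝ) := by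
    push_cast
    rw [← nsmul_eq_mul]
    refine (Finset.card_nsmul_le_sum E _ _ fun ω hω => ?_).trans
      (Finset.sum_le_sum_of_subset_of_nonneg (Finset.subset_univ E) fun _ _ _ => by positivity)
    exact (not_le.1 (Finset.mem_filter.1 hω).2).le
  have h4 : (E.card : ℝ) * (T * (η * (Fintype.card Ω : ℝ) ^ (2 * k + 1)))
      ≤ (δ * (Fintype.card Ω : ℝ) ^ c) * (T * (η * (Fintype.card Ω : ℝ) ^ (2 * k + 1))) := by
    calc _ = (T : ℝ) * (E.card * (η * (Fintype.card Ω : ℝ) ^ (2 * k + 1))) := by ring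
      _ ≤ _ := mul_le_mul_of_nonneg_left h3 hTpos.le
      _ ≤ _ := h1
      _ ≤ (δ * η * T) * (Fintype.card Ω : ℝ) ^ (c + (2 * k + 1)) :=
        mul_le_mul_of_nonneg_right hT (by positivity)
      _ = _ := by ring
  exact le_of_mul_le_mul_right h4 (by positivity)

end assembly

/-- The constraints on the sample `ω` are satisfied by a product vector. -/
def SampleSatisfiable {Ω : Type*} {k c : ℕ}
    (F : (Fin k → Ω) → (Fin k → Fin 2) → (Fin k → Fin 2) → ℂ) (ω : Fin c → Ω) : Prop :=
  ∃ x : Fin c → Fin 2 → ℂ, (∀ l, x l ≠ 0) ∧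
    ∀ (q : Fin k → Fin c) (f : Fin k → Fin 2), evalForm (F (ω ∘ q) f) (x ∘ q) = 0

/-- The end of the sampling window that starts at `r`, long enough to make the failure probability
at most `δ`. -/
noncomputable def nextStage (k : ℕ) (η : ℝ) (r : ℕ) : ℕ :=
  r + (⌈(wedgeBound k r : ℝ) / η⌉₊ + 1)

/-- If random samples of a suitable constant size are product satisfiable with probability at
least `3 / 4`, then some product vector satisfies all but an `ε` fraction of the constraints. -/
theorem exists_assignment_of_sampleSatisfiable (k : ℕ) {ε : ℝ} (hε : 0 < ε) :
    ∃ c : ℕ, ∀ (Ω : Type) [Fintype Ω] [Nonempty Ω]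
      (F : (Fin k → Ω) → (Fin k → Fin 2) → (Fin k → Fin 2) → ℂ),
      ((Finset.univ.filter fun ω : Fin c → Ω => ¬ SampleSatisfiable F ω).card : ℝ)
        ≤ 1 / 4 * (Fintype.card Ω : ℝ) ^ c →
      ∃ a : Ω → Fin 2 → ℂ, (∀ i, a i ≠ 0) ∧
        ((Finset.univ.filter fun t : Fin k → Ω => ∃ f, evalForm (F t f) (a ∘ t) ≠ 0).card : ℝ)
          ≤ ε * (Fintype.card Ω : ℝ) ^ k := by
  obtain ⟨η, hη, hηε⟩ : ∃ η : ℝ, 0 < η ∧ k * (2 * η) ≤ ε := by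
    refine ⟨ε / (2 * (k + 1)), by positivity, ?_⟩
    have hk : (0 : ℝ) < k + 1 := by positivity
    rw [show (k : ℝ) * (2 * (ε / (2 * (k + 1)))) = ε * (k / (k + 1)) by field_simp]
    exact mul_le_of_le_one_right hε.le ((div_le_one hk).2 (by linarith))
  obtain ⟨m, hm⟩ := exists_nat_gt ((k * 2 ^ k : ℝ) / η)
  rw [div_lt_iff₀ hη] at hm
  set δ : ℝ := 1 / (4 * (m + 1)) with hδ
  have hδpos : 0 < δ := by positivity
  set r : ℕ → ℕ := fun t => (nextStage k (δ * η ^ 2))^[t] 1 with hr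
  have hrs : ∀ t, r (t + 1) = nextStage k (δ * η ^ 2) (r t) := fun t =>
    Function.iterate_succ_apply' _ _ _
  have hrmono : Monotone r := monotone_nat_of_le_succ fun t => by
    rw [hrs, nextStage]; omega
  have hrpos : ∀ t, 0 < r t := fun t => lt_of_lt_of_le one_pos (hrmono (Nat.zero_le t))
  refine ⟨r m, fun Ω _ _ F hF => ?_⟩
  have hNpos : (0 : ℝ) < (Fintype.card Ω : ℝ) := by exact_mod_cast Fintype.card_pos
  set T : ℕ → ℕ := fun t => ⌈(wedgeBound k (r t) : ℝ) / (δ * η ^ 2)⌉₊ + 1 with hT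
  have hrT : ∀ t, r (t + 1) = r t + T t := fun t => hrs t
  set bad : ℕ → Finset (Fin (r m) → Ω) := fun t => Finset.univ.filter fun ω =>
      ¬ ((Finset.univ.filter fun q : Ω × (Fin k → Ω) × (Fin k → Ω) =>
        Uncontrolled F (r t) (T t) (extendSeq ω) q.2.1 q.2.2 q.1).card : ℝ)
          ≤ η ^ 2 * (Fintype.card Ω : ℝ) ^ (2 * k + 1) with hbad
  have hbadcard : ∀ t ∈ Finset.range m,
      ((bad t).card : ℝ) ≤ δ * (Fintype.card Ω : ℝ) ^ r m := by
    intro t ht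
    rw [Finset.mem_range] at ht
    refine card_uncontrolled_stage_le F ((hrT t).symm.le.trans (hrmono ht)) (by positivity) ?_
      (Nat.succ_pos _)
    have h1 := Nat.le_ceil ((wedgeBound k (r t) : ℝ) / (δ * η ^ 2))
    rw [div_le_iff₀ (by positivity)] at h1
    refine h1.trans ?_
    rw [mul_comm]
    refine mul_le_mul_of_nonneg_left ?_ (by positivity)
    simp [hT]
  obtain ⟨ω, hω⟩ : ∃ ω : Fin (r m) → Ω,
      ω ∉ (Finset.univ.filter fun ω : Fin (r m) → Ω => ¬ SampleSatisfiable F ω)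
        ∪ (Finset.range m).biUnion bad := by
    by_contra hno
    simp only [not_exists, not_not] at hno
    have h1 : (Fintype.card Ω : ℝ) ^ r m ≤
        ((Finset.univ.filter fun ω : Fin (r m) → Ω => ¬ SampleSatisfiable F ω).card : ℝ)
          + ∑ t ∈ Finset.range m, ((bad t).card : ℝ) := by
      have h2 : Fintype.card (Fin (r m) → Ω) ≤ (Finset.univ.filter
          fun ω : Fin (r m) → Ω => ¬ SampleSatisfiable F ω).card
            + ∑ t ∈ Finset.range m, (bad t).card := by
        rw [← Finset.card_univ]
        refine (Finset.card_le_card fun ω _ => hno ω).trans ?_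
        exact (Finset.card_union_le _ _).trans (Nat.add_le_add_left Finset.card_biUnion_le _)
      simp only [Fintype.card_pi, Finset.prod_const, Finset.card_univ, Fintype.card_fin] at h2
      exact_mod_cast h2
    have h3 : ∑ t ∈ Finset.range m, ((bad t).card : ℝ)
        ≤ m * (δ * (Fintype.card Ω : ℝ) ^ r m) := by
      refine (Finset.sum_le_sum hbadcard).trans ?_
      simp
    have h4 : (m : ℝ) * δ ≤ 1 / 4 := by
      rw [hδ, mul_one_div, div_le_div_iff₀ (by positivity) (by positivity)]
      linarith
    have h5 : (0 : ℝ) < (Fintype.card Ω : ℝ) ^ r m := by positivity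
    have h6 := mul_le_mul_of_nonneg_right h4 h5.le
    linarith
  simp only [Finset.mem_union, Finset.mem_biUnion, not_or, not_exists, not_and,
    Finset.mem_range] at hω
  obtain ⟨hsat, hstage⟩ := hω
  obtain ⟨x, hx, hxq⟩ : SampleSatisfiable F ω := by
    by_contra h
    exact hsat (Finset.mem_filter.2 ⟨Finset.mem_univ _, h⟩)
  set x' : ℕ → Fin 2 → ℂ := fun l => if h : l < r m then x ⟨l, h⟩ else 0 with hx'
  have hx'_of_lt : ∀ {l} (h : l < r m), x' l = x ⟨l, h⟩ := fun {l} h => by simp [hx', h]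
  obtain ⟨t, ht, hok⟩ := exists_stage F hm r hrmono (extendSeq ω) x'
  have hle : r (t + 1) ≤ r m := hrmono ht
  have hle' : r t ≤ r m := hrmono ht.le
  obtain ⟨a, ha, hcard⟩ := exists_assignment_of_stage F hη.le (T := T t) (hrpos t) (extendSeq ω) x'
    (fun l hl => by
      rw [hx'_of_lt (lt_of_lt_of_le hl ((hrT t).symm.le.trans hle))]
      exact hx _)
    (fun q hq f => by
      have h1 : extendSeq ω ∘ q = ω ∘ fun l => ⟨q l, (hq l).trans_le hle'⟩ :=
        funext fun l => extendSeq_of_lt ω ((hq l).trans_le hle')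
      have h2 : x' ∘ q = x ∘ fun l => ⟨q l, (hq l).trans_le hle'⟩ :=
        funext fun l => hx'_of_lt ((hq l).trans_le hle')
      rw [h1, h2]
      exact hxq _ f)
    (by rw [← hrT]; exact hok)
    (by
      by_contra h
      exact hstage t ht (Finset.mem_filter.2 ⟨Finset.mem_univ _, h⟩))
  exact ⟨a, ha, hcard.trans (mul_le_mul_of_nonneg_right hηε (by positivity))⟩

theorem exists_pencil_kernel {V W : Type*} [AddCommGroup V] [Module ℂ V] [AddCommGroup W]
    [Module ℂ W] [FiniteDimensional ℂ V] [FiniteDimensional ℂ W] [Nontrivial V]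
    (c : Fin 2 → V →ₗ[ℂ] W) (h : Module.finrank ℂ W ≤ Module.finrank ℂ V) :
    ∃ α : Fin 2 → ℂ, α ≠ 0 ∧ ∃ u : V, u ≠ 0 ∧ ∑ b, α b • c b u = 0 := by
  by_cases hinj : Function.Injective (c 0)
  · have hdim : Module.finrank ℂ V = Module.finrank ℂ W :=
      le_antisymm (LinearMap.finrank_le_finrank_of_injective hinj) h
    set e := LinearMap.linearEquivOfInjective (c 0) hinj hdim with he
    obtain ⟨μ, hμ⟩ := Module.End.exists_eigenvalue (e.symm.toLinearMap ∘ₗ c 1)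
    obtain ⟨u, hu⟩ := hμ.exists_hasEigenvector
    refine ⟨![-μ, 1], fun h0 => by simpa using congrFun h0 1, u, hu.2, ?_⟩
    have h1 : e (e.symm (c 1 u)) = e (μ • u) := congrArg e hu.apply_eq_smul
    rw [LinearEquiv.apply_symm_apply, map_smul, he,
      LinearMap.linearEquivOfInjective_apply] at h1
    simp [Fin.sum_univ_two, h1]
  · rw [← LinearMap.ker_eq_bot, Submodule.eq_bot_iff] at hinj
    push Not at hinj
    obtain ⟨u, hu, hu0⟩ := hinj
    refine ⟨![1, 0], fun h0 => by simpa using congrFun h0 0, u, hu0, ?_⟩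
    simpa [Fin.sum_univ_two] using hu

/-- A family of spaces of vectors on the subsets of a set of qubits which is closed under
contracting a qubit with a basis vector. -/
structure IsLocalSystem {I : Type*} [DecidableEq I]
    (V : Finset I → Submodule ℂ ((I → Fin 2) → ℂ)) : Prop where
  dep : ∀ C, ∀ v ∈ V C, ∀ f g, (∀ i ∈ C, f i = g i) → v f = v g
  contract : ∀ C, ∀ v ∈ V C, ∀ i ∈ C, ∀ b,
    (fun f => v (Function.update f i b)) ∈ V (C.erase i)

/-- The system at `C` contains a vector that factors off a tensor factor at `i`. -/
def Factors {I : Type*} [DecidableEq I] (V : Finset I → Submodule ℂ ((I → Fin 2) → ℂ))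
    (C : Finset I) (i : I) : Prop :=
  ∃ x : Fin 2 → ℂ, x ≠ 0 ∧ ∃ v ∈ V C, v ≠ 0 ∧ (fun f => v f * x (f i)) ∈ V (insert i C)

namespace IsLocalSystem

variable {I : Type*} [DecidableEq I] {V : Finset I → Submodule ℂ ((I → Fin 2) → ℂ)}

theorem contract_mem_insert (hV : IsLocalSystem V) {C : Finset I} {i : I} (hi : i ∉ C)
    {v : (I → Fin 2) → ℂ} (hv : v ∈ V (insert i C)) (b : Fin 2) :
    (fun f => v (Function.update f i b)) ∈ V C := by
  have := hV.contract _ v hv i (Finset.mem_insert_self i C) b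
  rwa [Finset.erase_insert hi] at this

theorem ne_bot [Fintype I] (hV : IsLocalSystem V) (h : V Finset.univ ≠ ⊥) (C : Finset I) :
    V C ≠ ⊥ := by
  have key : ∀ D : Finset I, V (Finset.univ \ D) ≠ ⊥ := by
    intro D
    induction D using Finset.induction_on with
    | empty => simpa using h
    | insert i D hi ih =>
      obtain ⟨v, hv, hv0⟩ := Submodule.exists_mem_ne_zero_of_ne_bot ih
      obtain ⟨f, hf⟩ := Function.ne_iff.1 hv0
      rw [Finset.sdiff_insert]
      refine Submodule.ne_bot_iff _ |>.2 ⟨_, hV.contract _ v hv i (by simp [hi]) (f i), ?_⟩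
      intro h0
      have := congrFun h0 f
      simp only [Function.update_eq_self] at this
      exact hf this
  have := key Cᶜ
  rwa [← Finset.compl_eq_univ_sdiff, compl_compl] at this

theorem finrank_le [Fintype I] (hV : IsLocalSystem V) (C : Finset I) :
    Module.finrank ℂ (V C) ≤ 2 ^ C.card := by
  let L : V C →ₗ[ℂ] ((C → Fin 2) → ℂ) :=
    { toFun := fun v g => v.1 fun i => if h : i ∈ C then g ⟨i, h⟩ else 0
      map_add' := fun _ _ => rfl
      map_smul' := fun _ _ => rfl }
  have hL : Function.Injective L := by
    intro v w h
    ext f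
    have h1 := congrFun h fun i => f i
    have h2 : ∀ u ∈ V C, u (fun i => if h : i ∈ C then f i else 0) = u f := fun u hu =>
      hV.dep C u hu _ _ fun i hi => by simp [hi]
    rw [← h2 _ v.2, ← h2 _ w.2]
    exact h1
  refine (LinearMap.finrank_le_finrank_of_injective hL).trans ?_
  simp

theorem finrank_insert_lt [Fintype I] (hV : IsLocalSystem V) (h : V Finset.univ ≠ ⊥)
    {C : Finset I} {i : I} (hi : i ∉ C) (hbad : ¬ Factors V C i) :
    Module.finrank ℂ (V (insert i C)) < Module.finrank ℂ (V C) := by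
  by_contra hle
  rw [not_lt] at hle
  have : Nontrivial (V (insert i C)) := Submodule.nontrivial_iff_ne_bot.2 (hV.ne_bot h _)
  let c : Fin 2 → V (insert i C) →ₗ[ℂ] V C := fun b =>
    { toFun := fun v => ⟨_, hV.contract_mem_insert hi v.2 b⟩
      map_add' := fun _ _ => rfl
      map_smul' := fun _ _ => rfl }
  obtain ⟨α, hα, ⟨u, hu⟩, hu0, hsum⟩ := exists_pencil_kernel c hle
  have hsum' : ∀ f, α 0 * u (Function.update f i 0) + α 1 * u (Function.update f i 1) = 0 := by
    intro f
    have h1 := congrFun (congrArg Subtype.val hsum) f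
    simpa [Fin.sum_univ_two, c] using h1
  have hu0' : u ≠ 0 := fun h0 => hu0 (Subtype.ext h0)
  apply hbad
  have hmk : ∀ v : (I → Fin 2) → ℂ, v ∈ V C → ∀ x : Fin 2 → ℂ, x ≠ 0 →
      (∀ f, u f = v f * x (f i)) → Factors V C i := by
    intro v hv x hx huv
    refine ⟨x, hx, v, hv, fun h0 => hu0' ?_, ?_⟩
    · ext f; simp [huv, h0]
    · convert hu using 1
      exact funext fun f => (huv f).symm
  have hself : ∀ f, u f = u (Function.update f i (f i)) := fun f => by simp
  by_cases h0 : α 0 = 0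
  · have h1 : α 1 ≠ 0 := fun h1 => hα (by ext b; fin_cases b <;> simp [h0, h1])
    refine hmk _ (hV.contract_mem_insert hi hu 0) (Pi.single 0 1) (by simp) fun f => ?_
    have h2 := hsum' f
    rw [h0, zero_mul, zero_add, mul_eq_zero, or_iff_right h1] at h2
    rw [hself f]
    generalize f i = b
    fin_cases b <;> simp [h2]
  · refine hmk _ (Submodule.smul_mem _ (α 0)⁻¹ (hV.contract_mem_insert hi hu 1)) ![-α 1, α 0]
      (fun h1 => h0 (by simpa using congrFun h1 1)) fun f => ?_
    have h2 := hsum' f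
    rw [hself f]
    generalize f i = b
    fin_cases b
    · simp only [Fin.zero_eta, Pi.smul_apply, smul_eq_mul, Matrix.cons_val_zero]
      field_simp
      linear_combination h2
    · simp only [Fin.mk_one, Pi.smul_apply, smul_eq_mul, Matrix.cons_val_one]
      field_simp
      simp

theorem factors_of_insert (hV : IsLocalSystem V) {C : Finset I} {i j : I} (hj : j ∉ C)
    (hij : i ≠ j) (h : Factors V (insert j C) i) : Factors V C i := by
  obtain ⟨x, hx, v, hv, hv0, hvx⟩ := h
  obtain ⟨f, hf⟩ := Function.ne_iff.1 hv0
  refine ⟨x, hx, _, hV.contract_mem_insert hj hv (f j), fun h0 => hf ?_, ?_⟩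
  · have := congrFun h0 f
    simpa using this
  · rw [Finset.insert_comm] at hvx
    have := hV.contract_mem_insert (by simp [hj, hij.symm]) hvx (f j)
    simpa [Function.update_of_ne hij] using this

theorem card_not_factors_le [Fintype I] (hV : IsLocalSystem V) (h : V Finset.univ ≠ ⊥)
    (C : Finset I) :
    (Finset.univ.filter fun i => i ∉ C ∧ ¬ Factors V C i).card ≤ 2 ^ C.card := by
  have hbad : ∀ E : Finset I, ∀ i, i ∉ E → i ∉ C → ¬ Factors V C i → ¬ Factors V (E ∪ C) i := by
    intro E
    induction E using Finset.induction_on with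
    | empty => intro i _ _ hi; simpa using hi
    | insert j E hj ih =>
      intro i hiE hiC hi
      rw [Finset.insert_union]
      rw [Finset.mem_insert, not_or] at hiE
      by_cases hjC : j ∈ E ∪ C
      · rw [Finset.insert_eq_of_mem hjC]
        exact ih i hiE.2 hiC hi
      · exact fun hf => ih i hiE.2 hiC hi (hV.factors_of_insert hjC hiE.1 hf)
  have key : ∀ E : Finset I, (∀ i ∈ E, i ∉ C ∧ ¬ Factors V C i) →
      Module.finrank ℂ (V (E ∪ C)) + E.card ≤ Module.finrank ℂ (V C) := by
    intro E
    induction E using Finset.induction_on with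
    | empty => intro _; rw [Finset.empty_union]; simp
    | insert i E hi ih =>
      intro hE
      have h1 := ih fun j hj => hE j (Finset.mem_insert_of_mem hj)
      obtain ⟨hiC, hif⟩ := hE i (Finset.mem_insert_self i E)
      have h2 := hV.finrank_insert_lt h (C := E ∪ C) (i := i) (by simp [hi, hiC])
        (hbad E i hi hiC hif)
      rw [Finset.insert_union, Finset.card_insert_of_notMem hi]
      omega
  have := key (Finset.univ.filter fun i => i ∉ C ∧ ¬ Factors V C i) (by simp)
  have h2 := hV.finrank_le C
  omega

end IsLocalSystem

theorem card_not_injective_le (c : ℕ) (α : Type*) [Fintype α] [DecidableEq α] :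
    Fintype.card α * (Finset.univ.filter fun ω : Fin c → α => ¬ Function.Injective ω).card
      ≤ c ^ 2 * Fintype.card α ^ c := by
  have h1 : ∀ p : Fin c × Fin c, Fintype.card α *
      (Finset.univ.filter fun ω : Fin c → α => p.1 ≠ p.2 ∧ ω p.1 = ω p.2).card
        ≤ Fintype.card α ^ c := by
    rintro ⟨a, b⟩
    by_cases hab : a = b
    · simp [hab]
    · have h := card_pairs_eq_card_mul_card_diag b (fun (ω : Fin c → α) i => ω a = i)
        (fun ω i i' => by rw [Function.update_of_ne hab])
      simp only [ne_eq, hab, not_false_eq_true, true_and]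
      have h2 : (Finset.univ.filter fun p : (Fin c → α) × α => p.1 a = p.2).card
          ≤ (Finset.univ.image fun ω : Fin c → α => (ω, ω a)).card := by
        refine Finset.card_le_card ?_
        rintro ⟨ω, i⟩ hp
        simp only [Finset.mem_filter, Finset.mem_univ, true_and] at hp
        simp [hp]
      have h3 : (Finset.univ.filter fun p : (Fin c → α) × α => p.1 a = p.2).card
          ≤ Fintype.card α ^ c := h2.trans (Finset.card_image_le.trans (by simp))
      convert h3 using 1
      convert h.symm
  have h2 : (Finset.univ.filter fun ω : Fin c → α => ¬ Function.Injective ω)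
      ⊆ Finset.univ.biUnion fun p : Fin c × Fin c =>
        Finset.univ.filter fun ω : Fin c → α => p.1 ≠ p.2 ∧ ω p.1 = ω p.2 := by
    intro ω hω
    simp only [Finset.mem_filter, Finset.mem_univ, true_and, Function.Injective,
      not_forall] at hω
    obtain ⟨a, b, h, hne⟩ := hω
    exact Finset.mem_biUnion.2 ⟨(a, b), Finset.mem_univ _, by simp [h, hne]⟩
  calc _ ≤ Fintype.card α * ∑ p : Fin c × Fin c,
        (Finset.univ.filter fun ω : Fin c → α => p.1 ≠ p.2 ∧ ω p.1 = ω p.2).card :=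
        Nat.mul_le_mul_left _ ((Finset.card_le_card h2).trans Finset.card_biUnion_le)
    _ ≤ ∑ _p : Fin c × Fin c, Fintype.card α ^ c := by
        rw [Finset.mul_sum]; exact Finset.sum_le_sum fun p _ => h1 p
    _ = _ := by simp [sq]

theorem card_comp_injective {c s : ℕ} {α : Type*} [Fintype α] (u : Fin c → Fin s)
    (hu : Function.Injective u) (P : (Fin c → α) → Prop) :
    Fintype.card α ^ c * (Finset.univ.filter fun e : Fin s → α => P (e ∘ u)).card
      = Fintype.card α ^ s * (Finset.univ.filter P).card := by
  have h1 : ((Finset.univ : Finset (Fin c → α)) ×ˢ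
        Finset.univ.filter fun e : Fin s → α => P (e ∘ u)).card
      = ((Finset.univ.filter P) ×ˢ (Finset.univ : Finset (Fin s → α))).card := by
    have hext : ∀ (η : Fin c → α) (e : Fin s → α), Function.extend u η e ∘ u = η := fun η e =>
      funext fun l => hu.extend_apply η e l
    have hext2 : ∀ (η : Fin c → α) (e : Fin s → α),
        Function.extend u (e ∘ u) (Function.extend u η e) = e := by
      intro η e
      ext1 j
      by_cases hj : ∃ l, u l = j
      · obtain ⟨l, rfl⟩ := hj
        rw [hu.extend_apply]; rfl
      · rw [Function.extend_apply' _ _ _ hj, Function.extend_apply' _ _ _ hj]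
    refine Finset.card_nbij' (fun p => (p.2 ∘ u, Function.extend u p.1 p.2))
      (fun p => (p.2 ∘ u, Function.extend u p.1 p.2)) ?_ ?_ ?_ ?_
    · rintro ⟨η, e⟩ h; simpa using h
    · rintro ⟨η, e⟩ h; simpa [hext] using h
    · rintro ⟨η, e⟩ h; simp [hext, hext2]
    · rintro ⟨η, e⟩ h; simp [hext, hext2]
  simpa [Finset.card_product, mul_comm] using h1

/-- The system contains a product vector on the set of qubits listed by `ω`. -/
def HasProduct {I : Type*} [DecidableEq I] (V : Finset I → Submodule ℂ ((I → Fin 2) → ℂ))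
    {c : ℕ} (ω : Fin c → I) : Prop :=
  ∃ x : Fin c → Fin 2 → ℂ, (∀ l, x l ≠ 0) ∧
    (fun f : I → Fin 2 => ∏ l, x l (f (ω l))) ∈ V (Finset.univ.image ω)

/-- The vectors on a set of qubits, embedded by `e`, whose product with the vector `x` at the
qubit `i` lies in the given system. -/
def pullback {I J : Type*} [DecidableEq I] (V : Finset I → Submodule ℂ ((I → Fin 2) → ℂ))
    (e : J → I) (i : I) (x : Fin 2 → ℂ) (C : Finset J) : Submodule ℂ ((J → Fin 2) → ℂ) where
  carrier := {w | (∀ f g, (∀ j ∈ C, f j = g j) → w f = w g) ∧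
    (fun f => w (f ∘ e) * x (f i)) ∈ V (insert i (C.image e))}
  add_mem' := by
    rintro v w ⟨hv, hv'⟩ ⟨hw, hw'⟩
    refine ⟨fun f g h => by simp [hv f g h, hw f g h], ?_⟩
    convert add_mem hv' hw' using 1
    ext f
    simp [add_mul]
  zero_mem' := ⟨fun _ _ _ => rfl, by
    simp only [Pi.zero_apply, zero_mul]
    exact zero_mem _⟩
  smul_mem' := by
    rintro a w ⟨hw, hw'⟩
    refine ⟨fun f g h => by simp [hw f g h], ?_⟩
    convert Submodule.smul_mem _ a hw' using 1
    ext f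
    simp [mul_assoc]

namespace IsLocalSystem

variable {I J : Type*} [DecidableEq I]
  {V : Finset I → Submodule ℂ ((I → Fin 2) → ℂ)}

theorem pullback [DecidableEq J] (hV : IsLocalSystem V) {e : J → I} (he : Function.Injective e)
    {i : I} (hi : ∀ j, e j ≠ i) (x : Fin 2 → ℂ) :
    IsLocalSystem (pullback V e i x) where
  dep C w hw := hw.1
  contract C w hw j hj b := by
    refine ⟨fun f g h => hw.1 _ _ fun l hl => ?_, ?_⟩
    · by_cases hlj : l = j
      · simp [hlj]
      · simpa [hlj] using h l (Finset.mem_erase.2 ⟨hlj, hl⟩)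
    · have h1 := hV.contract _ _ hw.2 (e j)
        (Finset.mem_insert_of_mem (Finset.mem_image_of_mem e hj)) b
      rw [Finset.erase_insert_of_ne (hi j).symm, ← Finset.image_erase he] at h1
      convert h1 using 1
      ext f
      rw [Function.update_comp_eq_of_injective _ he, Function.update_of_ne (hi j).symm]

theorem pullback_univ_ne_bot [Fintype J] (hV : IsLocalSystem V) {e : J → I}
    (he : Function.Injective e) {i : I} {x : Fin 2 → ℂ} {v : (I → Fin 2) → ℂ}
    (hv : v ∈ V (Finset.univ.image e)) (hv0 : v ≠ 0)
    (hvx : (fun f => v f * x (f i)) ∈ V (insert i (Finset.univ.image e))) :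
    QkSAT.pullback V e i x Finset.univ ≠ ⊥ := by
  have h1 : ∀ f, v (Function.extend e (f ∘ e) 0) = v f := fun f =>
    hV.dep _ v hv _ _ fun l hl => by
      obtain ⟨j, -, rfl⟩ := Finset.mem_image.1 hl
      rw [he.extend_apply, Function.comp_apply]
  refine (Submodule.ne_bot_iff _).2 ⟨fun g => v (Function.extend e g 0), ⟨fun f g h => ?_, ?_⟩, ?_⟩
  · rw [funext fun j => h j (Finset.mem_univ j)]
  · simpa only [h1] using hvx
  · obtain ⟨f, hf⟩ := Function.ne_iff.1 hv0
    exact Function.ne_iff.2 ⟨f ∘ e, (h1 f).trans_ne hf⟩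


end IsLocalSystem

theorem HasProduct.cons {I J : Type*} [DecidableEq I] [DecidableEq J]
    {V : Finset I → Submodule ℂ ((I → Fin 2) → ℂ)} {e : J → I} {i : I} {x : Fin 2 → ℂ}
    (hx : x ≠ 0) {c : ℕ} {u : Fin c → J} (h : HasProduct (pullback V e i x) u) :
    HasProduct V (Fin.cons i (e ∘ u) : Fin (c + 1) → I) := by
  obtain ⟨y, hy, hmem⟩ := h
  refine ⟨Fin.cons x y, fun l => Fin.cases hx hy l, ?_⟩
  have h1 : Finset.univ.image (Fin.cons i (e ∘ u) : Fin (c + 1) → I)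
      = insert i ((Finset.univ.image u).image e) := by
    ext a
    simp [Fin.exists_fin_succ, eq_comm]
  rw [h1]
  convert hmem.2 using 1
  ext f
  simp [Fin.prod_univ_succ, mul_comm]

theorem IsLocalSystem.hasProduct_of_isEmpty {I : Type*} [Fintype I] [DecidableEq I]
    {V : Finset I → Submodule ℂ ((I → Fin 2) → ℂ)} (hV : IsLocalSystem V)
    (h : V Finset.univ ≠ ⊥) (ω : Fin 0 → I) : HasProduct V ω := by
  obtain ⟨v, hv, hv0⟩ := Submodule.exists_mem_ne_zero_of_ne_bot (hV.ne_bot h ∅)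
  obtain ⟨f, hf⟩ := Function.ne_iff.1 hv0
  refine ⟨fun l => l.elim0, fun l => l.elim0, ?_⟩
  have h1 := Submodule.smul_mem _ (v f)⁻¹ hv
  rw [Finset.univ_eq_empty, Finset.image_empty]
  convert h1 using 1
  ext g
  have h2 : v g = v f := hV.dep _ v hv _ _ (by simp)
  rw [Pi.smul_apply, h2, smul_eq_mul, inv_mul_cancel₀ hf]
  simp

theorem card_filter_fin_succ {c : ℕ} {α : Type*} [Fintype α] (P : (Fin (c + 1) → α) → Prop) :
    (Finset.univ.filter P).card
      = ∑ i, (Finset.univ.filter fun η : Fin c → α => P (Fin.cons i η)).card := by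
  simp only [Finset.card_filter]
  rw [← Fintype.sum_prod_type', ← (Fin.consEquiv fun _ => α).sum_comp]
  rfl

theorem sum_card_comp_injective {c s : ℕ} {α : Type*} [Fintype α]
    (P : (Fin (c + 1) → α) → Prop) :
    Fintype.card α ^ c * ∑ e : Fin s → α, ∑ i : α,
        ((Finset.univ.filter fun u : Fin c → Fin s => Function.Injective u).filter
          fun u => P (Fin.cons i (e ∘ u))).card
      = (Finset.univ.filter fun u : Fin c → Fin s => Function.Injective u).card
        * Fintype.card α ^ s * (Finset.univ.filter P).card := by
  have h1 : ∀ i : α, Fintype.card α ^ c * ∑ e : Fin s → α,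
      ((Finset.univ.filter fun u : Fin c → Fin s => Function.Injective u).filter
          fun u => P (Fin.cons i (e ∘ u))).card
      = (Finset.univ.filter fun u : Fin c → Fin s => Function.Injective u).card
        * (Fintype.card α ^ s
          * (Finset.univ.filter fun η : Fin c → α => P (Fin.cons i η)).card) := by
    intro i
    have h2 := Finset.sum_card_bipartiteAbove_eq_sum_card_bipartiteBelow
      (s := (Finset.univ : Finset (Fin s → α)))
      (t := Finset.univ.filter fun u : Fin c → Fin s => Function.Injective u)
      (fun e u => P (Fin.cons i (e ∘ u)))
    unfold Finset.bipartiteAbove Finset.bipartiteBelow at h2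
    rw [h2, Finset.mul_sum, ← smul_eq_mul (Finset.card _), ← Finset.sum_const]
    refine Finset.sum_congr rfl fun u hu => ?_
    exact card_comp_injective u (Finset.mem_filter.1 hu).2 fun η => P (Fin.cons i η)
  rw [Finset.sum_comm, Finset.mul_sum, Finset.sum_congr rfl fun i _ => h1 i, ← Finset.mul_sum,
    ← Finset.mul_sum, ← card_filter_fin_succ, mul_assoc]

theorem half_pow_le_card_injective {c s : ℕ} (hs : 0 < s) (h : 2 * c ^ 2 ≤ s) :
    s ^ c ≤ 2 * (Finset.univ.filter fun u : Fin c → Fin s => Function.Injective u).card := by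
  have h1 := card_not_injective_le c (Fin s)
  have h2 := Finset.card_filter_add_card_filter_not (s := (Finset.univ : Finset (Fin c → Fin s)))
    (fun u => Function.Injective u)
  rw [Finset.card_univ, Fintype.card_pi, Finset.prod_const, Finset.card_univ, Fintype.card_fin,
    Fintype.card_fin] at h2
  rw [Fintype.card_fin] at h1
  have h3 : s * (2 * (Finset.univ.filter
      fun u : Fin c → Fin s => ¬ Function.Injective u).card) ≤ s * s ^ c := by
    calc _ = 2 * (s * (Finset.univ.filter
          fun u : Fin c → Fin s => ¬ Function.Injective u).card) := by ring
      _ ≤ 2 * (c ^ 2 * s ^ c) := Nat.mul_le_mul_left _ h1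
      _ = 2 * c ^ 2 * s ^ c := by ring
      _ ≤ s * s ^ c := Nat.mul_le_mul_right _ h
  have h4 := Nat.le_of_mul_le_mul_left h3 hs
  omega

/-- The pairs to which the induction step does not apply are few. -/
theorem IsLocalSystem.sum_card_not_factors_le {n s : ℕ}
    {V : Finset (Fin n) → Submodule ℂ ((Fin n → Fin 2) → ℂ)} (hV : IsLocalSystem V)
    (h : V Finset.univ ≠ ⊥) :
    ∑ e : Fin s → Fin n, (Finset.univ.filter fun i => ¬ (Function.Injective e ∧
        i ∉ Finset.univ.image e ∧ Factors V (Finset.univ.image e) i)).card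
      ≤ (s ^ 2 + s + 2 ^ s) * n ^ s := by
  have h1 : ∀ e : Fin s → Fin n, (Finset.univ.filter fun i => ¬ (Function.Injective e ∧
        i ∉ Finset.univ.image e ∧ Factors V (Finset.univ.image e) i)).card
      ≤ (if ¬ Function.Injective e then n else 0) + (s + 2 ^ s) := by
    intro e
    by_cases he : Function.Injective e
    · have hsub : (Finset.univ.filter fun i => ¬ (Function.Injective e ∧
          i ∉ Finset.univ.image e ∧ Factors V (Finset.univ.image e) i))
        ⊆ Finset.univ.image e ∪ Finset.univ.filter
          fun i => i ∉ Finset.univ.image e ∧ ¬ Factors V (Finset.univ.image e) i := by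
        intro i hi
        have hi := (Finset.mem_filter.1 hi).2
        rw [Finset.mem_union, Finset.mem_filter]
        have := Finset.mem_univ i
        tauto
      have hcard : (Finset.univ.image e).card = s := by
        rw [Finset.card_image_of_injective _ he, Finset.card_univ, Fintype.card_fin]
      have h2 := hV.card_not_factors_le h (Finset.univ.image e)
      have h3 := (Finset.card_le_card hsub).trans (Finset.card_union_le _ _)
      rw [hcard] at h2 h3
      rw [if_neg (not_not.2 he), zero_add]
      exact h3.trans (Nat.add_le_add_left h2 s)
    · refine (Finset.card_le_univ _).trans ?_
      rw [Fintype.card_fin, if_pos he]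
      exact Nat.le_add_right n _
  refine (Finset.sum_le_sum fun e _ => h1 e).trans ?_
  have h2 := card_not_injective_le s (Fin n)
  rw [Fintype.card_fin, mul_comm] at h2
  rw [Finset.sum_add_distrib, ← Finset.sum_filter, Finset.sum_const, Finset.sum_const,
    Finset.card_univ, Fintype.card_pi, Finset.prod_const, Finset.card_univ, Fintype.card_fin,
    Fintype.card_fin, smul_eq_mul, smul_eq_mul]
  exact (Nat.add_le_add_right h2 _).trans_eq (by ring)

/-- For every local system, all but a small fraction of the injective samples have a product
vector. -/
theorem card_not_hasProduct_le (c : ℕ) : ∀ δ : ℝ, 0 < δ → ∃ N : ℕ, ∀ n : ℕ, N ≤ n →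
    ∀ V : Finset (Fin n) → Submodule ℂ ((Fin n → Fin 2) → ℂ), IsLocalSystem V →
      V Finset.univ ≠ ⊥ →
      ((Finset.univ.filter fun ω : Fin c → Fin n =>
        Function.Injective ω ∧ ¬ HasProduct V ω).card : ℝ) ≤ δ * (n : ℝ) ^ c := by
  induction c with
  | zero =>
    refine fun δ hδ => ⟨0, fun n _ V hV h => ?_⟩
    rw [Finset.filter_false_of_mem fun ω _ hω => hω.2 (hV.hasProduct_of_isEmpty h ω)]
    simpa using hδ.le
  | succ c ih =>
    intro δ hδ
    obtain ⟨N₀, hN₀⟩ := ih (δ / 4) (by positivity)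
    set s := max N₀ (2 * c ^ 2) + 1 with hs
    have hs0 : 0 < s := by omega
    set K : ℕ := s ^ 2 + s + 2 ^ s with hK
    refine ⟨⌈4 * K / δ⌉₊ + 1, fun n hn V hV h => ?_⟩
    have hn0 : 0 < n := by omega
    have hKn : (K : ℝ) ≤ δ / 4 * n := by
      have h1 : (4 * K / δ : ℝ) ≤ n := (Nat.le_ceil _).trans (Nat.cast_le.2 (by omega))
      rw [div_le_iff₀ hδ] at h1
      linarith
    set P : (Fin (c + 1) → Fin n) → Prop := fun ω => Function.Injective ω ∧ ¬ HasProduct V ω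
      with hP
    set G : (Fin s → Fin n) → Fin n → Prop := fun e i => Function.Injective e ∧
        i ∉ Finset.univ.image e ∧ Factors V (Finset.univ.image e) i with hG
    set A : (Fin s → Fin n) → Fin n → ℕ := fun e i =>
      ((Finset.univ.filter fun u : Fin c → Fin s => Function.Injective u).filter
          fun u => P (Fin.cons i (e ∘ u))).card with hA
    have hgood : ∀ e i, G e i → (A e i : ℝ) ≤ δ / 4 * (s : ℝ) ^ c := by
      rintro e i ⟨he, hi, x, hx, v, hv, hv0, hvx⟩
      have hie : ∀ j, e j ≠ i := fun j hj =>
        hi (Finset.mem_image.2 ⟨j, Finset.mem_univ j, hj⟩)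
      refine le_trans ?_ (hN₀ s (by omega) _ (hV.pullback he hie x)
        (hV.pullback_univ_ne_bot he hv hv0 hvx))
      refine Nat.cast_le.2 (Finset.card_le_card fun u hu => ?_)
      rw [Finset.filter_filter, Finset.mem_filter] at hu
      exact Finset.mem_filter.2 ⟨hu.1, hu.2.1, fun hprod => hu.2.2.2 (hprod.cons hx)⟩
    have hle : ∀ e i, (A e i : ℝ)
        ≤ δ / 4 * (s : ℝ) ^ c + (if ¬ G e i then 1 else 0) * (s : ℝ) ^ c := by
      intro e i
      by_cases hGe : G e i
      · simpa [hGe] using hgood e i hGe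
      · have h1 : A e i ≤ s ^ c := by
          refine (Finset.card_le_univ _).trans ?_
          simp
        have h2 : (A e i : ℝ) ≤ (s : ℝ) ^ c := by exact_mod_cast h1
        simp only [hGe, not_false_eq_true, if_true, one_mul]
        exact h2.trans (le_add_of_nonneg_left (by positivity))
    have hbad : (∑ e : Fin s → Fin n, ∑ i, (if ¬ G e i then (1 : ℝ) else 0))
        ≤ K * (n : ℝ) ^ s := by
      have h1 := hV.sum_card_not_factors_le (s := s) h
      simp only [Finset.card_filter] at h1
      exact_mod_cast h1
    have hsum : (∑ e : Fin s → Fin n, ∑ i, (A e i : ℝ))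
        ≤ (n : ℝ) ^ s * (s : ℝ) ^ c * (δ / 2 * n) := by
      calc (∑ e : Fin s → Fin n, ∑ i, (A e i : ℝ))
          ≤ ∑ e : Fin s → Fin n, ∑ i, (δ / 4 * (s : ℝ) ^ c
            + (if ¬ G e i then 1 else 0) * (s : ℝ) ^ c) :=
            Finset.sum_le_sum fun e _ => Finset.sum_le_sum fun i _ => hle e i
        _ = (n : ℝ) ^ s * (n * (δ / 4 * (s : ℝ) ^ c))
            + (∑ e : Fin s → Fin n, ∑ i, (if ¬ G e i then (1 : ℝ) else 0)) * (s : ℝ) ^ c := by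
            simp only [Finset.sum_add_distrib, ← Finset.sum_mul, Finset.sum_const,
              Finset.card_univ, Fintype.card_pi, Finset.prod_const, Fintype.card_fin,
              nsmul_eq_mul, Nat.cast_pow]
            ring
        _ ≤ (n : ℝ) ^ s * (n * (δ / 4 * (s : ℝ) ^ c))
            + (δ / 4 * n * (n : ℝ) ^ s) * (s : ℝ) ^ c := by
            gcongr
            exact hbad.trans (mul_le_mul_of_nonneg_right hKn (by positivity))
        _ = _ := by ring
    have hcount := sum_card_comp_injective (s := s) P
    rw [Fintype.card_fin] at hcount
    have hcount' : (n : ℝ) ^ c * ∑ e : Fin s → Fin n, ∑ i, (A e i : ℝ)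
        = (Finset.univ.filter fun u : Fin c → Fin s => Function.Injective u).card
          * (n : ℝ) ^ s * (Finset.univ.filter P).card := by
      simp only [hA]
      norm_cast
      convert hcount
    have hhalf : (s : ℝ) ^ c
        ≤ 2 * (Finset.univ.filter fun u : Fin c → Fin s => Function.Injective u).card := by
      exact_mod_cast half_pow_le_card_injective hs0 (by omega : 2 * c ^ 2 ≤ s)
    have hpos : (0 : ℝ) < (s : ℝ) ^ c * (n : ℝ) ^ s := by positivity
    refine le_of_mul_le_mul_left ?_ hpos
    calc (s : ℝ) ^ c * (n : ℝ) ^ s * (Finset.univ.filter P).card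
        ≤ 2 * (Finset.univ.filter fun u : Fin c → Fin s => Function.Injective u).card
          * (n : ℝ) ^ s * (Finset.univ.filter P).card := by gcongr
      _ = 2 * ((n : ℝ) ^ c * ∑ e : Fin s → Fin n, ∑ i, (A e i : ℝ)) := by rw [hcount']; ring
      _ ≤ 2 * ((n : ℝ) ^ c * ((n : ℝ) ^ s * (s : ℝ) ^ c * (δ / 2 * n))) := by gcongr
      _ = _ := by ring

theorem extend_comp_of_injective {ι κ : Type*} {k : ℕ} {ω : ι → κ} (hω : Function.Injective ω)
    (q : Fin k → ι) (g : Fin k → Fin 2) (h : κ → Fin 2) :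
    Function.extend (ω ∘ q) g h ∘ ω = Function.extend q g (h ∘ ω) := by
  ext1 l
  by_cases hl : ∃ j, q j = l
  · have hl' : ∃ j, (ω ∘ q) j = ω l := hl.imp fun j hj => congrArg ω hj
    rw [Function.comp_apply, Function.extend_def, Function.extend_def, dif_pos hl, dif_pos hl']
    congr! 3
    exact hω.eq_iff
  · have hl' : ¬ ∃ j, (ω ∘ q) j = ω l := fun ⟨j, hj⟩ => hl ⟨j, hω hj⟩
    rw [Function.extend_apply' _ _ _ hl, Function.comp_apply, Function.extend_apply' _ _ _ hl',
      Function.comp_apply]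

theorem sum_mul_prod_extend {ι : Type*} [Fintype ι] [DecidableEq ι] {k : ℕ} {t : Fin k → ι}
    (ht : Function.Injective t) (w : (Fin k → Fin 2) → ℂ) (y : ι → Fin 2 → ℂ) (h : ι → Fin 2) :
    ∑ g, w g * ∏ i, y i (Function.extend t g h i)
      = evalForm w (y ∘ t) * ∏ i ∈ Finset.univ \ Finset.univ.image t, y i (h i) := by
  rw [evalForm, Finset.sum_mul]
  refine Finset.sum_congr rfl fun g _ => ?_
  rw [← Finset.prod_sdiff (Finset.subset_univ (Finset.univ.image t)),
    Finset.prod_image fun a _ b _ hab => ht hab, mul_comm (Finset.prod _ _), mul_assoc]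
  congr 2
  · exact Finset.prod_congr rfl fun j _ => by rw [ht.extend_apply, Function.comp_apply]
  · refine Finset.prod_congr rfl fun i hi => ?_
    rw [Function.extend_apply']
    rintro ⟨j, rfl⟩
    simp at hi

/-- The vectors on a set of qubits annihilated by all the forms `F t f` on it. -/
def solutionSpace {ι : Type*} {k : ℕ} (F : (Fin k → ι) → (Fin k → Fin 2) → (Fin k → Fin 2) → ℂ)
    (C : Finset ι) : Submodule ℂ ((ι → Fin 2) → ℂ) where
  carrier := {v | (∀ f g, (∀ i ∈ C, f i = g i) → v f = v g) ∧
    ∀ t, Function.Injective t → (∀ l, t l ∈ C) → ∀ f h,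
      ∑ g, F t f g * v (Function.extend t g h) = 0}
  add_mem' := by
    rintro v w ⟨hv, hv'⟩ ⟨hw, hw'⟩
    refine ⟨fun f g h => by simp [hv f g h, hw f g h], fun t ht htC f h => ?_⟩
    simp only [Pi.add_apply, mul_add, Finset.sum_add_distrib, hv' t ht htC, hw' t ht htC, add_zero]
  zero_mem' := ⟨fun _ _ _ => rfl, fun t _ _ f h => by simp⟩
  smul_mem' := by
    rintro a w ⟨hw, hw'⟩
    refine ⟨fun f g h => by simp [hw f g h], fun t ht htC f h => ?_⟩
    simp only [Pi.smul_apply, smul_eq_mul, mul_left_comm _ a, ← Finset.mul_sum, hw' t ht htC,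
      mul_zero]

theorem isLocalSystem_solutionSpace {ι : Type*} [DecidableEq ι] {k : ℕ}
    (F : (Fin k → ι) → (Fin k → Fin 2) → (Fin k → Fin 2) → ℂ) :
    IsLocalSystem (solutionSpace F) where
  dep C v hv := hv.1
  contract C v hv i hi b := by
    refine ⟨fun f g h => hv.1 _ _ fun l hl => ?_, fun t ht htC f h => ?_⟩
    · by_cases hli : l = i
      · simp [hli]
      · simpa [hli] using h l (Finset.mem_erase.2 ⟨hli, hl⟩)
    · rw [← hv.2 t ht (fun l => Finset.mem_of_mem_erase (htC l)) f (Function.update h i b)]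
      refine Finset.sum_congr rfl fun g _ => ?_
      change _ * v _ = _ * v _
      congr 2
      ext1 l
      by_cases hl : ∃ j, t j = l
      · obtain ⟨j, rfl⟩ := hl
        rw [Function.update_of_ne (Finset.ne_of_mem_erase (htC j)), ht.extend_apply,
          ht.extend_apply]
      · rw [Function.extend_apply' _ _ _ hl]
        by_cases hli : l = i
        · simp [hli]
        · rw [Function.update_of_ne hli, Function.update_of_ne hli, Function.extend_apply' _ _ _ hl]

theorem HasProduct.sampleSatisfiable {ι : Type*} [DecidableEq ι] {k c : ℕ}
    {F : (Fin k → ι) → (Fin k → Fin 2) → (Fin k → Fin 2) → ℂ}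
    (hF : ∀ t, ¬ Function.Injective t → F t = 0) {ω : Fin c → ι} (hω : Function.Injective ω)
    (h : HasProduct (solutionSpace F) ω) : SampleSatisfiable F ω := by
  obtain ⟨x, hx, hmem⟩ := h
  refine ⟨x, hx, fun q f => ?_⟩
  by_cases hq : Function.Injective (ω ∘ q)
  · choose b hb using fun l => Function.ne_iff.1 (hx l)
    have h1 := hmem.2 (ω ∘ q) hq (fun l => by simp) f (Function.extend ω b 0)
    have h2 : ∀ g l, Function.extend (ω ∘ q) g (Function.extend ω b 0) (ω l)
        = Function.extend q g b l := fun g l => by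
      have := congrFun (extend_comp_of_injective hω q g (Function.extend ω b 0)) l
      rwa [Function.extend_comp hω] at this
    simp only [h2] at h1
    rw [sum_mul_prod_extend hq.of_comp] at h1
    exact (mul_eq_zero.1 h1).resolve_right (Finset.prod_ne_zero_iff.2 fun l _ => hb l)
  · simp [hF _ hq, evalForm]

theorem extendOp_univ_mulVec {n : ℕ} (s : Finset (Fin n))
    (A : Matrix (↥s → Fin 2) (↥s → Fin 2) ℂ) (ψ : QVec n Finset.univ)
    (h : ↥(Finset.univ : Finset (Fin n)) → Fin 2) :
    (extendOp s Finset.univ A).mulVec ψ h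
      = ∑ g, A (fun j => h ⟨j, Finset.mem_univ _⟩) g
        * ψ (fun i => if hi : (i : Fin n) ∈ s then g ⟨i, hi⟩ else h i) := by
  have h1 : (extendOp s Finset.univ A).mulVec ψ h
      = ∑ p with ∀ i : ↥(Finset.univ : Finset (Fin n)), (i : Fin n) ∉ s → h i = p i,
        A (fun j => h ⟨j, Finset.mem_univ _⟩) (fun j => p ⟨j, Finset.mem_univ _⟩) * ψ p := by
    rw [Finset.sum_filter]
    refine Finset.sum_congr rfl fun p _ => ?_
    simp only [extendOp, Matrix.of_apply, Finset.subset_univ, dite_true]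
    split_ifs <;> simp
  rw [h1]
  refine Finset.sum_bij' (fun p _ j => p ⟨j, Finset.mem_univ _⟩)
    (fun g _ i => if hi : (i : Fin n) ∈ s then g ⟨i, hi⟩ else h i) ?_ ?_ ?_ ?_ ?_
  · exact fun p _ => Finset.mem_univ _
  · exact fun g _ => Finset.mem_filter.2 ⟨Finset.mem_univ _, fun i hi => by simp [hi]⟩
  · intro p hp
    ext1 i
    by_cases hi : (i : Fin n) ∈ s
    · simp [hi]
    · simp [hi, (Finset.mem_filter.1 hp).2 i hi]
  · intro g _
    ext1 j
    simp
  · intro p hp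
    congr 2
    ext1 i
    by_cases hi : (i : Fin n) ∈ s
    · simp [hi]
    · simp [hi, (Finset.mem_filter.1 hp).2 i hi]

theorem extendOp_univ_isHermitian {n : ℕ} {s : Finset (Fin n)}
    {A : Matrix (↥s → Fin 2) (↥s → Fin 2) ℂ} (hA : A.IsHermitian) :
    (extendOp s Finset.univ A).IsHermitian := by
  ext f g
  have h1 : (∀ i : ↥(Finset.univ : Finset (Fin n)), (i : Fin n) ∉ s → f i = g i)
      ↔ ∀ i : ↥(Finset.univ : Finset (Fin n)), (i : Fin n) ∉ s → g i = f i :=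
    forall₂_congr fun _ _ => eq_comm
  simp only [Matrix.conjTranspose_apply, extendOp, Matrix.of_apply, Finset.subset_univ, dite_true,
    h1]
  split_ifs
  · exact hA.apply _ _
  · simp

theorem extendOp_univ_mul_self {n : ℕ} {s : Finset (Fin n)}
    {A : Matrix (↥s → Fin 2) (↥s → Fin 2) ℂ} (hA : A * A = A) :
    extendOp s Finset.univ A * extendOp s Finset.univ A = extendOp s Finset.univ A := by
  ext f q
  have h1 := extendOp_univ_mulVec s A (fun p => extendOp s Finset.univ A p q) f
  have h2 : (extendOp s Finset.univ A * extendOp s Finset.univ A) f q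
      = (extendOp s Finset.univ A).mulVec (fun p => extendOp s Finset.univ A p q) f := rfl
  rw [h2, h1]
  simp only [extendOp, Matrix.of_apply, Finset.subset_univ, dite_true]
  have h3 : ∀ g : ↥s → Fin 2, (∀ i : ↥(Finset.univ : Finset (Fin n)), (i : Fin n) ∉ s →
      (if hi : (i : Fin n) ∈ s then g ⟨i, hi⟩ else f i) = q i)
      ↔ ∀ i : ↥(Finset.univ : Finset (Fin n)), (i : Fin n) ∉ s → f i = q i := fun g =>
    forall₂_congr fun i hi => by rw [dif_neg hi]
  simp only [h3]
  split_ifs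
  · nth_rewrite 3 [← hA]
    rw [Matrix.mul_apply]
    exact Finset.sum_congr rfl fun g _ => by simp
  · simp

/-- A vector annihilated by the sum of the projections is annihilated by each of them. -/
theorem mulVec_eq_zero_of_constraintSum {n k : ℕ} (I : Instance n k) {ψ : QVec n Finset.univ}
    (h : constraintSum I Finset.univ ψ = 0) {s : Finset (Fin n)} (hs : s.card = k) :
    (extendOp s Finset.univ (I.K s)).mulVec ψ = 0 := by
  open scoped ComplexOrder in
  have h1 : ∀ s : Finset (Fin n), s.card = k →
      star ψ ⬝ᵥ (extendOp s Finset.univ (I.K s)).mulVec ψ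
        = star ((extendOp s Finset.univ (I.K s)).mulVec ψ)
          ⬝ᵥ (extendOp s Finset.univ (I.K s)).mulVec ψ := by
    intro s hs
    rw [Matrix.star_mulVec, (extendOp_univ_isHermitian (I.isHermitian s hs)).eq,
      ← Matrix.dotProduct_mulVec, Matrix.mulVec_mulVec,
      extendOp_univ_mul_self (I.isIdempotent s hs)]
  have h2 : ∑ s ∈ Finset.powersetCard k Finset.univ,
      star ψ ⬝ᵥ (extendOp s Finset.univ (I.K s)).mulVec ψ = 0 := by
    rw [← dotProduct_sum]
    exact (congrArg (star ψ ⬝ᵥ ·) h).trans (dotProduct_zero _)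
  rw [Finset.sum_eq_zero_iff_of_nonneg] at h2
  · have h3 := h2 s (Finset.mem_powersetCard.2 ⟨Finset.subset_univ _, hs⟩)
    rw [h1 s hs] at h3
    exact dotProduct_star_self_eq_zero.1 h3
  · intro s hs
    rw [h1 s (Finset.mem_powersetCard.1 hs).2]
    exact dotProduct_star_self_nonneg _

/-- The matrix of the constraint on the qubits listed by `t`, in the order given by `t`. -/
noncomputable def orderedConstraint {n k : ℕ} (I : Instance n k) (t : Fin k → Fin n)
    (f g : Fin k → Fin 2) : ℂ :=
  if Function.Injective t then
    I.K (Finset.univ.image t) (fun j => Function.extend t f 0 j)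
      (fun j => Function.extend t g 0 j)
  else 0

theorem mulVec_eq_sum_orderedConstraint {n k : ℕ} (I : Instance n k) {t : Fin k → Fin n}
    (ht : Function.Injective t) (v : (Fin n → Fin 2) → ℂ) (h : Fin n → Fin 2) :
    (extendOp (Finset.univ.image t) Finset.univ (I.K (Finset.univ.image t))).mulVec
        (fun p => v fun i => p ⟨i, Finset.mem_univ i⟩) (fun i => h i)
      = ∑ g, orderedConstraint I t (h ∘ t) g * v (Function.extend t g h) := by
  rw [extendOp_univ_mulVec]
  have hmem : ∀ l, t l ∈ Finset.univ.image t := fun l =>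
    Finset.mem_image_of_mem t (Finset.mem_univ l)
  let e : Fin k ≃ ↥(Finset.univ.image t) :=
    Equiv.ofBijective (fun l => ⟨t l, hmem l⟩)
      ⟨fun a b hab => ht (congrArg Subtype.val hab), fun ⟨i, hi⟩ => by
        obtain ⟨l, -, rfl⟩ := Finset.mem_image.1 hi
        exact ⟨l, rfl⟩⟩
  have he : ∀ g : Fin k → Fin 2, (e.arrowCongr (Equiv.refl (Fin 2))) g
      = fun j : ↥(Finset.univ.image t) => Function.extend t g 0 (j : Fin n) := by
    intro g
    ext1 j
    obtain ⟨l, rfl⟩ := e.surjective j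
    have : ((e l : ↥(Finset.univ.image t)) : Fin n) = t l := rfl
    rw [this, ht.extend_apply]
    simp [Equiv.arrowCongr]
  rw [← (e.arrowCongr (Equiv.refl (Fin 2))).sum_comp]
  refine Finset.sum_congr rfl fun g _ => ?_
  rw [he, orderedConstraint, if_pos ht]
  congr 2
  · ext1 j
    obtain ⟨j, hj⟩ := j
    obtain ⟨l, -, rfl⟩ := Finset.mem_image.1 hj
    simp [ht.extend_apply]
  · ext1 i
    by_cases hi : i ∈ Finset.univ.image t
    · obtain ⟨l, -, rfl⟩ := Finset.mem_image.1 hi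
      simp [ht.extend_apply]
    · simp only [dif_neg hi]
      rw [Function.extend_apply']
      rintro ⟨l, rfl⟩
      exact hi (hmem l)

theorem solutionSpace_univ_ne_bot {n k : ℕ} {I : Instance n k} (hI : Satisfiable I) :
    solutionSpace (orderedConstraint I) Finset.univ ≠ ⊥ := by
  obtain ⟨ψ, hψ, hsum⟩ := hI
  refine (Submodule.ne_bot_iff _).2 ⟨fun p => ψ fun i => p i, ⟨fun f g h => ?_, ?_⟩, ?_⟩
  · rw [funext fun i => h i (Finset.mem_univ i)]
  · intro t ht _ f h
    have h1 := mulVec_eq_sum_orderedConstraint I ht (fun p => ψ fun i => p i)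
      (Function.extend t f h)
    have h2 := mulVec_eq_zero_of_constraintSum I hsum (s := Finset.univ.image t)
      (by rw [Finset.card_image_of_injective _ ht, Finset.card_univ, Fintype.card_fin])
    rw [show (fun p : ↥(Finset.univ : Finset (Fin n)) → Fin 2 =>
        ψ fun i => p ⟨i, Finset.mem_univ _⟩) = ψ from rfl, h2, Function.extend_comp ht] at h1
    rw [Pi.zero_apply] at h1
    have hext : ∀ g, Function.extend t g (Function.extend t f h) = Function.extend t g h := by
      intro g
      ext1 i
      by_cases hi : ∃ l, t l = i
      · obtain ⟨l, rfl⟩ := hi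
        rw [ht.extend_apply, ht.extend_apply]
      · rw [Function.extend_apply' _ _ _ hi, Function.extend_apply' _ _ _ hi,
          Function.extend_apply' _ _ _ hi]
    simp only [hext] at h1
    exact h1.symm
  · intro h0
    refine hψ (funext fun p => ?_)
    exact congrFun h0 fun i => p ⟨i, Finset.mem_univ i⟩

theorem card_not_sampleSatisfiable_le (k c : ℕ) : ∃ N : ℕ, ∀ n : ℕ, N ≤ n → ∀ I : Instance n k,
    Satisfiable I → ((Finset.univ.filter fun ω : Fin c → Fin n =>
      ¬ SampleSatisfiable (orderedConstraint I) ω).card : ℝ) ≤ 1 / 4 * (n : ℝ) ^ c := by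
  obtain ⟨N, hN⟩ := card_not_hasProduct_le c (1 / 8) (by norm_num)
  refine ⟨max N (8 * c ^ 2) + 1, fun n hn I hI => ?_⟩
  have h1 := hN n (by omega) _ (isLocalSystem_solutionSpace (orderedConstraint I))
    (solutionSpace_univ_ne_bot hI)
  have h2 := card_not_injective_le c (Fin n)
  rw [Fintype.card_fin] at h2
  have hn0 : (0 : ℝ) < n := by exact_mod_cast (by omega : 0 < n)
  have h3 : ((Finset.univ.filter fun ω : Fin c → Fin n => ¬ Function.Injective ω).card : ℝ)
      ≤ 1 / 8 * (n : ℝ) ^ c := by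
    have h4 : (n : ℝ) * (Finset.univ.filter
        fun ω : Fin c → Fin n => ¬ Function.Injective ω).card ≤ (c : ℝ) ^ 2 * (n : ℝ) ^ c := by
      exact_mod_cast h2
    have h5 : 8 * (c : ℝ) ^ 2 ≤ n := by exact_mod_cast (by omega : 8 * c ^ 2 ≤ n)
    refine le_of_mul_le_mul_left (h4.trans ?_) hn0
    have h6 := mul_le_mul_of_nonneg_right h5 (by positivity : (0 : ℝ) ≤ (n : ℝ) ^ c)
    linarith
  have hsub : (Finset.univ.filter fun ω : Fin c → Fin n =>
      ¬ SampleSatisfiable (orderedConstraint I) ω)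
      ⊆ (Finset.univ.filter fun ω : Fin c → Fin n => ¬ Function.Injective ω)
        ∪ Finset.univ.filter fun ω : Fin c → Fin n => Function.Injective ω ∧
          ¬ HasProduct (solutionSpace (orderedConstraint I)) ω := by
    intro ω hω
    have hω := (Finset.mem_filter.1 hω).2
    have hmem := Finset.mem_univ ω
    have himp : Function.Injective ω → HasProduct (solutionSpace (orderedConstraint I)) ω →
        SampleSatisfiable (orderedConstraint I) ω := fun hinj hprod =>
      hprod.sampleSatisfiable (fun t ht => by ext f g; simp [orderedConstraint, ht]) hinj
    rw [Finset.mem_union, Finset.mem_filter, Finset.mem_filter]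
    tauto
  have h4 : ((Finset.univ.filter fun ω : Fin c → Fin n =>
      ¬ SampleSatisfiable (orderedConstraint I) ω).card : ℝ)
      ≤ (Finset.univ.filter fun ω : Fin c → Fin n => ¬ Function.Injective ω).card
        + (Finset.univ.filter fun ω : Fin c → Fin n => Function.Injective ω ∧
          ¬ HasProduct (solutionSpace (orderedConstraint I)) ω).card := by
    exact_mod_cast (Finset.card_le_card hsub).trans (Finset.card_union_le _ _)
  linarith

/-- A product vector violates at most as many constraints as ordered constraints. -/
theorem EpsFarFromProdSat.le_card {n k : ℕ} {I : Instance n k} {ε : ℝ}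
    (hI : EpsFarFromProdSat I ε) {a : Fin n → Fin 2 → ℂ} (ha : ∀ i, a i ≠ 0) :
    ε * (n : ℝ) ^ k ≤ ((Finset.univ.filter fun t : Fin k → Fin n =>
      ∃ f, evalForm (orderedConstraint I t f) (a ∘ t) ≠ 0).card : ℝ) := by
  refine (hI ((Finset.univ.filter fun t : Fin k → Fin n =>
      ∃ f, evalForm (orderedConstraint I t f) (a ∘ t) ≠ 0).image fun t => Finset.univ.image t)
    ⟨fun i => a i, fun i => ha i, Finset.sum_eq_zero fun s hs => ?_⟩).trans
      (Nat.cast_le.2 Finset.card_image_le)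
  obtain ⟨hs, hsSig⟩ := Finset.mem_sdiff.1 hs
  have hsk := (Finset.mem_powersetCard.1 hs).2
  obtain ⟨t, ht, rfl⟩ : ∃ t : Fin k → Fin n, Function.Injective t ∧ Finset.univ.image t = s :=
    ⟨s.orderEmbOfFin hsk, (s.orderEmbOfFin hsk).injective, by
      rw [← Finset.coe_inj, Finset.coe_image, Finset.coe_univ, Set.image_univ,
        Finset.range_orderEmbOfFin]⟩
  have hform : ∀ f, evalForm (orderedConstraint I t f) (a ∘ t) = 0 := by
    by_contra! h
    exact hsSig (Finset.mem_image.2 ⟨t, Finset.mem_filter.2 ⟨Finset.mem_univ _, h⟩, rfl⟩)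
  ext1 h
  have h1 := mulVec_eq_sum_orderedConstraint I ht (fun p => ∏ i, a i (p i))
    fun i => h ⟨i, Finset.mem_univ i⟩
  rw [sum_mul_prod_extend ht, hform, zero_mul] at h1
  have h2 : prodVec (fun i : ↥(Finset.univ : Finset (Fin n)) => a i)
      = fun p => ∏ i, a i (p ⟨i, Finset.mem_univ i⟩) := by
    ext1 p
    exact Finset.prod_coe_sort_eq_attach _ _ |>.trans
      (Finset.prod_attach_univ (fun i => a i.1 (p i)))
  rw [h2]
  exact h1

/-- For every `k` and `ε > 0`, for all large enough `n`, no instance of quantum `k`-SAT on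
`n` qubits is both satisfiable and `ε`-far from satisfiable by a product state. -/
theorem not_satisfiable_and_far (k : ℕ) (ε : ℝ) (hε : 0 < ε) :
    ∃ N : ℕ, ∀ n : ℕ, N ≤ n → ∀ I : Instance n k,
      ¬ (Satisfiable I ∧ EpsFarFromProdSat I ε) := by
  obtain ⟨c, hc⟩ := exists_assignment_of_sampleSatisfiable k (half_pos hε)
  obtain ⟨N, hN⟩ := card_not_sampleSatisfiable_le k c
  refine ⟨N + 1, fun n hn I ⟨hsat, hfar⟩ => ?_⟩
  have hn0 : 0 < n := by omega
  have : Nonempty (Fin n) := ⟨⟨0, hn0⟩⟩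
  have h1 := hN n (by omega) I hsat
  obtain ⟨a, ha, hcard⟩ := hc (Fin n) (orderedConstraint I) (by simpa using h1)
  rw [Fintype.card_fin] at hcard
  have h2 := (hfar.le_card ha).trans hcard
  have h3 : (0 : ℝ) < (n : ℝ) ^ k := by positivity
  nlinarith

end QkSAT
end

section
/- Let n, c be natural numbers such that l := n/2^c + δ and k := l/2 + ε are natural numbers, where −3 ≤ δ < −1 and −1/2 ≤ ε ≤ 0. Let G be an l-regular hypergraph on n vertices with edge density θ ∈ (0,1]. Suppose n ≥ 3·2^c and n ≥ 3·2^{c+1}·( 1/2 + (1/ln A)·( A^{1/3}/4 − ln θ ) ) for some constant A > 1. Then the edge density θ|_{k,1/2} of every partial (k,1/2)-shadow of G satisfies θ|_{k,1/2} ≥ θ / ( 2·√( A·exp(A^{1/3}/2) ) ). -/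
open scoped Classical

/-- `H` is a partial `(k, 1/2)`-shadow of the `l`-regular hypergraph `G`: it is obtained
by choosing, for each edge `E` of `G`, a subset `K_E ⊆ σ_k(E)` of size
`⌊(1/2)·C(l,k)⌋` and taking the union of the chosen sets as the edge set. -/
def IsPartialHalfShadow {n : ℕ} (G : Finset (Finset (Fin n))) (l k : ℕ)
    (H : Finset (Finset (Fin n))) : Prop :=
  ∃ Kf : Finset (Fin n) → Finset (Finset (Fin n)),
    (∀ E ∈ G, Kf E ⊆ Finset.powersetCard k E ∧ (Kf E).card = l.choose k / 2) ∧
    H = G.biUnion Kf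

/-- The number of `l`-sets of a family containing a fixed `k`-set is at most `C(n - k, l - k)`. -/
theorem card_filter_superset_le {n l k : ℕ} (G : Finset (Finset (Fin n)))
    (hreg : ∀ e ∈ G, e.card = l) (K : Finset (Fin n)) (hK : K.card = k) :
    (G.filter (fun E => K ⊆ E)).card ≤ (n - k).choose (l - k) := by
  have hc : (Finset.powersetCard (l - k) Kᶜ).card = (n - k).choose (l - k) := by
    rw [Finset.card_powersetCard, Finset.card_compl, Fintype.card_fin, hK]
  rw [← hc]
  refine Finset.card_le_card_of_injOn (fun E => E \ K) ?_ ?_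
  · intro E hE
    obtain ⟨hE, hKE⟩ := Finset.mem_filter.1 (Finset.mem_coe.1 hE)
    refine Finset.mem_coe.2 (Finset.mem_powersetCard.2 ⟨fun x hx => ?_, ?_⟩)
    · exact Finset.mem_compl.2 (Finset.mem_sdiff.1 hx).2
    · rw [Finset.card_sdiff_of_subset hKE, hreg E hE, hK]
  · intro E hE F hF h
    have hE := (Finset.mem_filter.1 (Finset.mem_coe.1 hE)).2
    have hF := (Finset.mem_filter.1 (Finset.mem_coe.1 hF)).2
    rw [← Finset.sdiff_union_of_subset hE, ← Finset.sdiff_union_of_subset hF]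
    exact congrArg (· ∪ K) h

/-- Double counting of the pairs `(K, E)` with `K ∈ K_E`. -/
theorem IsPartialHalfShadow.card_mul_le {n l k : ℕ} {G H : Finset (Finset (Fin n))}
    (hreg : ∀ e ∈ G, e.card = l) (hH : IsPartialHalfShadow G l k H) :
    G.card * (l.choose k / 2) ≤ H.card * (n - k).choose (l - k) := by
  obtain ⟨Kf, hKf, rfl⟩ := hH
  refine Finset.card_mul_le_card_mul (fun E K => K ∈ Kf E) (fun E hE => ?_) (fun K hK => ?_)
  · rw [← (hKf E hE).2]
    refine Finset.card_le_card fun K hK => ?_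
    exact (Finset.mem_bipartiteAbove _).2 ⟨Finset.mem_biUnion.2 ⟨E, hE, hK⟩, hK⟩
  · obtain ⟨E, hE, hKE⟩ := Finset.mem_biUnion.1 hK
    have hKc := (Finset.mem_powersetCard.1 ((hKf E hE).1 hKE)).2
    refine le_trans (Finset.card_le_card fun F hF => ?_) (card_filter_superset_le G hreg K hKc)
    obtain ⟨hF, hKF⟩ := (Finset.mem_bipartiteBelow _).1 hF
    exact Finset.mem_filter.2 ⟨hF, (Finset.mem_powersetCard.1 ((hKf F hF).1 hKF)).1⟩

/-- A partial `(k, 1/2)`-shadow has density at least `⌊C(l,k)/2⌋ / C(l,k)` times that of the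
hypergraph. -/
theorem IsPartialHalfShadow.density_le {n l k : ℕ} {θ θk : ℝ} {G H : Finset (Finset (Fin n))}
    (hkl : k ≤ l) (hln : l ≤ n) (hreg : ∀ e ∈ G, e.card = l)
    (hθ : (G.card : ℝ) = θ * (n.choose l : ℝ)) (hH : IsPartialHalfShadow G l k H)
    (hθk : (H.card : ℝ) = θk * (n.choose k : ℝ)) :
    θ * (l.choose k / 2 : ℕ) ≤ θk * l.choose k := by
  have h1 : (G.card : ℝ) * (l.choose k / 2 : ℕ) ≤ H.card * (n - k).choose (l - k) :=
    mod_cast hH.card_mul_le hreg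
  have h2 : (n.choose l : ℝ) * l.choose k = n.choose k * (n - k).choose (l - k) :=
    mod_cast Nat.choose_mul hkl
  have h3 : (0 : ℝ) < n.choose l := mod_cast Nat.choose_pos hln
  rw [hθ, hθk, mul_assoc θk, ← h2] at h1
  refine le_of_mul_le_mul_left ?_ h3
  linarith

theorem Nat.le_choose_of_pos_of_lt {l k : ℕ} (hk : 0 < k) (hkl : k < l) : l ≤ l.choose k := by
  induction l generalizing k with
  | zero => omega
  | succ l ih =>
    obtain ⟨k, rfl⟩ : ∃ j, k = j + 1 := ⟨k - 1, by omega⟩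
    rcases Nat.lt_or_ge (k + 1) l with h | h
    · have := ih (Nat.succ_pos k) h
      have := Nat.choose_pos (show k ≤ l by omega)
      rw [Nat.choose_succ_succ]
      omega
    · obtain rfl : l = k + 1 := by omega
      rw [Nat.choose_succ_self_right]

theorem Real.exp_one_mul_log_le_three_mul_rpow {A : ℝ} (hA : 0 < A) :
    Real.exp 1 * Real.log A ≤ 3 * A ^ ((1 : ℝ) / 3) := by
  have h := Real.add_one_le_exp (Real.log A * (1 / 3) - 1)
  have h2 : A ^ ((1 : ℝ) / 3) = Real.exp 1 * Real.exp (Real.log A * (1 / 3) - 1) := by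
    rw [Real.rpow_def_of_pos hA, ← Real.exp_add]
    ring_nf
  rw [h2]
  nlinarith [Real.exp_pos 1]

/-- **Edge density of partial shadows.**
With `l = n/2^c + δ` (`−3 ≤ δ < −1`) and `k = l/2 + ε` (`−1/2 ≤ ε ≤ 0`) natural numbers,
`G` an `l`-regular hypergraph on `n` vertices of edge density `θ ∈ (0,1]`,
`n ≥ 3·2^c` and `n ≥ 3·2^{c+1}·(1/2 + (1/ln A)(A^{1/3}/4 − ln θ))` for some `A > 1`,
every partial `(k,1/2)`-shadow of `G` has edge density at least
`θ / (2·√(A·exp(A^{1/3}/2)))`. -/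
theorem partial_shadow_edge_density (n c l k : ℕ) (δ ε A θ θk : ℝ)
    (hδ1 : -3 ≤ δ) (hδ2 : δ < -1) (hε1 : -(1 / 2) ≤ ε) (hε2 : ε ≤ 0)
    (hl : (l : ℝ) = (n : ℝ) / 2 ^ c + δ) (hk : (k : ℝ) = (l : ℝ) / 2 + ε)
    (G : Finset (Finset (Fin n))) (hreg : ∀ e ∈ G, e.card = l)
    (hθ0 : 0 < θ) (hθ1 : θ ≤ 1) (hθ : (G.card : ℝ) = θ * (n.choose l : ℝ))
    (hA : 1 < A) (hn1 : 3 * 2 ^ c ≤ n)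
    (hn2 : 3 * 2 ^ (c + 1) *
        (1 / 2 + 1 / Real.log A * (A ^ ((1 : ℝ) / 3) / 4 - Real.log θ)) ≤ (n : ℝ))
    (H : Finset (Finset (Fin n))) (hH : IsPartialHalfShadow G l k H)
    (hθk : (H.card : ℝ) = θk * (n.choose k : ℝ)) :
    θ / (2 * Real.sqrt (A * Real.exp (A ^ ((1 : ℝ) / 3) / 2))) ≤ θk := by
  have hL : 0 < Real.log A := Real.log_pos hA
  have hR : 1 ≤ A ^ ((1 : ℝ) / 3) := Real.one_le_rpow hA.le (by norm_num)
  have hRL := Real.exp_one_mul_log_le_three_mul_rpow (zero_lt_one.trans hA)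
  set R := A ^ ((1 : ℝ) / 3)
  have hlogθ : Real.log θ ≤ 0 := Real.log_nonpos hθ0.le hθ1
  have hpow : (1 : ℝ) ≤ 2 ^ c := one_le_pow₀ (by norm_num)
  have hx : 6 * (1 / 2 + 1 / Real.log A * (R / 4 - Real.log θ)) ≤ (n : ℝ) / 2 ^ c := by
    rw [le_div_iff₀ (by positivity)]
    refine le_trans (le_of_eq ?_) hn2
    ring
  have hq : R / 4 / Real.log A ≤ 1 / Real.log A * (R / 4 - Real.log θ) := by
    rw [div_mul_eq_mul_div, one_mul]
    gcongr
    linarith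
  have hq' : 1 / 6 < R / 4 / Real.log A := by
    rw [lt_div_iff₀ hL]
    nlinarith [Real.exp_one_gt_d9]
  have hl2 : 2 ≤ l := by
    have : (1 : ℝ) < l := by linarith
    exact_mod_cast this
  have hln : l ≤ n := by
    have : (n : ℝ) / 2 ^ c ≤ n := div_le_self (by positivity) hpow
    have : (l : ℝ) ≤ n := by linarith
    exact_mod_cast this
  have hk0 : 0 < k := by
    have : (2 : ℝ) ≤ l := mod_cast hl2
    have : (0 : ℝ) < k := by linarith
    exact_mod_cast this
  have hkl : k < l := by
    have : (2 : ℝ) ≤ l := mod_cast hl2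
    have : (k : ℝ) < l := by linarith
    exact_mod_cast this
  have hC := Nat.le_choose_of_pos_of_lt hk0 hkl
  have hdens := hH.density_le hkl.le hln hreg hθ hθk
  have hexp : Real.exp (1 / 2) ≤ Real.exp (R / 2) := Real.exp_le_exp.2 (by linarith)
  rw [div_le_iff₀ (by positivity)]
  by_cases h3 : l.choose k = 3
  · have hl3 : (l : ℝ) ≤ 3 := mod_cast h3 ▸ hC
    have hq2 : R / 4 / Real.log A ≤ 1 / 2 := by linarith
    rw [div_le_iff₀ hL] at hq2
    have hA' : Real.exp (1 / 2) ≤ A := (Real.le_log_iff_exp_le (by linarith)).1 (by linarith)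
    have hS : (3 / 2 : ℝ) ≤ Real.sqrt (A * Real.exp (R / 2)) := by
      refine Real.le_sqrt_of_sq_le ?_
      have : Real.exp (1 / 2) * Real.exp (1 / 2) = Real.exp 1 := by
        rw [← Real.exp_add]
        norm_num
      have := mul_le_mul hA' hexp (Real.exp_pos _).le (by linarith)
      linarith [Real.exp_one_gt_d9]
    rw [h3] at hdens
    norm_num at hdens
    nlinarith
  · have hS : (5 / 4 : ℝ) ≤ Real.sqrt (A * Real.exp (R / 2)) := by
      refine Real.le_sqrt_of_sq_le ?_
      have := Real.quadratic_le_exp_of_nonneg (show (0 : ℝ) ≤ 1 / 2 by norm_num)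
      nlinarith
    have hf : (2 * l.choose k : ℝ) ≤ 5 * (l.choose k / 2 : ℕ) := by
      have : 2 * l.choose k ≤ 5 * (l.choose k / 2) := by omega
      exact_mod_cast this
    have hCpos : (0 : ℝ) < l.choose k := mod_cast Nat.choose_pos hkl.le
    have hθk' : 2 / 5 * θ ≤ θk := by
      refine le_of_mul_le_mul_right ?_ hCpos
      nlinarith
    nlinarith
end

section
/- Let n be an odd natural number and let G be an (n−1)/2-regular hypergraph on the vertex set [n] constructed as follows: for every subset X ∈ σ_{(n−1)/2}([n]), either X is an edge of G, or every element of σ_{(n−1)/2}([n]∖X) is an edge of G. Then the edge density θ of G satisfies θ ≥ 1/2, i.e. |E(G)| ≥ (1/2)·C(n,(n−1)/2). -/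
open scoped Classical

/-- **Edge density for a certain construction.**
Let `n` be odd and let `G` be an `(n−1)/2`-regular hypergraph on `[n]` such that for every
subset `X` of cardinality `(n−1)/2`, either `X` is an edge of `G` or every
`(n−1)/2`-element subset of the complement of `X` is an edge of `G`.  Then the edge
density of `G` is at least `1/2`, i.e. `|E(G)| ≥ (1/2)·C(n,(n−1)/2)`. -/
theorem odd_construction_edge_density (n : ℕ) (hn : Odd n)
    (G : Finset (Finset (Fin n)))
    (hreg : ∀ e ∈ G, e.card = (n - 1) / 2)
    (hconstr : ∀ X : Finset (Fin n), X.card = (n - 1) / 2 →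
      X ∈ G ∨ ∀ Y ∈ Finset.powersetCard ((n - 1) / 2) Xᶜ, Y ∈ G) :
    (1 / 2 : ℝ) * (n.choose ((n - 1) / 2) : ℝ) ≤ (G.card : ℝ) := by
  obtain ⟨m, rfl⟩ := hn
  have hm : (2 * m + 1 - 1) / 2 = m := by omega
  simp only [hm] at hreg hconstr ⊢
  have hdeg : ∀ X : Finset (Fin (2 * m + 1)), X.card = m →
      (Finset.powersetCard m Xᶜ).card = m + 1 := by
    intro X hX
    rw [Finset.card_powersetCard, Finset.card_compl, Fintype.card_fin, hX,
      show 2 * m + 1 - m = m + 1 by omega, Nat.choose_succ_self_right]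
  have hsub : G ⊆ Finset.powersetCard m Finset.univ := fun e he =>
    Finset.mem_powersetCard.2 ⟨Finset.subset_univ e, hreg e he⟩
  have hcount : (Finset.powersetCard m Finset.univ \ G).card * (m + 1) ≤ G.card * (m + 1) := by
    refine Finset.card_mul_le_card_mul (fun X Y => Disjoint X Y) ?_ ?_
    · intro X hX
      obtain ⟨hX, hXG⟩ := Finset.mem_sdiff.1 hX
      have hXm := (Finset.mem_powersetCard.1 hX).2
      rw [← hdeg X hXm]
      refine Finset.card_le_card fun Y hY => ?_
      exact Finset.mem_filter.2 ⟨(hconstr X hXm).resolve_left hXG Y hY,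
        (Finset.subset_compl_iff_disjoint_left).1 (Finset.mem_powersetCard.1 hY).1⟩
    · intro Y hY
      rw [← hdeg Y (hreg Y hY)]
      refine Finset.card_le_card fun X hX => ?_
      obtain ⟨hX, hXY⟩ := Finset.mem_filter.1 hX
      exact Finset.mem_powersetCard.2 ⟨Finset.subset_compl_iff_disjoint_right.2 hXY,
        (Finset.mem_powersetCard.1 (Finset.mem_sdiff.1 hX).1).2⟩
  have hle := Nat.le_of_mul_le_mul_right hcount m.succ_pos
  have htotal := Finset.card_sdiff_add_card_eq_card hsub
  rw [Finset.card_powersetCard, Finset.card_univ, Fintype.card_fin] at htotal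
  have hchoose : ((2 * m + 1).choose m : ℝ) ≤ 2 * G.card := by
    exact_mod_cast (by omega : (2 * m + 1).choose m ≤ 2 * G.card)
  linarith
end

section
/- Let n be an odd natural number and let G be an (n−1)/2-regular hypergraph on the vertex set [n] with the property that for every subset X ∈ σ_{(n−1)/2}([n]), either X is an edge of G, or every element of σ_{(n−1)/2}([n]∖X) is an edge of G. Then |E(G)| ≥ C(n−1,(n−1)/2) = ((n+1)/(2n))·C(n,(n−1)/2), and this minimum is attained. -/
open scoped Classical

/-- A family of `m`-subsets of a `(2m+1)`-set which, for every `m`-set `X`, contains `X` or all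
`m`-subsets of its complement, has at least `(2m).choose m` members. -/
theorem choose_le_card_of_mem_or_compl_subset (m : ℕ) (G : Finset (Finset (Fin (2 * m + 1))))
    (hG : ∀ X : Finset (Fin (2 * m + 1)), X.card = m →
      X ∈ G ∨ ∀ Y ∈ Finset.powersetCard m Xᶜ, Y ∈ G) :
    (2 * m).choose m ≤ G.card := by
  set H := Finset.powersetCard m (Finset.univ : Finset (Fin (2 * m + 1))) \ G with hH
  have hint : (H : Set (Finset (Fin (2 * m + 1)))).Intersecting := by
    intro a ha b hb hab
    simp only [hH, Finset.coe_sdiff, Set.mem_sdiff, Finset.mem_coe,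
      Finset.mem_powersetCard_univ] at ha hb
    exact (hG a ha.1).elim ha.2 fun h => hb.2 <| h b <|
      Finset.mem_powersetCard.2 ⟨hab.symm.le_compl_right, hb.1⟩
  have hsized : (H : Set (Finset (Fin (2 * m + 1)))).Sized m := by
    intro a ha
    simp only [hH, Finset.coe_sdiff, Set.mem_sdiff, Finset.mem_coe,
      Finset.mem_powersetCard_univ] at ha
    exact ha.1
  have hcard : (2 * m + 1).choose m ≤ H.card + G.card := by
    have h := Finset.card_le_card_sdiff_add_card (t := G)
      (s := Finset.powersetCard m (Finset.univ : Finset (Fin (2 * m + 1))))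
    rwa [Finset.card_powersetCard, Finset.card_univ, Fintype.card_fin] at h
  cases m with
  | zero =>
    have hempty : (∅ : Finset (Fin (2 * 0 + 1))) ∈ G :=
      (hG ∅ rfl).elim id fun h => h ∅ (by simp)
    simpa [Nat.one_le_iff_ne_zero] using Finset.ne_empty_of_mem hempty
  | succ k =>
    have hekr := Finset.erdos_ko_rado hint hsized (by omega)
    have hpascal := Nat.choose_succ_succ' (2 * (k + 1)) k
    simp only [Nat.add_sub_cancel] at hekr
    omega

/-- The family of `m`-subsets of a `(2m+1)`-set that avoid a fixed point contains every `m`-set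
or all `m`-subsets of its complement, and has `(2m).choose m` members. -/
theorem exists_card_eq_choose_mem_or_compl_subset (m : ℕ) :
    ∃ G : Finset (Finset (Fin (2 * m + 1))),
      (∀ e ∈ G, e.card = m) ∧
      (∀ X : Finset (Fin (2 * m + 1)), X.card = m →
        X ∈ G ∨ ∀ Y ∈ Finset.powersetCard m Xᶜ, Y ∈ G) ∧
      G.card = (2 * m).choose m := by
  refine ⟨Finset.powersetCard m {0}ᶜ, fun e he => (Finset.mem_powersetCard.1 he).2,
    fun X hX => ?_, by simp [Finset.card_compl]⟩
  by_cases h0 : (0 : Fin (2 * m + 1)) ∈ X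
  · refine Or.inr fun Y hY => ?_
    rw [Finset.mem_powersetCard] at hY ⊢
    exact ⟨hY.1.trans (Finset.compl_subset_compl.2 (Finset.singleton_subset_iff.2 h0)), hY.2⟩
  · exact Or.inl <| Finset.mem_powersetCard.2
      ⟨by simpa [Finset.subset_compl_comm] using h0, hX⟩

theorem choose_half_eq_div_mul_choose (m : ℕ) :
    ((2 * m).choose m : ℝ) =
      (((2 * m + 1 : ℕ) : ℝ) + 1) / (2 * (2 * m + 1 : ℕ)) * ((2 * m + 1).choose m : ℝ) := by
  have h := Nat.add_one_mul_choose_eq (2 * m) m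
  rw [Nat.choose_symm_half] at h
  have h' : (2 * (m : ℝ) + 1) * (2 * m).choose m = (2 * m + 1).choose m * (m + 1) := by
    exact_mod_cast h
  have : 2 * (m : ℝ) + 1 ≠ 0 := by positivity
  push_cast
  field_simp
  linear_combination 2 * h'

/-- **Edge density for a certain construction, sharp form.**
Let `n` be odd and let `G` be an `(n−1)/2`-regular hypergraph on `[n]` such that for every
subset `X` of cardinality `(n−1)/2`, either `X` is an edge of `G` or every
`(n−1)/2`-element subset of the complement of `X` is an edge of `G`.  Then
`|E(G)| ≥ C(n−1,(n−1)/2) = ((n+1)/(2n))·C(n,(n−1)/2)`, and this minimum is attained. -/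
theorem odd_construction_minimal_edges (n : ℕ) (hn : Odd n)
    (G : Finset (Finset (Fin n)))
    (hreg : ∀ e ∈ G, e.card = (n - 1) / 2)
    (hconstr : ∀ X : Finset (Fin n), X.card = (n - 1) / 2 →
      X ∈ G ∨ ∀ Y ∈ Finset.powersetCard ((n - 1) / 2) Xᶜ, Y ∈ G) :
    (n - 1).choose ((n - 1) / 2) ≤ G.card ∧
    (((n - 1).choose ((n - 1) / 2) : ℝ) =
      ((n : ℝ) + 1) / (2 * n) * (n.choose ((n - 1) / 2) : ℝ)) ∧
    ∃ G₀ : Finset (Finset (Fin n)),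
      (∀ e ∈ G₀, e.card = (n - 1) / 2) ∧
      (∀ X : Finset (Fin n), X.card = (n - 1) / 2 →
        X ∈ G₀ ∨ ∀ Y ∈ Finset.powersetCard ((n - 1) / 2) Xᶜ, Y ∈ G₀) ∧
      G₀.card = (n - 1).choose ((n - 1) / 2) := by
  obtain ⟨m, rfl⟩ := hn
  have hm : 2 * m / 2 = m := by omega
  simp only [Nat.add_sub_cancel, hm] at hconstr ⊢
  exact ⟨choose_le_card_of_mem_or_compl_subset m G hconstr, choose_half_eq_div_mul_choose m,
    exists_card_eq_choose_mem_or_compl_subset m⟩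
end

section
/- Let |ψ⟩ ∈ (ℂ²)^{⊗n} be a nonzero state, let x ∈ [n], and let S₁, S₂ ⊆ [n]∖{x} be disjoint subsets with S₁ ⊔ S₂ = [n]∖{x}. Then at least one of the following holds: (1) the subspace supp(Tr_{S₂}(|ψ⟩⟨ψ|)) ⊆ ℂ² ⊗ (ℂ²)^{⊗|S₁|} (reduced to the qubits {x} ⊔ S₁) contains a nonzero vector of the form |φ_x⟩⊗|φ_{S₁}⟩; (2) the subspace supp(Tr_{S₁}(|ψ⟩⟨ψ|)) ⊆ ℂ² ⊗ (ℂ²)^{⊗|S₂|} (reduced to the qubits {x} ⊔ S₂) contains a nonzero vector of the form |φ_x⟩⊗|φ_{S₂}⟩. -/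
open scoped Classical

namespace QkSAT

/-- Combine a bit string on the qubits in `C` with a bit string on the qubits outside `C`
into a bit string on all `n` qubits. -/
def merge {n : ℕ} (C : Finset (Fin n)) (f : ↥C → Fin 2) (g : ↥Cᶜ → Fin 2) : Fin n → Fin 2 :=
  fun i => if h : i ∈ C then f ⟨i, h⟩ else g ⟨i, Finset.mem_compl.mpr h⟩

/-- The support of the reduced density matrix of `ψ` on the qubits in `C` (tracing out the
qubits outside `C`): the span of the contractions of `ψ` against the basis vectors on the
qubits outside `C`, i.e. `span{(⟨v|⊗1_C)|ψ⟩ : v}`. -/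
noncomputable def reducedSupp {n : ℕ} (C : Finset (Fin n)) (ψ : (Fin n → Fin 2) → ℂ) :
    Submodule ℂ (QVec n C) :=
  Submodule.span ℂ {w | ∃ g : ↥Cᶜ → Fin 2, w = fun f => ψ (merge C f g)}

/-- The subspace `W` of the Hilbert space of the qubits in `C` contains a nonzero product
vector `|φ₁⟩⊗…⊗|φ_c⟩`. -/
def ContainsProdVec {n : ℕ} (C : Finset (Fin n)) (W : Submodule ℂ (QVec n C)) : Prop :=
  ∃ φ : ↥C → (Fin 2 → ℂ), (∀ i, φ i ≠ 0) ∧ prodVec φ ∈ W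


/-- For two matrices that do not both vanish, either some vector is mapped to proportional images
by `A` and `B`, with nonzero image under `B`, or some left null vector of `B` is not a left null
vector of `A`. -/
theorem exists_mulVec_eq_smul_or_exists_vecMul_eq_zero {K l m : Type*} [Field K] [IsAlgClosed K]
    [Fintype l] [Fintype m] [DecidableEq l] (A B : Matrix l m K) (h : A ≠ 0 ∨ B ≠ 0) :
    (∃ (u : m → K) (μ : K), B.mulVec u ≠ 0 ∧ A.mulVec u = μ • B.mulVec u) ∨
      ∃ c : l → K, Matrix.vecMul c B = 0 ∧ Matrix.vecMul c A ≠ 0 := by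
  by_cases hAB : LinearMap.range A.mulVecLin ≤ LinearMap.range B.mulVecLin
  · left
    have hB : B ≠ 0 := by
      rintro rfl
      refine h.elim (fun hA => hA ?_) (fun h0 => h0 rfl)
      apply Matrix.mulVec_injective
      funext u
      simpa using hAB ⟨u, rfl⟩
    obtain ⟨g, hg⟩ := B.mulVecLin.rangeRestrict.exists_rightInverse_of_surjective
      (LinearMap.range_rangeRestrict _)
    have : Nontrivial (LinearMap.range B.mulVecLin) := by
      rw [Submodule.nontrivial_iff_ne_bot, Ne, LinearMap.range_eq_bot]
      intro h0
      exact hB (Matrix.mulVec_injective (funext fun u => by simpa using LinearMap.congr_fun h0 u))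
    obtain ⟨μ, hμ⟩ := Module.End.exists_eigenvalue
      ((A.mulVecLin.comp g).codRestrict (LinearMap.range B.mulVecLin) fun r => hAB ⟨g r, rfl⟩)
    obtain ⟨r, hr⟩ := hμ.exists_hasEigenvector
    have hgr : B.mulVec (g r) = r := congrArg Subtype.val (LinearMap.congr_fun hg r)
    refine ⟨g r, μ, ?_, ?_⟩
    · rw [hgr]
      exact fun h0 => hr.2 (Subtype.ext h0)
    · rw [hgr]
      exact congrArg Subtype.val hr.apply_eq_smul
  · right
    obtain ⟨_, ⟨u, rfl⟩, hu⟩ := SetLike.not_le_iff_exists.mp hAB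
    obtain ⟨f, hfu, hf⟩ := Submodule.exists_le_ker_of_notMem hu
    obtain ⟨c, rfl⟩ := (dotProductEquiv K l).surjective f
    refine ⟨c, ?_, fun h0 => hfu ?_⟩
    · refine dotProduct_eq_zero _ fun w => ?_
      rw [← Matrix.dotProduct_mulVec]
      exact hf ⟨w, rfl⟩
    · simp [Matrix.dotProduct_mulVec, h0]

/-- Combine a bit `k` and bit strings on `S` and `T` into a bit string on all qubits, where the
bit `k` is placed on every qubit outside `S ∪ T`. -/
def joinBits {n : ℕ} (S T : Finset (Fin n)) (k : Fin 2) (a : ↥S → Fin 2) (b : ↥T → Fin 2) :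
    Fin n → Fin 2 :=
  fun i => if h : i ∈ S then a ⟨i, h⟩ else if h : i ∈ T then b ⟨i, h⟩ else k

theorem joinBits_swap {n : ℕ} {S T : Finset (Fin n)} (hST : Disjoint S T) (k : Fin 2)
    (a : ↥S → Fin 2) (b : ↥T → Fin 2) : joinBits S T k a b = joinBits T S k b a := by
  funext i
  have := fun hS : i ∈ S => Finset.disjoint_left.mp hST hS
  unfold joinBits
  split_ifs <;> first | rfl | tauto

theorem joinBits_restrict {n : ℕ} {S T : Finset (Fin n)} {x : Fin n} (hST : S ∪ T = {x}ᶜ)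
    (f : Fin n → Fin 2) : joinBits S T (f x) (fun i => f i) (fun i => f i) = f := by
  funext i
  have : i ∈ S ∪ T ↔ i ≠ x := by simp [hST]
  rw [Finset.mem_union] at this
  unfold joinBits
  split_ifs
  · rfl
  · rfl
  · rw [show i = x by tauto]

/-- Contracting `ψ` against a vector on the qubits in `T` gives an element of the support of the
reduced density matrix on the remaining qubits. -/
theorem contract_mem_reducedSupp {n : ℕ} (ψ : (Fin n → Fin 2) → ℂ) {S T : Finset (Fin n)}
    {x : Fin n} (hdisj : Disjoint S T) (hST : S ∪ T = {x}ᶜ) (u : QVec n T) :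
    (fun f : ↥(insert x S) → Fin 2 =>
      ∑ b, ψ (joinBits S T (f ⟨x, Finset.mem_insert_self x S⟩)
        (fun i => f ⟨i.1, Finset.mem_insert_of_mem i.2⟩) b) * u b) ∈
      reducedSupp (insert x S) ψ := by
  have hmem : ∀ i, i ∈ S ∨ i ∈ T ↔ i ≠ x := fun i => by
    rw [← Finset.mem_union, hST, Finset.mem_compl, Finset.mem_singleton]
  have hT : ∀ i, i ∈ (insert x S)ᶜ → i ∈ T := fun i hi => by
    rw [Finset.mem_compl, Finset.mem_insert] at hi
    have := hmem i
    tauto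
  have key : (fun f : ↥(insert x S) → Fin 2 =>
      ∑ b, ψ (joinBits S T (f ⟨x, Finset.mem_insert_self x S⟩)
        (fun i => f ⟨i.1, Finset.mem_insert_of_mem i.2⟩) b) * u b) =
      ∑ b, u b • fun f : ↥(insert x S) → Fin 2 =>
        ψ (merge (insert x S) f fun i => b ⟨i.1, hT i.1 i.2⟩) := by
    funext f
    rw [Finset.sum_apply]
    refine Finset.sum_congr rfl fun b _ => ?_
    rw [Pi.smul_apply, smul_eq_mul, mul_comm]
    congr 2
    funext i
    have hi := hmem i
    have hd := fun hS : i ∈ S => Finset.disjoint_left.mp hdisj hS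
    unfold joinBits merge
    by_cases hS : i ∈ S
    · simp [hS]
    · by_cases hix : i = x
      · subst hix
        have : i ∉ T := by tauto
        simp [hS, this]
      · have : i ∈ T := by tauto
        simp [hS, this, hix]
  rw [key]
  exact Submodule.sum_mem _ fun b _ =>
    Submodule.smul_mem _ _ (Submodule.subset_span ⟨_, rfl⟩)

/-- **Lemma (product-state dichotomy).**
Let `|ψ⟩ ∈ (ℂ²)^{⊗n}` be a nonzero state, `x ∈ [n]`, and let `S₁, S₂` be disjoint subsets
with `S₁ ⊔ S₂ = [n]∖{x}`.  Then the support of the reduced density matrix of `|ψ⟩` on the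
qubits `{x} ⊔ S₁` (tracing out `S₂`) contains a nonzero vector of the form
`|φ_x⟩⊗|φ_{S₁}⟩`, or the support of the reduced density matrix on `{x} ⊔ S₂` (tracing out
`S₁`) contains a nonzero vector of the form `|φ_x⟩⊗|φ_{S₂}⟩`. -/
theorem supp_contains_product_dichotomy (n : ℕ) (ψ : (Fin n → Fin 2) → ℂ) (hψ : ψ ≠ 0)
    (x : Fin n) (S₁ S₂ : Finset (Fin n)) (hdisj : Disjoint S₁ S₂)
    (hunion : S₁ ∪ S₂ = ({x} : Finset (Fin n))ᶜ) :
    (∃ (v : Fin 2 → ℂ) (w : QVec n S₁), v ≠ 0 ∧ w ≠ 0 ∧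
      (fun f : ↥(insert x S₁) → Fin 2 =>
          v (f ⟨x, Finset.mem_insert_self x S₁⟩) *
            w (fun i => f ⟨i.1, Finset.mem_insert_of_mem i.2⟩)) ∈
        reducedSupp (insert x S₁) ψ) ∨
    (∃ (v : Fin 2 → ℂ) (w : QVec n S₂), v ≠ 0 ∧ w ≠ 0 ∧
      (fun f : ↥(insert x S₂) → Fin 2 =>
          v (f ⟨x, Finset.mem_insert_self x S₂⟩) *
            w (fun i => f ⟨i.1, Finset.mem_insert_of_mem i.2⟩)) ∈
        reducedSupp (insert x S₂) ψ) := by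
  have hne : (Matrix.of fun a b => ψ (joinBits S₁ S₂ 0 a b)) ≠ 0 ∨
      (Matrix.of fun a b => ψ (joinBits S₁ S₂ 1 a b)) ≠ 0 := by
    by_contra! h0
    refine hψ (funext fun f => ?_)
    rw [← joinBits_restrict hunion f]
    generalize f x = k
    fin_cases k
    · exact congrFun (congrFun h0.1 _) _
    · exact congrFun (congrFun h0.2 _) _
  rcases exists_mulVec_eq_smul_or_exists_vecMul_eq_zero _ _ hne with
    ⟨u, μ, hB, hA⟩ | ⟨c, hB, hA⟩
  · left
    refine ⟨![μ, 1], _, fun h0 => one_ne_zero (congrFun h0 1), hB, ?_⟩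
    convert contract_mem_reducedSupp ψ hdisj hunion u using 2 with f
    generalize f ⟨x, Finset.mem_insert_self x S₁⟩ = k
    fin_cases k
    · exact (congrFun hA _).symm
    · exact one_mul _
  · right
    refine ⟨![1, 0], _, fun h0 => one_ne_zero (congrFun h0 0), hA, ?_⟩
    convert contract_mem_reducedSupp ψ hdisj.symm (Finset.union_comm S₂ S₁ ▸ hunion) c using 2
      with f
    simp only [joinBits_swap hdisj.symm, mul_comm _ (c _)]
    generalize f ⟨x, Finset.mem_insert_self x S₂⟩ = k
    fin_cases k
    · exact one_mul _
    · exact (zero_mul _).trans (congrFun hB _).symm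

end QkSAT
end

section
/- Let m ≥ 1 and let L ⊆ (ℂ²)^{⊗m} be a linear subspace. Define X := { x ∈ ℙ(ℂ²) : there exist nonzero |φ₁⟩,…,|φ_m⟩ ∈ ℂ² with |φ₁⟩⊗…⊗|φ_m⟩ ∈ L and x = [|φ₁⟩] }. Then either X = ℙ(ℂ²) (X is the whole projective line), or X is finite with cardinality |X| ≤ m!. -/
/-- The product vector `⊗ᵢ φᵢ ∈ (ℂ²)^{⊗m}`, in coordinates over bit strings. -/
def prodVec {m : ℕ} (φ : Fin m → (Fin 2 → ℂ)) : (Fin m → Fin 2) → ℂ :=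
  fun f => ∏ i, φ i (f i)

section Pencil

variable {K M : Type*} [Field K] [AddCommGroup M] [Module K M]

/-- The shift of coefficient sequences, i.e. multiplication by the variable. -/
def coeffShift (K M : Type*) [Field K] [AddCommGroup M] [Module K M] :
    (ℕ → M) →ₗ[K] (ℕ → M) where
  toFun q n := n.casesOn 0 q
  map_add' q r := by ext n; cases n <;> simp
  map_smul' c q := by ext n; cases n <;> simp

@[simp] lemma coeffShift_zero (q : ℕ → M) : coeffShift K M q 0 = 0 := rfl

@[simp] lemma coeffShift_succ (q : ℕ → M) (n : ℕ) : coeffShift K M q (n + 1) = q n := rfl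

/-- Binary forms of degree `b - 1` with coefficients in `P`, as coefficient sequences
supported on `{0, …, b - 1}`. -/
def coeffSeq (P : Submodule K M) (b : ℕ) : Submodule K (ℕ → M) where
  carrier := {q | ∀ n, q n ∈ P ∧ (b ≤ n → q n = 0)}
  zero_mem' n := by simp
  add_mem' {q r} hq hr n :=
    ⟨P.add_mem (hq n).1 (hr n).1, fun h => by simp [(hq n).2 h, (hr n).2 h]⟩
  smul_mem' c q hq n := ⟨P.smul_mem c (hq n).1, fun h => by simp [(hq n).2 h]⟩

lemma coeffSeq_mono {P : Submodule K M} {b c : ℕ} (h : b ≤ c) : coeffSeq P b ≤ coeffSeq P c :=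
  fun _ hq n => ⟨(hq n).1, fun hn => (hq n).2 (h.trans hn)⟩

lemma coeffShift_mem {P : Submodule K M} {b : ℕ} {q : ℕ → M} (hq : q ∈ coeffSeq P b) :
    coeffShift K M q ∈ coeffSeq P (b + 1) := by
  rintro (_ | n)
  · simp
  · exact ⟨(hq n).1, fun h => (hq n).2 (by omega)⟩

lemma single_mem_coeffSeq {P : Submodule K M} {b n : ℕ} (hn : n < b) {m : M} (hm : m ∈ P) :
    Pi.single n m ∈ coeffSeq P b := by
  intro i
  by_cases h : i = n
  · subst h
    simpa using ⟨hm, fun h => by omega⟩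
  · simp [h]

/-- Restriction of coefficient sequences to the first `b` coefficients. -/
def coeffSeqRestrict (P : Submodule K M) (b : ℕ) : coeffSeq P b →ₗ[K] (Fin b → P) where
  toFun q i := ⟨q.1 i, (q.2 i).1⟩
  map_add' _ _ := rfl
  map_smul' _ _ := rfl

lemma coeffSeqRestrict_injective (P : Submodule K M) (b : ℕ) :
    Function.Injective (coeffSeqRestrict P b) := by
  intro q r h
  ext n
  by_cases hn : n < b
  · exact congrArg Subtype.val (congrFun h ⟨n, hn⟩)
  · rw [(q.2 n).2 (by omega), (r.2 n).2 (by omega)]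

instance (P : Submodule K M) [Module.Finite K P] (b : ℕ) : Module.Finite K (coeffSeq P b) :=
  Module.Finite.of_injective _ (coeffSeqRestrict_injective P b)

lemma finrank_coeffSeq_le (P : Submodule K M) [Module.Finite K P] (b : ℕ) :
    Module.finrank K (coeffSeq P b) ≤ b * Module.finrank K P := by
  simpa [Module.finrank_pi_fintype] using
    LinearMap.finrank_le_finrank_of_injective (coeffSeqRestrict_injective P b)

/-- Evaluation at `y` of the binary form of degree `b - 1` with given coefficients. -/
def formEval (y : Fin 2 → K) : ℕ → (ℕ → M) →ₗ[K] M
  | 0 => 0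
  | b + 1 => y 0 • formEval y b + y 1 ^ b • LinearMap.proj b

lemma formEval_succ (y : Fin 2 → K) (b : ℕ) (q : ℕ → M) :
    formEval y (b + 1) q = y 0 • formEval y b q + y 1 ^ b • q b := rfl

@[simp] lemma formEval_zero (y : Fin 2 → K) (q : ℕ → M) : formEval y 0 q = 0 := rfl

lemma formEval_succ_coeffShift (y : Fin 2 → K) (b : ℕ) (q : ℕ → M) :
    formEval y (b + 1) (coeffShift K M q) = y 1 • formEval y b q := by
  induction b with
  | zero => simp [formEval_succ]
  | succ b ih =>
    rw [formEval_succ, ih, formEval_succ y b q, coeffShift_succ]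
    module

lemma formEval_mem {P : Submodule K M} {b : ℕ} (y : Fin 2 → K) {q : ℕ → M}
    (hq : ∀ n, q n ∈ P) : formEval y b q ∈ P := by
  induction b with
  | zero => simp
  | succ b ih =>
    rw [formEval_succ]
    exact P.add_mem (P.smul_mem _ ih) (P.smul_mem _ (hq b))

lemma formEval_comp (y : Fin 2 → K) (b : ℕ) (f : M →ₗ[K] M) (q : ℕ → M) :
    formEval y b (fun n => f (q n)) = f (formEval y b q) := by
  induction b with
  | zero => simp
  | succ b ih => simp [formEval_succ, ih]

lemma exists_ne_zero_of_fin_two {y : Fin 2 → K} (hy : y ≠ 0) : y 0 ≠ 0 ∨ y 1 ≠ 0 := by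
  by_contra! h
  exact hy (by ext i; fin_cases i <;> simp [h])

lemma exists_formEval_eq {P : Submodule K M} {y : Fin 2 → K} (hy : y ≠ 0) (b : ℕ) {m : M}
    (hm : m ∈ P) : ∃ q ∈ coeffSeq P (b + 1), formEval y (b + 1) q = m := by
  by_cases h0 : y 0 = 0
  · have h1 : y 1 ≠ 0 := by simpa [h0] using exists_ne_zero_of_fin_two hy
    refine ⟨Pi.single b ((y 1 ^ b)⁻¹ • m), single_mem_coeffSeq (by omega) (P.smul_mem _ hm), ?_⟩
    simp [formEval_succ, h0, h1]
  · refine ⟨Pi.single 0 ((y 0 ^ b)⁻¹ • m), single_mem_coeffSeq (by omega) (P.smul_mem _ hm), ?_⟩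
    have key : ∀ (c : ℕ) (w : M), formEval y (c + 1) (Pi.single 0 w) = y 0 ^ c • w := by
      intro c w
      induction c with
      | zero => simp [formEval_succ]
      | succ c ih =>
        rw [formEval_succ, ih, Pi.single_eq_of_ne (by omega), smul_smul, smul_zero, add_zero,
          ← pow_succ']
    rw [key, smul_smul, mul_inv_cancel₀ (pow_ne_zero _ h0), one_smul]

/-- Multiplication by the linear form vanishing at `y`. -/
def mulLine (M : Type*) [AddCommGroup M] [Module K M] (y : Fin 2 → K) :
    (ℕ → M) →ₗ[K] (ℕ → M) :=
  y 0 • coeffShift K M - y 1 • LinearMap.id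

lemma mulLine_apply (y : Fin 2 → K) (q : ℕ → M) (n : ℕ) :
    mulLine M y q n = y 0 • coeffShift K M q n - y 1 • q n := rfl

lemma mulLine_mem {P : Submodule K M} {b : ℕ} (y : Fin 2 → K) {q : ℕ → M}
    (hq : q ∈ coeffSeq P b) : mulLine M y q ∈ coeffSeq P (b + 1) :=
  Submodule.sub_mem _ (Submodule.smul_mem _ _ (coeffShift_mem hq))
    (Submodule.smul_mem _ _ (coeffSeq_mono (Nat.le_succ b) hq))

lemma formEval_mulLine {P : Submodule K M} {b : ℕ} (y : Fin 2 → K) {q : ℕ → M}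
    (hq : q ∈ coeffSeq P b) : formEval y (b + 1) (mulLine M y q) = 0 := by
  rw [mulLine, LinearMap.sub_apply, LinearMap.smul_apply, LinearMap.smul_apply, map_sub, map_smul,
    map_smul, formEval_succ_coeffShift, LinearMap.id_apply, formEval_succ, (hq b).2 le_rfl]
  module

lemma mulLine_injective {y : Fin 2 → K} (hy : y ≠ 0) : Function.Injective (mulLine M y) := by
  rw [injective_iff_map_eq_zero]
  intro q hq
  have h n : y 0 • coeffShift K M q n = y 1 • q n := by
    simpa [mulLine_apply, sub_eq_zero] using congrFun hq n
  by_cases h1 : y 1 = 0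
  · have h0 : y 0 ≠ 0 := by simpa [h1] using exists_ne_zero_of_fin_two hy
    ext n
    simpa [h1, h0] using h (n + 1)
  · ext n
    induction n with
    | zero => simpa [h1] using (h 0).symm
    | succ n ih => simpa [h1, ih] using (h (n + 1)).symm

lemma exists_mulLine_eq {P : Submodule K M} {y : Fin 2 → K} (hy : y ≠ 0) {b : ℕ} {q : ℕ → M}
    (hq : q ∈ coeffSeq P (b + 1)) (h : formEval y (b + 1) q = 0) :
    ∃ r ∈ coeffSeq P b, mulLine M y r = q := by
  by_cases h0 : y 0 = 0
  · have h1 : y 1 ≠ 0 := by simpa [h0] using exists_ne_zero_of_fin_two hy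
    have hb : q b = 0 := by simpa [formEval_succ, h0, h1] using h
    refine ⟨-(y 1)⁻¹ • q, Submodule.smul_mem _ _ fun n => ⟨(hq n).1, fun hn => ?_⟩, ?_⟩
    · rcases hn.eq_or_lt with rfl | hn
      exacts [hb, (hq n).2 hn]
    · ext n
      simp [mulLine_apply, h0, h1]
  · induction b generalizing q with
    | zero =>
      refine ⟨0, Submodule.zero_mem _, ?_⟩
      ext n
      rcases n with _ | n
      · simpa [formEval_succ] using h.symm
      · simpa using ((hq (n + 1)).2 (by omega)).symm
    | succ b ih =>
      set s : ℕ → M := Pi.single b ((y 0)⁻¹ • q (b + 1)) with hs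
      have hsm : s ∈ coeffSeq P (b + 1) :=
        single_mem_coeffSeq (by omega) (P.smul_mem _ (hq _).1)
      have hq' : q - mulLine M y s ∈ coeffSeq P (b + 1) := by
        have hmem := Submodule.sub_mem _ hq (mulLine_mem y hsm)
        refine fun n => ⟨(hmem n).1, fun hn => ?_⟩
        rcases hn.eq_or_lt with rfl | hn
        · simp [mulLine_apply, hs, h0]
        · exact (hmem n).2 hn
      have hev : formEval y (b + 1) (q - mulLine M y s) = 0 := by
        have h2 : formEval y (b + 1 + 1) (q - mulLine M y s) = 0 := by
          rw [map_sub, h, formEval_mulLine y hsm, sub_zero]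
        rw [formEval_succ, (hq' (b + 1)).2 le_rfl] at h2
        simpa [h0] using h2
      obtain ⟨r, hr, hrq⟩ := ih hq' hev
      exact ⟨r + s, Submodule.add_mem _ (coeffSeq_mono (Nat.le_succ b) hr) hsm, by
        rw [map_add, hrq, sub_add_cancel]⟩

/-- A linear family `g` of endomorphisms, parametrized by `K²`, acts on binary forms with
coefficients in `M` by the matrix of linear forms `y ↦ g y`. -/
def pencil (K M : Type*) [Field K] [AddCommGroup M] [Module K M] :
    ((Fin 2 → K) →ₗ[K] Module.End K M) →ₗ[K] Module.End K (ℕ → M) where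
  toFun g :=
    { toFun q n := g (Pi.single 0 1) (q n) + g (Pi.single 1 1) (coeffShift K M q n)
      map_add' q r := by ext n; simp; abel
      map_smul' c q := by ext n; simp }
  map_add' g h := by ext q n; simp; abel
  map_smul' c g := by ext q n; simp

lemma pencil_apply (g : (Fin 2 → K) →ₗ[K] Module.End K M) (q : ℕ → M) (n : ℕ) :
    pencil K M g q n = g (Pi.single 0 1) (q n) + g (Pi.single 1 1) (coeffShift K M q n) := rfl

lemma coeffShift_pencil (g : (Fin 2 → K) →ₗ[K] Module.End K M) (q : ℕ → M) :
    coeffShift K M (pencil K M g q) = pencil K M g (coeffShift K M q) := by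
  ext n
  rcases n with _ | n <;> simp [pencil_apply]

lemma mulLine_pencil (g : (Fin 2 → K) →ₗ[K] Module.End K M) (y : Fin 2 → K) (q : ℕ → M) :
    mulLine M y (pencil K M g q) = pencil K M g (mulLine M y q) := by
  simp [mulLine, coeffShift_pencil]

lemma pencil_mem {P P' : Submodule K M} (g : (Fin 2 → K) →ₗ[K] Module.End K M)
    (hg : ∀ v, ∀ m ∈ P, g v m ∈ P') {b : ℕ} {q : ℕ → M} (hq : q ∈ coeffSeq P b) :
    pencil K M g q ∈ coeffSeq P' (b + 1) := fun n => by
  refine ⟨P'.add_mem (hg _ _ (hq n).1) (hg _ _ (coeffShift_mem hq n).1), fun hn => ?_⟩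
  rw [pencil_apply, (hq n).2 (by omega), (coeffShift_mem hq n).2 hn]
  simp

lemma formEval_pencil {P : Submodule K M} (g : (Fin 2 → K) →ₗ[K] Module.End K M) (y : Fin 2 → K)
    {b : ℕ} {q : ℕ → M} (hq : q ∈ coeffSeq P b) :
    formEval y (b + 1) (pencil K M g q) = g y (formEval y b q) := by
  have hgy : g y = y 0 • g (Pi.single 0 1) + y 1 • g (Pi.single 1 1) := by
    rw [← map_smul, ← map_smul, ← map_add]
    congr 1
    ext i; fin_cases i <;> simp
  have hsplit : pencil K M g q =
      (fun n => g (Pi.single 0 1) (q n)) + fun n => g (Pi.single 1 1) (coeffShift K M q n) := rfl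
  rw [hsplit, map_add, formEval_comp, formEval_comp, formEval_succ_coeffShift, formEval_succ,
    (hq b).2 le_rfl, hgy]
  simp

lemma pencil_anticomm (g h : (Fin 2 → K) →ₗ[K] Module.End K M)
    (hgh : ∀ v w m, g v (h w m) = -h w (g v m)) (q : ℕ → M) :
    pencil K M g (pencil K M h q) = -pencil K M h (pencil K M g q) := by
  ext n
  rcases n with _ | n
  · simp [pencil_apply, hgh]
  · simp [pencil_apply, hgh]
    abel

end Pencil

section Exactness

variable {K M : Type*} [Field K] [AddCommGroup M] [Module K M]

/-- If the identity `Z / B → M / B'` is injective and its image contains that of the map induced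
by `f`, then `f` induces an endomorphism of `Z / B`. If this has no eigenvectors, `Z / B = 0`. -/
lemma le_of_no_eigenvector [IsAlgClosed K] (Z B B' : Submodule K M) [Module.Finite K Z]
    (f : M →ₗ[K] M) (hfB : ∀ z ∈ B, f z ∈ B')
    (hsurj : ∀ z ∈ Z, ∃ z' ∈ Z, f z - z' ∈ B')
    (hinj : ∀ z ∈ Z, z ∈ B' → z ∈ B)
    (hinj' : ∀ z ∈ Z, ∀ c : K, f z - c • z ∈ B' → z ∈ B)
    (hBB' : B ≤ B') : Z ≤ B := by
  set A := Z.map B'.mkQ with hA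
  let π : Z →ₗ[K] A := B'.mkQ.submoduleMap Z
  have hπ : Function.Surjective π := B'.mkQ.submoduleMap_surjective Z
  let T : Z →ₗ[K] A := (B'.mkQ ∘ₗ f ∘ₗ Z.subtype).codRestrict A fun z => by
    obtain ⟨z', hz', h⟩ := hsurj z z.2
    exact ⟨z', hz', ((Submodule.Quotient.eq B').2 h).symm⟩
  have hπ0 (z : Z) : π z = 0 ↔ (z : M) ∈ B' := by
    rw [Subtype.ext_iff]
    exact Submodule.Quotient.mk_eq_zero B'
  have hker : LinearMap.ker π ≤ LinearMap.ker T := fun z hz => by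
    rw [LinearMap.mem_ker, Subtype.ext_iff]
    exact (Submodule.Quotient.mk_eq_zero B').2
      (hfB _ (hinj z z.2 ((hπ0 z).1 hz)))
  let S : Module.End K A :=
    (LinearMap.ker π).liftQ T hker ∘ₗ (π.quotKerEquivOfSurjective hπ).symm.toLinearMap
  have hS (z : Z) : S (π z) = T z := by
    simp only [S, LinearMap.comp_apply, LinearEquiv.coe_coe]
    rw [LinearMap.quotKerEquivOfSurjective_symm_apply]
    rfl
  have hfin : Module.Finite K A := Module.Finite.of_surjective π hπ
  rcases subsingleton_or_nontrivial A with hs | hs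
  · exact fun z hz => hinj z hz ((hπ0 ⟨z, hz⟩).1 (Subsingleton.elim _ _))
  · obtain ⟨c, hc⟩ := Module.End.exists_eigenvalue S
    obtain ⟨a, ha⟩ := hc.exists_hasEigenvector
    obtain ⟨z, rfl⟩ := hπ a
    have h1 : T z = c • π z := by rw [← hS]; exact ha.apply_eq_smul
    have h2 : f z - c • (z : M) ∈ B' :=
      (Submodule.Quotient.eq B').1 (congrArg Subtype.val h1)
    exact absurd ((hπ0 z).2 (hBB' (hinj' z z.2 c h2))) ha.2

/-- Exactness of the linear map `d` at the middle term of `P₁ → P → ·`. -/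
def ExactBetween (P₁ P : Submodule K M) (d : Module.End K M) : Prop :=
  ∀ z ∈ P, d z = 0 → ∃ u ∈ P₁, d u = z

variable {P₀ P₁ P₂ : Submodule K M} {g : (Fin 2 → K) →ₗ[K] Module.End K M}

lemma exists_pencil_sub_mulLine (hg : ∀ v, ∀ m ∈ P₁, g v m ∈ P₀) {y : Fin 2 → K} (hy : y ≠ 0)
    (hsq : ∀ q, pencil K M g (pencil K M g q) = 0)
    (hex : ExactBetween P₁ P₀ (g y)) {b : ℕ} {z : ℕ → M} (hz : z ∈ coeffSeq P₀ (b + 2))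
    (hgz : pencil K M g z = 0) :
    ∃ u ∈ coeffSeq P₁ (b + 1), ∃ z' ∈ coeffSeq P₀ (b + 1),
      pencil K M g z' = 0 ∧ mulLine M y z' = z - pencil K M g u := by
  obtain ⟨w, hw, hwz⟩ := hex (formEval y (b + 2) z) (formEval_mem y fun n => (hz n).1) (by
    rw [← formEval_pencil g y hz, hgz, map_zero])
  obtain ⟨u, hu, rfl⟩ := exists_formEval_eq hy b hw
  obtain ⟨z', hz', h⟩ := exists_mulLine_eq hy (Submodule.sub_mem _ hz (pencil_mem g hg hu)) (by
    rw [map_sub, formEval_pencil g y hu, hwz, sub_self])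
  refine ⟨u, hu, z', hz', mulLine_injective hy ?_, h⟩
  rw [mulLine_pencil, h, map_sub, hgz, hsq, sub_zero, map_zero]

lemma mem_map_pencil_of_mulLine_mem (hg : ∀ v, ∀ m ∈ P₂, g v m ∈ P₁)
    {y : Fin 2 → K} (hy : y ≠ 0)
    (hsq : ∀ q, pencil K M g (pencil K M g q) = 0)
    (hex : ExactBetween P₂ P₁ (g y)) {b : ℕ} {z : ℕ → M} (hz : z ∈ coeffSeq P₀ (b + 2))
    (h : mulLine M y z ∈ (coeffSeq P₁ (b + 2)).map (pencil K M g)) :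
    z ∈ (coeffSeq P₁ (b + 1)).map (pencil K M g) := by
  obtain ⟨u, hu, huz⟩ := h
  obtain ⟨w, hw, hwz⟩ := hex (formEval y (b + 2) u) (formEval_mem y fun n => (hu n).1) (by
    rw [← formEval_pencil g y hu, huz, formEval_mulLine y hz])
  obtain ⟨v, hv, rfl⟩ := exists_formEval_eq hy b hw
  obtain ⟨u', hu', h⟩ := exists_mulLine_eq hy (Submodule.sub_mem _ hu (pencil_mem g hg hv)) (by
    rw [map_sub, formEval_pencil g y hv, hwz, sub_self])
  refine ⟨u', hu', mulLine_injective hy ?_⟩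
  rw [mulLine_pencil, h, map_sub, huz, hsq, sub_zero]

/-- If a pencil of differentials `P₂ → P₁ → P₀` is exact at `P₀` and `P₁` for every value of the
parameter, it is exact at `P₀` on binary forms of positive degree. -/
lemma exactBetween_pencil [IsAlgClosed K] [Module.Finite K P₀]
    (hg₁ : ∀ v, ∀ m ∈ P₁, g v m ∈ P₀) (hg₂ : ∀ v, ∀ m ∈ P₂, g v m ∈ P₁)
    (hsq : ∀ q, pencil K M g (pencil K M g q) = 0)
    (hex₀ : ∀ y ≠ 0, ExactBetween P₁ P₀ (g y)) (hex₁ : ∀ y ≠ 0, ExactBetween P₂ P₁ (g y))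
    (b : ℕ) :
    ExactBetween (coeffSeq P₁ (b + 1)) (coeffSeq P₀ (b + 2)) (pencil K M g) := by
  intro z hz hgz
  have hfin : Module.Finite K ↥(coeffSeq P₀ (b + 2) ⊓ LinearMap.ker (pencil K M g)) :=
    Submodule.finiteDimensional_of_le (S₂ := coeffSeq P₀ (b + 2)) inf_le_left
  have hinf : (![0, -1] : Fin 2 → K) ≠ 0 := fun h => by simpa using congrFun h 1
  have hline (z : ℕ → M) : mulLine M (![0, -1] : Fin 2 → K) z = z := by
    ext n; simp [mulLine_apply]
  have hBB' : (coeffSeq P₁ (b + 1)).map (pencil K M g) ≤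
      (coeffSeq P₁ (b + 2)).map (pencil K M g) :=
    Submodule.map_mono (coeffSeq_mono (by omega))
  refine le_of_no_eigenvector (coeffSeq P₀ (b + 2) ⊓ LinearMap.ker (pencil K M g))
    ((coeffSeq P₁ (b + 1)).map (pencil K M g)) ((coeffSeq P₁ (b + 2)).map (pencil K M g))
    (coeffShift K M) ?_ ?_ ?_ ?_ hBB' ⟨hz, hgz⟩
  · rintro _ ⟨u, hu, rfl⟩
    exact ⟨_, coeffShift_mem hu, (coeffShift_pencil g u).symm⟩
  · rintro z ⟨hz, hgz⟩
    obtain ⟨u, hu, z', hz', hgz', h⟩ := exists_pencil_sub_mulLine hg₁ hinf hsq (hex₀ _ hinf)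
      (coeffShift_mem hz) (by
        rw [← coeffShift_pencil, LinearMap.mem_ker.1 hgz, map_zero])
    rw [hline] at h
    exact ⟨z', ⟨hz', hgz'⟩, u, hu, by rw [h, sub_sub_cancel]⟩
  · rintro z ⟨hz, -⟩ h
    exact mem_map_pencil_of_mulLine_mem hg₂ hinf hsq (hex₁ _ hinf) hz (by rwa [hline])
  · rintro z ⟨hz, -⟩ c h
    have hc : (![1, c] : Fin 2 → K) ≠ 0 := fun h => by simpa using congrFun h 0
    refine mem_map_pencil_of_mulLine_mem hg₂ hc hsq (hex₁ _ hc) hz ?_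
    have : mulLine M (![1, c] : Fin 2 → K) z = coeffShift K M z - c • z := by
      ext n; simp [mulLine_apply]
    rwa [this]

end Exactness

section FirstFactor

variable {K : Type*} [Field K]

lemma exists_complement_line {t₀ : Fin 2 → K} (ht₀ : t₀ ≠ 0) :
    ∃ t₁ : Fin 2 → K, (∀ c : K, t₁ + c • t₀ ≠ 0) ∧ ∀ t, ∃ a b : K, t = a • t₁ + b • t₀ := by
  by_cases h0 : t₀ 0 = 0
  · have h1 : t₀ 1 ≠ 0 := by simpa [h0] using exists_ne_zero_of_fin_two ht₀
    refine ⟨![1, 0], fun c h => by simpa [h0] using congrFun h 0, fun t => ⟨t 0, t 1 / t₀ 1, ?_⟩⟩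
    ext i; fin_cases i <;> simp [h0, h1]
  · refine ⟨![0, 1], fun c h => ?_, fun t => ⟨t 1 - t 0 / t₀ 0 * t₀ 1, t 0 / t₀ 0, ?_⟩⟩
    · have hc : c = 0 := by simpa [h0] using congrFun h 0
      simpa [hc] using congrFun h 1
    · ext i; fin_cases i <;> simp [h0]

variable {M : Type*} [AddCommGroup M] [Module K M]

/-- The classes of the first factors of those `ψ` for which `D ψ : P 1 → P 0` is not onto. -/
def degeneracySet {k : ℕ} (P : ℕ → Submodule K M)
    (D : MultilinearMap K (fun _ : Fin (k + 1) => Fin 2 → K) (Module.End K M)) :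
    Set (Projectivization K (Fin 2 → K)) :=
  {x | ∃ ψ : Fin (k + 1) → Fin 2 → K, ∃ h : ∀ i, ψ i ≠ 0,
    (∃ z ∈ P 0, ∀ u ∈ P 1, D ψ u ≠ z) ∧ x = Projectivization.mk K (ψ 0) (h 0)}

/-- A pencil of linear maps onto a space of dimension `n` that is onto at some point drops rank
in at most `n` points of the projective line. -/
lemma finite_degeneracySet_of_one_slot (P : ℕ → Submodule K M) [Module.Finite K (P 0)]
    (D : MultilinearMap K (fun _ : Fin 1 => Fin 2 → K) (Module.End K M))
    (hdeg : ∀ ψ, ∀ u ∈ P 1, D ψ u ∈ P 0) {t₀ : Fin 2 → K} (ht₀ : t₀ ≠ 0)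
    (hsurj : ∀ z ∈ P 0, ∃ u ∈ P 1, D (fun _ => t₀) u = z) :
    (degeneracySet P D).Finite ∧ (degeneracySet P D).ncard ≤ Module.finrank K (P 0) := by
  classical
  let g (t : Fin 2 → K) : P 1 →ₗ[K] P 0 := (D fun _ => t).restrict (hdeg _)
  have hlin (a b : K) (t s : Fin 2 → K) : g (a • t + b • s) = a • g t + b • g s := by
    have h (t : Fin 2 → K) : D (fun _ => t) = D (Function.update 0 0 t) := by
      congr 1; ext i; fin_cases i; simp
    ext u
    simp [g, h, D.map_update_add, D.map_update_smul]
  have hg₀ : LinearMap.range (g t₀) = ⊤ := LinearMap.range_eq_top.2 fun z => by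
    obtain ⟨u, hu, huz⟩ := hsurj z z.2
    exact ⟨⟨u, hu⟩, Subtype.ext huz⟩
  obtain ⟨R, hR⟩ := (g t₀).exists_rightInverse_of_surjective hg₀
  obtain ⟨t₁, ht₁, hspan⟩ := exists_complement_line ht₀
  let T : Module.End K (P 0) := g t₁ ∘ₗ R
  let F : Finset (Projectivization K (Fin 2 → K)) :=
    T.charpoly.roots.toFinset.image fun μ => Projectivization.mk K (t₁ + (-μ) • t₀) (ht₁ _)
  have hsub : degeneracySet P D ⊆ F := by
    rintro _ ⟨ψ, hψ, ⟨z, hz, hzu⟩, rfl⟩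
    have hψ0 : ψ = fun _ => ψ 0 := by ext i; fin_cases i; rfl
    obtain ⟨a, b, hab⟩ := hspan (ψ 0)
    have hns : ¬ Function.Surjective (g (ψ 0)) := fun hs => by
      obtain ⟨u, hu⟩ := hs ⟨z, hz⟩
      refine hzu u u.2 ?_
      rw [hψ0]
      exact congrArg Subtype.val hu
    have hcomp : g (ψ 0) ∘ₗ R = a • T + b • LinearMap.id := by
      rw [hab, hlin, LinearMap.add_comp, LinearMap.smul_comp, LinearMap.smul_comp, hR]
    have hns' : ¬ Function.Surjective (a • T + b • LinearMap.id : Module.End K (P 0)) :=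
      fun hs => hns (by
        rw [← hcomp] at hs
        exact Function.Surjective.of_comp hs)
    have ha : a ≠ 0 := by
      rintro rfl
      have hb : b ≠ 0 := by
        rintro rfl
        exact hψ 0 (by simpa using hab)
      exact hns' fun z => ⟨b⁻¹ • z, by simp [hb]⟩
    have hroot : T.HasEigenvalue (-(b / a)) := by
      rw [Module.End.HasEigenvalue, Module.End.HasUnifEigenvalue, Ne,
        Module.End.genEigenspace_one]
      intro hker
      have hinj := LinearMap.ker_eq_bot.1 hker
      refine hns' fun z => ?_
      obtain ⟨w, hw⟩ := LinearMap.injective_iff_surjective.1 hinj (a⁻¹ • z)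
      refine ⟨w, ?_⟩
      have : a • (T - (-(b / a)) • (1 : Module.End K (P 0))) w = z := by
        rw [hw, smul_smul, mul_inv_cancel₀ ha, one_smul]
      rw [← this]
      simp [smul_smul, mul_div_cancel₀ _ ha]
    simp only [F, Finset.coe_image, Set.mem_image, Finset.mem_coe, Multiset.mem_toFinset]
    refine ⟨-(b / a), ?_, ?_⟩
    · rw [Polynomial.mem_roots T.charpoly_monic.ne_zero]
      exact (Module.End.hasEigenvalue_iff_isRoot_charpoly _ _).1 hroot
    · rw [Projectivization.mk_eq_mk_iff']
      refine ⟨a⁻¹, ?_⟩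
      rw [hab, smul_add, smul_smul, smul_smul, inv_mul_cancel₀ ha, one_smul, neg_neg,
        div_eq_inv_mul]
  refine ⟨F.finite_toSet.subset hsub, ?_⟩
  calc (degeneracySet P D).ncard ≤ (F : Set _).ncard := Set.ncard_le_ncard hsub F.finite_toSet
    _ = F.card := Set.ncard_coe_finset F
    _ ≤ T.charpoly.roots.toFinset.card := Finset.card_image_le
    _ ≤ T.charpoly.roots.card := Multiset.toFinset_card_le _
    _ ≤ T.charpoly.natDegree := T.charpoly.card_roots'
    _ = Module.finrank K (P 0) := T.charpoly_natDegree

/-- A Koszul-type complex depending multilinearly on `k + 1` vectors of `K²` that is exact in low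
degrees over one point of the first projective line is onto over all but at most
`(k + 1)! * dim (P 0)` points of it. -/
theorem finite_degeneracySet [IsAlgClosed K] [CharZero K] (k : ℕ) :
    ∀ {M : Type*} [AddCommGroup M] [Module K M] (P : ℕ → Submodule K M)
      [∀ p, Module.Finite K (P p)]
      (D : MultilinearMap K (fun _ : Fin (k + 1) => Fin 2 → K) (Module.End K M))
      (_ : ∀ ψ φ m, D ψ (D φ m) = -D φ (D ψ m))
      (_ : ∀ ψ p, ∀ m ∈ P (p + 1), D ψ m ∈ P p)
      (_ : ∀ ψ, ∀ m ∈ P 0, D ψ m = 0) {t₀ : Fin 2 → K} (_ : t₀ ≠ 0)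
      (_ : ∀ ψ, ψ 0 = t₀ → (∀ i, ψ i ≠ 0) → ∀ p ≤ k, ExactBetween (P (p + 1)) (P p) (D ψ)),
      (degeneracySet P D).Finite ∧
        (degeneracySet P D).ncard ≤ (k + 1).factorial * Module.finrank K (P 0) := by
  induction k with
  | zero =>
    intro M _ _ P _ D _ hdeg h0 t₀ ht₀ hex
    simpa using finite_degeneracySet_of_one_slot P D (fun ψ => hdeg ψ 0) ht₀
      fun z hz => hex _ rfl (fun _ => ht₀) 0 le_rfl z hz (h0 _ z hz)
  | succ k ih =>
    intro M _ _ P _ D hanti hdeg h0 t₀ ht₀ hex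
    let Q (p : ℕ) : Submodule K (ℕ → M) := coeffSeq (P p) (k + 2 - p)
    let E : MultilinearMap K (fun _ : Fin (k + 1) => Fin 2 → K) (Module.End K (ℕ → M)) :=
      (pencil K M).compMultilinearMap (MultilinearMap.curryRight D)
    have hE (ψ : Fin (k + 1) → Fin 2 → K) : E ψ = pencil K M (D.curryRight ψ) := rfl
    have hantiE ψ φ q : E ψ (E φ q) = -E φ (E ψ q) :=
      pencil_anticomm _ _ (fun v w m => hanti _ _ m) q
    have hsub : degeneracySet P D ⊆ degeneracySet Q E := by
      rintro _ ⟨ψ, hψ, ⟨z, hz, hzu⟩, rfl⟩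
      refine ⟨fun i => ψ i.castSucc, fun i => hψ _, ?_, rfl⟩
      obtain ⟨w, hw, rfl⟩ := exists_formEval_eq (hψ (Fin.last _)) (k + 1) hz
      refine ⟨w, hw, ?_⟩
      rintro u hu rfl
      refine hzu (formEval (ψ (Fin.last _)) (k + 1) u) (formEval_mem _ fun n => (hu n).1) ?_
      have hev := formEval_pencil (D.curryRight fun i => ψ i.castSucc) (ψ (Fin.last _)) hu
      refine Eq.trans ?_ hev.symm
      rw [MultilinearMap.curryRight_apply]
      congr 2
      exact (Fin.snoc_init_self ψ).symm
    obtain ⟨hfin, hcard⟩ := ih Q E hantiE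
      (fun ψ p q hq => by
        rcases le_or_gt p (k + 1) with hp | hp
        · have := pencil_mem (D.curryRight ψ) (P' := P p) (fun v => hdeg _ p) hq
          rwa [show k + 2 - (p + 1) + 1 = k + 2 - p by omega] at this
        · have : q = 0 := by
            ext n
            exact (hq n).2 (by omega)
          simp [this])
      (fun ψ q hq => by
        ext n
        simp only [hE, pencil_apply, MultilinearMap.curryRight_apply]
        rw [h0 _ _ (hq n).1, h0 _ _ (coeffShift_mem hq n).1]
        simp)
      ht₀
      (fun ψ hψ0 hψ p hp => by
        have hne : ∀ y : Fin 2 → K, y ≠ 0 → ∀ i, Fin.snoc (α := fun _ => Fin 2 → K) ψ y i ≠ 0 := by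
          intro y hy i
          refine Fin.lastCases ?_ (fun j => ?_) i
          · simpa using hy
          · simpa using hψ j
        have h00 (y : Fin 2 → K) : Fin.snoc (α := fun _ => Fin 2 → K) ψ y 0 = t₀ := by
          rw [← hψ0]
          exact Fin.snoc_castSucc (α := fun _ => Fin 2 → K) y ψ 0
        have := exactBetween_pencil (g := D.curryRight ψ) (P₀ := P p) (P₁ := P (p + 1))
          (P₂ := P (p + 2)) (fun v => hdeg _ _) (fun v => hdeg _ _)
          (fun q => by
            have h2 : (2 : K) • pencil K M (D.curryRight ψ) (pencil K M (D.curryRight ψ) q) = 0 := by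
              rw [two_smul]
              exact add_eq_zero_iff_eq_neg.2 (hantiE ψ ψ q)
            exact (smul_eq_zero.1 h2).resolve_left two_ne_zero)
          (fun y hy => hex _ (h00 y) (hne y hy) p (by omega))
          (fun y hy => hex _ (h00 y) (hne y hy) (p + 1) (by omega)) (k - p)
        simp only [Q]
        rwa [show k + 2 - p = k - p + 2 by omega, show k + 2 - (p + 1) = k - p + 1 by omega])
    refine ⟨hfin.subset hsub, (Set.ncard_le_ncard hsub hfin).trans (hcard.trans ?_)⟩
    calc (k + 1).factorial * Module.finrank K (Q 0)
        ≤ (k + 1).factorial * ((k + 2) * Module.finrank K (P 0)) :=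
          Nat.mul_le_mul_left _ (finrank_coeffSeq_le _ _)
      _ = (k + 1 + 1).factorial * Module.finrank K (P 0) := by
          rw [Nat.factorial_succ (k + 1)]; ring

end FirstFactor

section Contraction

open CliffordAlgebra

variable {K W : Type*} [Field K] [AddCommGroup W] [Module K W]

lemma contractLeft_mem_exteriorPower (d : Module.Dual K W) (p : ℕ) :
    ∀ m ∈ ⋀[K]^(p + 1) W, contractLeft (Q := 0) d m ∈ ⋀[K]^p W := by
  induction p with
  | zero =>
    intro m hm
    rw [ExteriorAlgebra.exteriorPower, zero_add, pow_one] at hm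
    obtain ⟨w, rfl⟩ := hm
    rw [ExteriorAlgebra.exteriorPower, pow_zero]
    exact (contractLeft_ι 0 w (d := d)).symm ▸ Submodule.algebraMap_mem _
  | succ p ih =>
    intro m hm
    rw [ExteriorAlgebra.exteriorPower, pow_succ'] at hm
    refine Submodule.mul_induction_on hm ?_ fun x y hx hy => ?_
    · rintro _ ⟨w, rfl⟩ n hn
      have h := contractLeft_ι_mul (Q := 0) d w n
      refine h.symm ▸ Submodule.sub_mem _ (Submodule.smul_mem _ _ hn) ?_
      rw [ExteriorAlgebra.exteriorPower, pow_succ']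
      exact Submodule.mul_mem_mul ⟨w, rfl⟩ (ih n hn)
    · rw [map_add]
      exact Submodule.add_mem _ hx hy

lemma exactBetween_contractLeft {d : Module.Dual K W} (hd : d ≠ 0) (p : ℕ) :
    ExactBetween (⋀[K]^(p + 1) W) (⋀[K]^p W) (contractLeft (Q := 0) d) := by
  intro z hz hdz
  obtain ⟨w, hw⟩ : ∃ w, d w ≠ 0 := by
    by_contra! h
    exact hd (LinearMap.ext h)
  refine ⟨ι (0 : QuadraticForm K W) ((d w)⁻¹ • w) * z, ?_, ?_⟩
  · rw [ExteriorAlgebra.exteriorPower, pow_succ']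
    exact Submodule.mul_mem_mul ⟨_, rfl⟩ hz
  · rw [contractLeft_ι_mul, hdz]
    simp [hw]

end Contraction

/-- `prodVec` as a multilinear map. -/
def prodVecMultilinear (m : ℕ) :
    MultilinearMap ℂ (fun _ : Fin m => Fin 2 → ℂ) ((Fin m → Fin 2) → ℂ) :=
  MultilinearMap.pi fun f =>
    (MultilinearMap.mkPiAlgebra ℂ (Fin m) ℂ).compLinearMap fun i => LinearMap.proj (f i)

lemma prodVecMultilinear_apply {m : ℕ} (φ : Fin m → Fin 2 → ℂ) :
    prodVecMultilinear m φ = prodVec φ := by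
  ext f
  simp [prodVecMultilinear, prodVec]

/-- **Lemma (first factors of product vectors in a subspace).**
Let `L ⊆ (ℂ²)^{⊗m}` be a subspace, `m ≥ 1`, and let
`X = { [|φ₁⟩] ∈ ℙ(ℂ²) : |φ₁⟩⊗…⊗|φ_m⟩ ∈ L for some nonzero |φ₁⟩,…,|φ_m⟩ }`.
Then either `X` is the whole projective line, or `X` is finite with `|X| ≤ m!`. -/
theorem first_factor_set_finite_or_univ (m : ℕ) (hm : 1 ≤ m)
    (L : Submodule ℂ ((Fin m → Fin 2) → ℂ)) :
    ∀ X : Set (Projectivization ℂ (Fin 2 → ℂ)),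
      X = {x | ∃ φ : Fin m → (Fin 2 → ℂ), ∃ h : ∀ i, φ i ≠ 0,
        prodVec φ ∈ L ∧ x = Projectivization.mk ℂ (φ ⟨0, hm⟩) (h ⟨0, hm⟩)} →
      X = Set.univ ∨ (X.Finite ∧ X.ncard ≤ m.factorial) := by
  rintro X rfl
  refine or_iff_not_imp_left.2 fun hX => ?_
  obtain ⟨x, hx⟩ := (Set.ne_univ_iff_exists_notMem _).1 hX
  obtain ⟨k, rfl⟩ := Nat.exists_eq_add_of_le' hm
  let W := Module.Dual ℂ (((Fin (k + 1) → Fin 2) → ℂ) ⧸ L)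
  let P (p : ℕ) : Submodule ℂ (ExteriorAlgebra ℂ W) := ⋀[ℂ]^p W
  let D : MultilinearMap ℂ (fun _ : Fin (k + 1) => Fin 2 → ℂ)
      (Module.End ℂ (ExteriorAlgebra ℂ W)) :=
    (CliffordAlgebra.contractLeft (Q := 0) ∘ₗ Module.Dual.eval ℂ _ ∘ₗ L.mkQ).compMultilinearMap
      (prodVecMultilinear (k + 1))
  have hD (ψ) : D ψ = CliffordAlgebra.contractLeft (Q := 0)
      (Module.Dual.eval ℂ _ (L.mkQ (prodVec ψ))) := by
    rw [← prodVecMultilinear_apply]; rfl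
  have hone (ψ) : ∀ z ∈ P 0, D ψ z = 0 := by
    intro z hz
    obtain ⟨c, rfl⟩ := Submodule.mem_one.1 (by simpa [P, ExteriorAlgebra.exteriorPower] using hz)
    rw [hD]
    exact CliffordAlgebra.contractLeft_algebraMap (Q := 0) _ c
  have hrank : Module.finrank ℂ (P 0) ≤ 1 := by
    simp [P, exteriorPower.finrank_eq]
  obtain ⟨hfin, hcard⟩ := finite_degeneracySet k P D
    (fun ψ φ z => by rw [hD, hD]; exact CliffordAlgebra.contractLeft_comm _ _ z)
    (fun ψ p => by rw [hD]; exact contractLeft_mem_exteriorPower _ p)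
    hone x.rep_nonzero
    (fun ψ hψ0 hψ p _ => by
      rw [hD]
      refine exactBetween_contractLeft (fun h => hx ⟨ψ, hψ, ?_, ?_⟩) p
      · rw [Module.eval_apply_eq_zero_iff] at h
        exact (Submodule.Quotient.mk_eq_zero L).1 h
      · rw [← x.mk_rep]
        congr 1
        exact hψ0.symm)
  have hsub : {x | ∃ φ : Fin (k + 1) → (Fin 2 → ℂ), ∃ h : ∀ i, φ i ≠ 0,
      prodVec φ ∈ L ∧ x = Projectivization.mk ℂ (φ ⟨0, hm⟩) (h ⟨0, hm⟩)} ⊆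
      degeneracySet P D := by
    rintro _ ⟨φ, hφ, hL, rfl⟩
    refine ⟨φ, hφ, ⟨1, ?_, fun u _ h => ?_⟩, rfl⟩
    · simp [P, ExteriorAlgebra.exteriorPower]
    · have hφL : L.mkQ (prodVec φ) = 0 := (Submodule.Quotient.mk_eq_zero L).2 hL
      simp [hD, hφL] at h
  refine ⟨hfin.subset hsub, (Set.ncard_le_ncard hsub hfin).trans (hcard.trans ?_)⟩
  simpa using Nat.mul_le_mul_left (k + 1).factorial hrank
end

section
/- Let a, b, c, r be natural numbers with 1 ≤ c ≤ a + b. Then F_{a,b,c}(r) = F_{a,b,c−1}(r−1) + ((a + r − (c−1))/(a + b − (c−1)))·h_{a,b,c−1}(r), where F_{a,b,c−1}(−1) := 0. In words: the cumulative distribution function of the hypergeometric distribution satisfies P(X_{a,b,c} ≤ r) = P(X_{a,b,c−1} ≤ r−1) + ((a+r−(c−1))/(a+b−(c−1)))·P(X_{a,b,c−1} = r). -/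
/-- The hypergeometric probability mass function: the probability of drawing exactly `i`
white balls when `c` balls are drawn without replacement from `a` black and `b` white
balls, `h_{a,b,c}(i) = C(a,c−i)·C(b,i)/C(a+b,c)` (zero for `i > c`). -/
noncomputable def hypergeomPMF (a b c i : ℕ) : ℝ :=
  if i ≤ c then ((a.choose (c - i) : ℝ) * (b.choose i : ℝ)) / ((a + b).choose c : ℝ)
  else 0

/-- The hypergeometric cumulative distribution function
`F_{a,b,c}(r) = P(X_{a,b,c} ≤ r) = Σ_{i=0}^{r} h_{a,b,c}(i)`. -/
noncomputable def hypergeomCDF (a b c r : ℕ) : ℝ :=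
  ∑ i ∈ Finset.range (r + 1), hypergeomPMF a b c i

/-- `Nat.choose_succ_right_eq` with real subtraction in place of truncated subtraction. -/
theorem cast_choose_succ_mul (m k : ℕ) :
    (m.choose (k + 1) : ℝ) * ((k : ℝ) + 1) = (m.choose k : ℝ) * ((m : ℝ) - k) := by
  rcases le_or_gt k m with h | h
  · have := Nat.choose_succ_right_eq m k
    rw [← Nat.cast_sub h]
    exact_mod_cast this
  · simp [Nat.choose_eq_zero_of_lt h, Nat.choose_eq_zero_of_lt (h.trans k.lt_succ_self)]

/-- Conversion of the normalisation by `C(a+b,n+1)` into the normalisation by `C(a+b,n)`. -/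
theorem div_choose_succ {m n : ℕ} (h : n < m) (x : ℝ) :
    x / (m.choose (n + 1) : ℝ) = x * ((n : ℝ) + 1) / (((m : ℝ) - n) * (m.choose n : ℝ)) := by
  have h₁ : (m.choose (n + 1) : ℝ) ≠ 0 := by exact_mod_cast (Nat.choose_pos h).ne'
  have h₂ : (n : ℝ) + 1 ≠ 0 := by positivity
  rw [mul_comm ((m : ℝ) - n), ← cast_choose_succ_mul, mul_div_mul_right _ _ h₂]

/-- No white ball after `n + 1` draws: none after `n` draws, followed by a black one. -/
theorem hypergeomPMF_succ_zero {a b n : ℕ} (h : n < a + b) :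
    hypergeomPMF a b (n + 1) 0 =
      ((a : ℝ) - n) / ((a : ℝ) + b - n) * hypergeomPMF a b n 0 := by
  simp only [hypergeomPMF, Nat.zero_le, if_true, Nat.sub_zero, Nat.choose_zero_right,
    Nat.cast_one, mul_one]
  rw [div_choose_succ h, cast_choose_succ_mul, div_mul_div_comm, Nat.cast_add, mul_comm (_ - _) (a.choose n : ℝ)]

/-- Conditioning on the colour of the last of `n + 1` drawn balls. -/
theorem hypergeomPMF_succ_succ {a b n : ℕ} (h : n < a + b) (i : ℕ) :
    hypergeomPMF a b (n + 1) (i + 1) =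
      ((a : ℝ) + (i + 1) - n) / ((a : ℝ) + b - n) * hypergeomPMF a b n (i + 1) +
        ((b : ℝ) - i) / ((a : ℝ) + b - n) * hypergeomPMF a b n i := by
  have hb := cast_choose_succ_mul b i
  rcases lt_trichotomy i n with hi | rfl | hi
  · obtain ⟨k, rfl⟩ := Nat.exists_eq_add_of_lt hi
    have ha := cast_choose_succ_mul a k
    have e₁ : i + k + 1 + 1 - (i + 1) = k + 1 := by omega
    have e₂ : i + k + 1 - (i + 1) = k := by omega
    have e₃ : i + k + 1 - i = k + 1 := by omega
    simp only [hypergeomPMF, e₁, e₂, e₃]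
    rw [if_pos (by omega), if_pos (by omega), if_pos (by omega), div_choose_succ h,
      div_mul_div_comm, div_mul_div_comm, ← add_div]
    push_cast
    congr 1
    linear_combination (b.choose (i + 1) : ℝ) * ha + (a.choose (k + 1) : ℝ) * hb
  · simp only [hypergeomPMF, Nat.sub_self, Nat.choose_zero_right, Nat.cast_one, one_mul, le_refl,
      if_true]
    rw [if_neg (by omega), div_choose_succ h, hb, div_mul_div_comm, mul_zero, zero_add,
      Nat.cast_add, mul_comm (_ - _) (b.choose i : ℝ)]
  · simp only [hypergeomPMF]
    rw [if_neg (by omega), if_neg (by omega), if_neg (by omega)]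
    simp

/-- **Hypergeometric CDF recursion in the number of draws.**
For `1 ≤ c ≤ a + b`,
`P(X_{a,b,c} ≤ r) = P(X_{a,b,c−1} ≤ r−1) + ((a+r−(c−1))/(a+b−(c−1)))·P(X_{a,b,c−1} = r)`,
with the convention `F_{a,b,c−1}(−1) = 0` (the sum `Σ_{i=0}^{r-1}` below is empty when
`r = 0`). -/
theorem hypergeomCDF_draw_recursion (a b c r : ℕ) (hc1 : 1 ≤ c) (hc2 : c ≤ a + b) :
    hypergeomCDF a b c r =
      (∑ i ∈ Finset.range r, hypergeomPMF a b (c - 1) i) +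
        (((a : ℝ) + r - ((c : ℝ) - 1)) / ((a : ℝ) + b - ((c : ℝ) - 1))) *
          hypergeomPMF a b (c - 1) r := by
  obtain ⟨n, rfl⟩ := Nat.exists_eq_add_of_le' hc1
  have hn : n < a + b := hc2
  have hD : (a : ℝ) + b - n ≠ 0 := by
    have : (n : ℝ) < a + b := by exact_mod_cast hn
    linarith
  simp only [hypergeomCDF, Nat.add_sub_cancel, Nat.cast_add, Nat.cast_one, add_sub_cancel_right]
  induction r with
  | zero => simp [hypergeomPMF_succ_zero hn]
  | succ r ih =>
    rw [Finset.sum_range_succ, ih, hypergeomPMF_succ_succ hn, Finset.sum_range_succ]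
    push_cast
    field_simp
    ring
end
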